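/- Let n > 4 be a natural number and let k be a positive integer. Then k ≥ n - 1 if and only if for every irreducible complex character χ of the symmetric group S_n with χ(1) > 1 and every irreducible complex character θ of S_n, there exists some j with 1 ≤ j ≤ k such that ⟨χ^j, θ⟩ is nonzero (i.e., every irreducible character is a constituent of some power χ^j with j ≤ k). -/

import Mathlib

open scoped ComplexOrder

noncomputable section

/-- `χ : G → ℂ` is the character of some finite-dimensional complex representation of `G`. -/
def IsChar (G : Type) [Group G] [Fintype G] (χ : G → ℂ) : Prop :=
  ∃ V : FDRep ℂ G, χ = V.character

/-- `χ : G → ℂ` is the character of some irreducible (simple) finite-dimensional complex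
representation of `G`. -/
def IsIrredChar (G : Type) [Group G] [Fintype G] (χ : G → ℂ) : Prop :=
  ∃ V : FDRep ℂ G, CategoryTheory.Simple V ∧ χ = V.character

/-- The usual inner product of class functions:
`⟨φ, ψ⟩ = |G|⁻¹ ∑ g, φ g * conj (ψ g)`. -/
def charInner (G : Type) [Group G] [Fintype G] (φ ψ : G → ℂ) : ℂ :=
  (Fintype.card G : ℂ)⁻¹ * ∑ g : G, φ g * (starRingEnd ℂ) (ψ g)

set_option linter.all false

namespace SymCov

section frame
variable {G : Type} [Group G] [Fintype G] {V W : Type} [AddCommGroup V] [Module ℂ V]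
  [AddCommGroup W] [Module ℂ W]

/-- space of matrix coefficients -/
def cf (ρ : G →* (V →ₗ[ℂ] V)) : Submodule ℂ (G → ℂ) :=
  Submodule.span ℂ (Set.range fun p : Module.Dual ℂ V × V => fun g => p.1 (ρ g p.2))

theorem cf_mem (ρ : G →* (V →ₗ[ℂ] V)) (φ : Module.Dual ℂ V) (v : V) :
    (fun g => φ (ρ g v)) ∈ cf ρ := Submodule.subset_span ⟨(φ, v), rfl⟩

/-- irreducibility -/
def Irr (ρ : G →* (V →ₗ[ℂ] V)) : Prop :=
  Nontrivial V ∧ ∀ U : Submodule ℂ V, (∀ g, ∀ v ∈ U, ρ g v ∈ U) → U = ⊥ ∨ U = ⊤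

/-- commutant consists of scalars -/
def Scal (ρ : G →* (V →ₗ[ℂ] V)) : Prop :=
  ∀ T : V →ₗ[ℂ] V, (∀ g, T * ρ g = ρ g * T) → ∃ c : ℂ, T = c • 1

theorem rho_inv_mul (ρ : G →* (V →ₗ[ℂ] V)) (g : G) : ρ g⁻¹ * ρ g = 1 := by
  rw [← map_mul]; simp
theorem rho_mul_inv (ρ : G →* (V →ₗ[ℂ] V)) (g : G) : ρ g * ρ g⁻¹ = 1 := by
  rw [← map_mul]; simp

theorem maschke (ρ : G →* (V →ₗ[ℂ] V)) (U : Submodule ℂ V) (hU : ∀ g, ∀ v ∈ U, ρ g v ∈ U) :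
    ∃ X : V →ₗ[ℂ] V, (∀ g, X * ρ g = ρ g * X) ∧ (∀ v, X v ∈ U) ∧ (∀ v ∈ U, X v = v) := by
  obtain ⟨U', hc⟩ := Submodule.exists_isCompl U
  set p : V →ₗ[ℂ] V := U.subtype ∘ₗ Submodule.projectionOnto U U' hc with hp
  have hp1 : ∀ v, p v ∈ U := fun v => by simp [hp]
  have hp2 : ∀ v ∈ U, p v = v := fun v hv => by
    simp only [hp, LinearMap.comp_apply]
    have := Submodule.projectionOnto_apply_left hc ⟨v, hv⟩
    simp only at this
    rw [this]; rfl
  have hcard : (Fintype.card G : ℂ) ≠ 0 := by simp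
  refine ⟨(Fintype.card G : ℂ)⁻¹ • ∑ g, ρ g * p * ρ g⁻¹, ?_, ?_, ?_⟩
  · intro h
    rw [smul_mul_assoc, mul_smul_comm, Finset.sum_mul, Finset.mul_sum]
    congr 1
    refine Fintype.sum_equiv (Equiv.mulLeft h⁻¹) _ _ fun g => ?_
    simp only [Equiv.coe_mulLeft, map_mul, mul_inv_rev, inv_inv]
    rw [← mul_assoc, ← mul_assoc, ← mul_assoc, ← mul_assoc, rho_mul_inv, one_mul]
  · intro v
    simp only [LinearMap.smul_apply, LinearMap.sum_apply]
    exact U.smul_mem _ (U.sum_mem fun g _ => hU _ _ (hp1 _))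
  · intro v hv
    have : ∀ g, (ρ g * p * ρ g⁻¹) v = v := fun g => by
      simp only [Module.End.mul_apply]
      rw [hp2 _ (hU _ _ hv), ← Module.End.mul_apply, rho_mul_inv]; rfl
    simp only [LinearMap.smul_apply, LinearMap.sum_apply, this]
    simp [← Nat.cast_smul_eq_nsmul ℂ, smul_smul]

theorem irr_of_scal [Nontrivial V] (ρ : G →* (V →ₗ[ℂ] V)) (h : Scal ρ) : Irr ρ := by
  refine ⟨inferInstance, fun U hU => ?_⟩
  obtain ⟨X, h1, h2, h3⟩ := maschke ρ U hU
  obtain ⟨c, rfl⟩ := h X h1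
  by_cases hc : c = 0
  · left
    rw [Submodule.eq_bot_iff]
    intro v hv
    simpa [hc] using (h3 v hv).symm
  · right
    rw [Submodule.eq_top_iff']
    intro v
    have := U.smul_mem c⁻¹ (h2 v)
    simpa [smul_smul, hc] using this

theorem scal_of_irr [FiniteDimensional ℂ V] (ρ : G →* (V →ₗ[ℂ] V)) (h : Irr ρ) : Scal ρ := by
  intro T hT
  have := h.1
  obtain ⟨c, hc⟩ := Module.End.exists_eigenvalue T
  refine ⟨c, ?_⟩
  rcases h.2 (Module.End.eigenspace T c) (fun g v hv => by
    rw [Module.End.mem_eigenspace_iff] at hv ⊢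
    have := LinearMap.congr_fun (hT g) v
    simp only [Module.End.mul_apply] at this
    rw [this, hv, map_smul]) with h1 | h1
  · exact absurd h1 hc
  · ext v
    have : v ∈ Module.End.eigenspace T c := by rw [h1]; trivial
    simpa using Module.End.mem_eigenspace_iff.1 this

/-- precomposition algebra hom -/
def pre {H : Type} (f : H → G) : (G → ℂ) →ₐ[ℂ] (H → ℂ) :=
  AlgHom.pi (fun h => Pi.evalAlgHom ℂ (fun _ : G => ℂ) (f h))

@[simp] theorem pre_apply {H : Type} (f : H → G) (F : G → ℂ) (h : H) : pre f F h = F (f h) := rfl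

theorem cf_map {H : Type} [Group H] [Fintype H] (ρ : G →* (V →ₗ[ℂ] V)) (f : H →* G) :
    (cf ρ).map (pre f).toLinearMap = cf (ρ.comp f) := by
  rw [cf, cf, Submodule.map_span, ← Set.range_comp]; rfl

theorem cf_map_pow {H : Type} [Group H] [Fintype H] (ρ : G →* (V →ₗ[ℂ] V)) (f : H →* G) (k : ℕ)
    (F : H → ℂ) (hF : F ∈ (cf (ρ.comp f)) ^ k) : ∃ F' ∈ (cf ρ) ^ k, ∀ h, F' (f h) = F h := by
  rw [← cf_map, ← Submodule.map_pow] at hF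
  obtain ⟨F', h1, h2⟩ := hF
  exact ⟨F', h1, fun h => congr_fun h2 h⟩

theorem cf_transl (ρ : G →* (V →ₗ[ℂ] V)) (a b : G) (F : G → ℂ) (hF : F ∈ cf ρ) :
    (fun g => F (a * g * b)) ∈ cf ρ := by
  have : (cf ρ).map (pre (fun g => a * g * b)).toLinearMap ≤ cf ρ := by
    conv_lhs => rw [cf, Submodule.map_span]
    rw [Submodule.span_le]
    rintro _ ⟨_, ⟨⟨φ, v⟩, rfl⟩, rfl⟩
    have := cf_mem ρ (φ ∘ₗ ρ a) (ρ b v)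
    have h2 : (pre (fun g => a * g * b)).toLinearMap (fun g => φ (ρ g v)) =
        fun g => (φ ∘ₗ ρ a) (ρ g (ρ b v)) := by
      ext g
      change φ (ρ (a * g * b) v) = _
      simp [map_mul]
    rw [← h2] at this
    exact this
  exact this ⟨F, hF, rfl⟩

end frame
end SymCov

namespace SymCov

section frame2
variable {G : Type} [Group G] [Fintype G] {V W : Type} [AddCommGroup V] [Module ℂ V]
  [AddCommGroup W] [Module ℂ W] [FiniteDimensional ℂ V] [FiniteDimensional ℂ W]

theorem tens_pow (ρ : G →* (V →ₗ[ℂ] V)) (k : ℕ) :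
    ∃ (U : Type) (_ : AddCommGroup U) (_ : Module ℂ U) (_ : FiniteDimensional ℂ U)
      (τ : G →* (U →ₗ[ℂ] U)), (∀ g, Representation.character τ g = (Representation.character ρ g) ^ k) ∧
        (cf ρ) ^ k ≤ cf τ := by
  induction k with
  | zero =>
    refine ⟨ℂ, inferInstance, inferInstance, inferInstance, 1, fun g => ?_, ?_⟩
    · simp [Representation.character]
    · rw [pow_zero, Submodule.one_eq_span, Submodule.span_le]
      rintro _ rfl
      have := cf_mem (1 : G →* (ℂ →ₗ[ℂ] ℂ)) LinearMap.id 1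
      have h1 : (1 : G → ℂ) = fun g => LinearMap.id (R := ℂ) (((1 : G →* (ℂ →ₗ[ℂ] ℂ)) g) (1:ℂ)) := by
        ext g; simp
      rw [SetLike.mem_coe, h1]; exact this
  | succ k ih =>
    obtain ⟨U, i1, i2, i3, τ, h1, h2⟩ := ih
    refine ⟨TensorProduct ℂ U V, inferInstance, inferInstance, inferInstance,
      Representation.tprod (V := U) (W := V) τ ρ, fun g => ?_, ?_⟩
    · rw [Representation.char_tensor]
      simp [h1, pow_succ]
    · rw [pow_succ]
      refine (mul_le_mul' h2 le_rfl).trans ?_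
      conv_lhs => rw [cf, cf, Submodule.span_mul_span]
      rw [Submodule.span_le]
      rintro _ ⟨_, ⟨⟨φ, u⟩, rfl⟩, _, ⟨⟨ψ, v⟩, rfl⟩, rfl⟩
      have := cf_mem (Representation.tprod (V := U) (W := V) τ ρ)
        (TensorProduct.lift (LinearMap.mk₂ ℂ (fun a b => φ a * ψ b)
          (by intros; simp [add_mul]) (by intros; simp [mul_assoc])
          (by intros; simp [mul_add]) (by intros; simp; ring))) (u ⊗ₜ v)
      simp only [Representation.tprod_apply, TensorProduct.map_tmul, TensorProduct.lift.tmul,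
        LinearMap.mk₂_apply] at this
      exact this

theorem detect (ρ : G →* (V →ₗ[ℂ] V)) (σ : G →* (W →ₗ[ℂ] W)) (k : ℕ) (F : G → ℂ)
    (hF : F ∈ (cf ρ) ^ k) (h : ∑ g, F g • σ g⁻¹ ≠ 0) :
    ∑ g, (Representation.character ρ g) ^ k * Representation.character σ g⁻¹ ≠ 0 := by
  obtain ⟨U, i1, i2, i3, τ, h1, h2⟩ := tens_pow ρ k
  intro h0
  have : Invertible (Nat.card G : ℂ) := invertibleOfNonzero (by simp)
  have key := Representation.card_inv_mul_sum_char_mul_char_eq_finrank (ρ := σ) (σ := τ)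
  simp only [h1, h0, mul_zero] at key
  have hz : Module.finrank ℂ (Representation.IntertwiningMap σ τ) = 0 := by
    exact_mod_cast key.symm
  have hsub : ∀ T : W →ₗ[ℂ] U, (∀ g w, T (σ g w) = τ g (T w)) → T = 0 := by
    intro T hT
    let T' : Representation.IntertwiningMap σ τ := ⟨T, fun g => by ext w; exact hT g w⟩
    have e : Module.Finite ℂ (Representation.IntertwiningMap σ τ) :=
      Module.Finite.of_injective ({ toFun := fun f => f.toLinearMap, map_add' := fun _ _ => rfl, map_smul' := fun _ _ => rfl } : Representation.IntertwiningMap σ τ →ₗ[ℂ] (W →ₗ[ℂ] U))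
        (Representation.IntertwiningMap.toLinearMap_injective _ _)
    have : T' = 0 := by
      have := Module.finrank_zero_iff.1 hz
      exact Subsingleton.elim _ _
    have h3 : T'.toLinearMap = 0 := by rw [this]; rfl
    exact h3
  apply h
  have hall : ∀ F ∈ cf τ, ∑ g, F g • σ g⁻¹ = 0 := by
    intro F hF
    induction hF using Submodule.span_induction with
    | mem x hx =>
      obtain ⟨⟨φ, u⟩, rfl⟩ := hx
      ext w
      rw [← sub_eq_zero, LinearMap.zero_apply, sub_zero]
      by_contra hne
      obtain ⟨ψ, hψ⟩ := (Module.forall_dual_apply_eq_zero_iff ℂ _).not.2 hne |> not_forall.1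
      apply hψ
      have := hsub (∑ g, τ g ∘ₗ (LinearMap.smulRight ψ u) ∘ₗ σ g⁻¹) (by
        intro h w
        simp only [LinearMap.sum_apply, LinearMap.comp_apply, map_sum]
        refine Fintype.sum_equiv (Equiv.mulLeft h⁻¹) _ _ fun g => ?_
        simp only [Equiv.coe_mulLeft, mul_inv_rev, inv_inv, map_mul, Module.End.mul_apply]
        rw [← Module.End.mul_apply (τ h), rho_mul_inv]; rfl)
      have h4 := congrArg φ (LinearMap.congr_fun this w)
      simp only [LinearMap.sum_apply, LinearMap.comp_apply, map_sum, LinearMap.smulRight_apply,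
        map_smul, smul_eq_mul, LinearMap.zero_apply, map_zero] at h4
      simp only [LinearMap.sum_apply, LinearMap.smul_apply, map_sum, map_smul, smul_eq_mul]
      rw [← h4]
      exact Finset.sum_congr rfl fun g _ => mul_comm _ _
    | zero => simp
    | add x y _ _ hx hy => simp [add_smul, Finset.sum_add_distrib, hx, hy]
    | smul a x _ hx => simp [mul_smul, ← Finset.smul_sum, hx]
  exact hall F (h2 hF)

theorem conj_char (σ : G →* (W →ₗ[ℂ] W)) (g : G) :
    (starRingEnd ℂ) (Representation.character σ g) = Representation.character σ g⁻¹ := by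
  classical
  let b := Module.finBasis ℂ W
  let M : G → Matrix _ _ ℂ := fun g => LinearMap.toMatrix b b (σ g)
  have hM : ∀ g h, M (g * h) = M g * M h := fun g h => by
    simp only [M, map_mul]; exact LinearMap.toMatrix_mul b _ _
  have hM1 : M 1 = 1 := by simp [M]
  have htr : ∀ g, Representation.character σ g = (M g).trace := fun g => by
    rw [Representation.character, LinearMap.trace_eq_matrix_trace ℂ b]
  open Matrix in
  let S : Matrix _ _ ℂ := ∑ g, (M g)ᴴ * M g
  have hS : S.PosDef := by
    simp only [S]
    rw [← Finset.add_sum_erase _ _ (Finset.mem_univ (1 : G))]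
    refine Matrix.PosDef.add_posSemidef ?_ ?_
    · rw [hM1]; simpa using Matrix.PosDef.one
    · exact Matrix.posSemidef_sum _ fun g _ => Matrix.posSemidef_conjTranspose_mul_self _
  have hinv : ∀ h, (M h).conjTranspose * S * M h = S := fun h => by
    simp only [S, Finset.mul_sum, Finset.sum_mul]
    refine Fintype.sum_equiv (Equiv.mulRight h) _ _ fun g => ?_
    simp only [Equiv.coe_mulRight, hM, Matrix.conjTranspose_mul, Matrix.mul_assoc]
  have hu : IsUnit S := hS.isUnit
  have hdet : IsUnit S.det := (Matrix.isUnit_iff_isUnit_det S).1 hu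
  have e1 : (M g).conjTranspose * S = S * M g⁻¹ := by
    conv_rhs => rw [← hinv g]
    rw [Matrix.mul_assoc, ← hM, mul_inv_cancel, hM1, Matrix.mul_one]
  have e2 : (M g).conjTranspose = S * M g⁻¹ * S⁻¹ := by
    rw [← e1, Matrix.mul_assoc, Matrix.mul_nonsing_inv _ hdet, Matrix.mul_one]
  rw [htr, htr, starRingEnd_apply, ← Matrix.trace_conjTranspose, e2, Matrix.trace_mul_comm,
    ← Matrix.mul_assoc, Matrix.nonsing_inv_mul _ hdet, Matrix.one_mul]

end frame2
end SymCov

namespace SymCov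

section bridge
variable {G : Type} [Group G] [Fintype G] {V W : Type} [AddCommGroup V] [Module ℂ V]
  [FiniteDimensional ℂ V]

theorem norm_iff (ρ : G →* (V →ₗ[ℂ] V)) :
    (∑ g, Representation.character ρ g * Representation.character ρ g⁻¹ = Nat.card G) ↔ Irr ρ := by
  have : Invertible (Nat.card G : ℂ) := invertibleOfNonzero (by simp)
  have key := Representation.card_inv_mul_sum_char_mul_char_eq_finrank (ρ := ρ) (σ := ρ)
  have hc : (Nat.card G : ℂ) ≠ 0 := by simp
  have e1 : (∑ g, Representation.character ρ g * Representation.character ρ g⁻¹ = Nat.card G) ↔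
      Module.finrank ℂ (Representation.IntertwiningMap ρ ρ) = 1 := by
    constructor
    · intro h
      rw [h] at key
      simp at key
      exact_mod_cast key.symm
    · intro h
      rw [h] at key
      have k2 := congrArg (fun x => (Nat.card G : ℂ) * x) key
      simp only [← mul_assoc, mul_inv_cancel₀ hc, one_mul, Nat.cast_one, mul_one] at k2
      exact k2
  rw [e1]
  constructor
  · intro h
    have hnt : Nontrivial V := by
      by_contra hn
      rw [not_nontrivial_iff_subsingleton] at hn
      have : Subsingleton (Representation.IntertwiningMap ρ ρ) :=
        ⟨fun a b => Representation.IntertwiningMap.ext (by ext v; exact Subsingleton.elim _ _)⟩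
      rw [Module.finrank_zero_of_subsingleton] at h
      exact absurd h (by norm_num)
    refine irr_of_scal ρ fun T hT => ?_
    have hne : Representation.IntertwiningMap.id ρ ≠ 0 := by
      intro h0
      obtain ⟨v, hv⟩ := exists_ne (0 : V)
      exact hv (congrArg (fun f => f.toLinearMap v) h0)
    obtain ⟨c, hc⟩ := (finrank_eq_one_iff_of_nonzero' _ hne).1 h ⟨T, fun g => hT g⟩
    exact ⟨c, congrArg (fun f => f.toLinearMap) hc.symm⟩
  · intro h
    have hs := scal_of_irr ρ h
    have := h.1
    have hne : Representation.IntertwiningMap.id ρ ≠ 0 := by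
      intro h0
      obtain ⟨v, hv⟩ := exists_ne (0 : V)
      exact hv (congrArg (fun f => f.toLinearMap v) h0)
    refine (finrank_eq_one_iff_of_nonzero' _ hne).2 fun f => ?_
    obtain ⟨c, hc⟩ := hs f.toLinearMap (fun g => f.isIntertwining' g)
    exact ⟨c, Representation.IntertwiningMap.ext hc.symm⟩

theorem irr_of_simple (V : FDRep ℂ G) (h : CategoryTheory.Simple V) : Irr V.ρ := by
  rw [FDRep.simple_iff_char_is_norm_one] at h
  rw [← norm_iff]
  exact h

theorem simple_of_irr (ρ : G →* (V →ₗ[ℂ] V)) (h : Irr ρ) :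
    CategoryTheory.Simple (FDRep.of ρ) := by
  rw [FDRep.simple_iff_char_is_norm_one]
  exact (norm_iff ρ).2 h

theorem cf_self (ρ : G →* (V →ₗ[ℂ] V)) (X : V →ₗ[ℂ] V) :
    (fun g => LinearMap.trace ℂ V (X * ρ g)) ∈ cf ρ := by
  let b := Module.finBasis ℂ V
  have : (fun g => LinearMap.trace ℂ V (X * ρ g)) =
      ∑ i, fun g => (b.coord i ∘ₗ X) (ρ g (b i)) := by
    ext g
    rw [LinearMap.trace_eq_matrix_trace ℂ b, Finset.sum_apply, Matrix.trace]
    simp [LinearMap.toMatrix_apply]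
  rw [this]
  exact Submodule.sum_mem _ fun i _ => cf_mem ρ _ _

end bridge

section selfdual
variable {G : Type} [Group G] [Fintype G] {V : Type} [AddCommGroup V] [Module ℂ V]
  [FiniteDimensional ℂ V]

theorem detect1 (ρ : G →* (V →ₗ[ℂ] V)) (h : Irr ρ)
    (hsd : ∀ g, Representation.character ρ g⁻¹ = Representation.character ρ g)
    (F : G → ℂ) (hF : F ∈ cf ρ) : (fun g => F g⁻¹) ∈ cf ρ := by
  -- the span of translates of the character
  let χ : G → ℂ := Representation.character ρ
  let T : Submodule ℂ (G → ℂ) := Submodule.span ℂ (Set.range fun a : G => fun g => χ (a * g))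
  have hχ : χ ∈ cf ρ := by
    have := cf_self ρ 1
    simp only [one_mul] at this
    exact this
  have hclass : ∀ a b, χ (a * b) = χ (b * a) := fun a b => by
    simp only [χ, Representation.character, map_mul]
    exact LinearMap.trace_mul_comm ℂ _ _
  have hT : ∀ F ∈ T, (fun g => F g⁻¹) ∈ cf ρ := by
    intro F hF
    induction hF using Submodule.span_induction with
    | mem x hx =>
      obtain ⟨a, rfl⟩ := hx
      have := cf_transl ρ 1 a⁻¹ χ hχ
      convert this using 2 with g
      have : (a * g⁻¹) = (g * a⁻¹)⁻¹ := by group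
      change χ (a * g⁻¹) = _
      rw [this, one_mul]; exact hsd _
    | zero => exact Submodule.zero_mem _
    | add x y _ _ hx hy => exact Submodule.add_mem _ hx hy
    | smul a x _ hx => exact Submodule.smul_mem _ a hx
  -- Burnside style: the span of ρ g is everything acting on dual
  suffices h' : cf ρ ≤ T from hT F (h' hF)
  -- Σ_h χ(h⁻¹ g) φ(ρ h v) = c φ(ρ g v)
  have hs := scal_of_irr ρ h
  have hE : ∀ X : V →ₗ[ℂ] V, ∃ c : ℂ, ∑ g, ρ g * X * ρ g⁻¹ = c • 1 := fun X => hs _ (by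
    intro h
    rw [Finset.sum_mul, Finset.mul_sum]
    refine Fintype.sum_equiv (Equiv.mulLeft h⁻¹) _ _ fun g => ?_
    simp only [Equiv.coe_mulLeft, map_mul, mul_inv_rev, inv_inv]
    rw [← mul_assoc, ← mul_assoc, ← mul_assoc, ← mul_assoc, rho_mul_inv, one_mul])
  let P : V →ₗ[ℂ] V := ∑ g, χ g⁻¹ • ρ g
  obtain ⟨c, hc⟩ := hs P (by
    intro h
    simp only [P, Finset.sum_mul, Finset.mul_sum]
    refine Fintype.sum_equiv (MulAut.conj h⁻¹).toEquiv _ _ fun g => ?_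
    simp only [MulEquiv.toEquiv_eq_coe, EquivLike.coe_coe, MulAut.conj_apply, map_mul, inv_inv,
      mul_inv_rev, mul_assoc, rho_inv_mul, mul_one, smul_mul_assoc, mul_smul_comm]
    rw [← mul_assoc (ρ h), rho_mul_inv, one_mul]
    congr 1
    rw [← mul_assoc, hclass, ← mul_assoc, mul_inv_cancel, one_mul])
  have hc0 : c ≠ 0 := by
    rintro rfl
    have h2 := (norm_iff ρ).2 h
    have h3 : LinearMap.trace ℂ V P = Nat.card G := by
      rw [← h2]
      simp only [P, map_sum, map_smul, smul_eq_mul]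
      refine Finset.sum_congr rfl fun g _ => ?_
      rw [mul_comm]; rfl
    rw [hc] at h3
    rw [zero_smul, map_zero] at h3
    exact (by simp : (Nat.card G : ℂ) ≠ 0) h3.symm
  rw [cf, Submodule.span_le]
  rintro _ ⟨⟨φ, v⟩, rfl⟩
  have : (fun g => φ (ρ g v)) = c⁻¹ • ∑ h, φ (ρ h v) • fun g => χ (h⁻¹ * g) := by
    ext g
    simp only [Pi.smul_apply, Finset.sum_apply, smul_eq_mul]
    have h1 := congrArg φ (LinearMap.congr_fun hc (ρ g v))
    simp only [P, LinearMap.sum_apply, LinearMap.smul_apply, Module.End.one_apply, map_sum,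
      map_smul, smul_eq_mul] at h1
    rw [← mul_right_inj' hc0, ← h1, ← mul_assoc, mul_inv_cancel₀ hc0, one_mul]
    refine Fintype.sum_equiv (Equiv.mulRight g) _ _ fun x => ?_
    simp only [Equiv.coe_mulRight, map_mul, Module.End.mul_apply, mul_inv_rev]
    rw [mul_comm, hclass]; congr 2; group
  rw [SetLike.mem_coe]
  simp only
  rw [this]
  exact Submodule.smul_mem _ _ (Submodule.sum_mem _ fun a _ => Submodule.smul_mem _ _
    (Submodule.subset_span ⟨a⁻¹, rfl⟩))

/-- conj coefficient -/
theorem dmem (ρ : G →* (V →ₗ[ℂ] V)) (h : Irr ρ)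
    (hsd : ∀ g, Representation.character ρ g⁻¹ = Representation.character ρ g)
    (X : V →ₗ[ℂ] V) (Y : Module.Dual ℂ (V →ₗ[ℂ] V)) :
    (fun g => Y (ρ g * X * ρ g⁻¹)) ∈ cf ρ ^ 2 := by
  let b := Module.finBasis ℂ V
  have hY : ∀ Z : V →ₗ[ℂ] V, Y Z = ∑ i, ∑ j, b.coord i (Z (b j)) * Y (LinearMap.toSpanSingleton ℂ V (b i) ∘ₗ b.coord j) := by
    intro Z
    have : Z = ∑ i, ∑ j, b.coord i (Z (b j)) • (LinearMap.toSpanSingleton ℂ V (b i) ∘ₗ b.coord j) := by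
      refine b.ext fun k => ?_
      simp only [LinearMap.sum_apply, LinearMap.smul_apply, LinearMap.comp_apply,
        Module.Basis.coord_apply, Module.Basis.repr_self, LinearMap.toSpanSingleton_apply,
        Finsupp.single_apply, ite_smul, one_smul, zero_smul, smul_ite, smul_zero]
      simp [b.sum_repr]
    conv_lhs => rw [this]
    simp only [map_sum, map_smul, smul_eq_mul]
  have : (fun g => Y (ρ g * X * ρ g⁻¹)) = ∑ i, ∑ j, ∑ k,
      Y (LinearMap.toSpanSingleton ℂ V (b i) ∘ₗ b.coord j) •
      ((fun g => b.coord i (ρ g (X (b k)))) * (fun g => b.coord k (ρ g⁻¹ (b j)))) := by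
    ext g
    rw [hY]
    simp only [Finset.sum_apply, Pi.smul_apply, Pi.mul_apply, smul_eq_mul, ← Finset.mul_sum]
    refine Finset.sum_congr rfl fun i _ => Finset.sum_congr rfl fun j _ => ?_
    rw [mul_comm]
    congr 1
    have e : ρ g⁻¹ (b j) = ∑ k, b.coord k (ρ g⁻¹ (b j)) • b k := (b.sum_repr _).symm
    conv_lhs => rw [Module.End.mul_apply, e]
    simp only [map_sum, map_smul, smul_eq_mul, Module.End.mul_apply]
    exact Finset.sum_congr rfl fun k _ => mul_comm _ _
  rw [this]
  refine Submodule.sum_mem _ fun i _ => Submodule.sum_mem _ fun j _ => Submodule.sum_mem _ fun k _ => Submodule.smul_mem _ _ ?_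
  rw [pow_two]
  exact Submodule.mul_mem_mul (cf_mem _ _ _) (detect1 ρ h hsd _ (cf_mem ρ (b.coord k) (b j)))

end selfdual
end SymCov

namespace SymCov
open Equiv

section sym
variable {α : Type} [Fintype α] [DecidableEq α] {V W : Type} [AddCommGroup V] [Module ℂ V]
  [FiniteDimensional ℂ V] [AddCommGroup W] [Module ℂ W] [FiniteDimensional ℂ W]

theorem sd (ρ : Perm α →* (V →ₗ[ℂ] V)) (g : Perm α) :
    Representation.character ρ g⁻¹ = Representation.character ρ g := by
  have h : IsConj g g⁻¹ := by
    rw [Equiv.Perm.isConj_iff_cycleType_eq, Equiv.Perm.cycleType_inv]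
  obtain ⟨c, hc⟩ := isConj_iff.1 h
  rw [← hc]
  simp only [Representation.character, map_mul]
  rw [LinearMap.trace_mul_comm, ← mul_assoc, rho_inv_mul, one_mul]

theorem dmemS (ρ : Perm α →* (V →ₗ[ℂ] V)) (h : Irr ρ) (X : V →ₗ[ℂ] V)
    (Y : Module.Dual ℂ (V →ₗ[ℂ] V)) : (fun g => Y (ρ g * X * ρ g⁻¹)) ∈ cf ρ ^ 2 :=
  dmem ρ h (sd ρ) X Y

theorem one_mem_sq (ρ : Perm α →* (V →ₗ[ℂ] V)) (h : Irr ρ) : (1 : Perm α → ℂ) ∈ cf ρ ^ 2 := by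
  have := h.1
  obtain ⟨Y, hY⟩ := not_forall.1 ((Module.forall_dual_apply_eq_zero_iff ℂ (1 : V →ₗ[ℂ] V)).not.2 one_ne_zero)
  have h1 := Submodule.smul_mem _ (Y 1)⁻¹ (dmemS ρ h 1 Y)
  convert h1 using 1
  ext g
  simp [rho_mul_inv, hY]

theorem pow_le_two (ρ : Perm α →* (V →ₗ[ℂ] V)) (h : Irr ρ) (k : ℕ) : cf ρ ^ k ≤ cf ρ ^ (k + 2) := by
  intro F hF
  rw [pow_add]
  have := Submodule.mul_mem_mul hF (one_mem_sq ρ h)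
  rwa [mul_one] at this

/-- irreducible of degree other than one -/
def NL (σ : Perm α →* (W →ₗ[ℂ] W)) : Prop := Irr σ ∧ Module.finrank ℂ W ≠ 1

theorem scalar_faithful (hn : 5 ≤ Fintype.card α) (σ : Perm α →* (W →ₗ[ℂ] W)) (h : NL σ)
    (g : Perm α) (hg : ∃ c : ℂ, σ g = c • 1) : g = 1 := by
  by_contra hne
  let N : Subgroup (Perm α) :=
    { carrier := {g | ∃ c : ℂ, σ g = c • 1}
      one_mem' := ⟨1, by simp⟩
      mul_mem' := by
        rintro a b ⟨c, hc⟩ ⟨d, hd⟩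
        exact ⟨c * d, by rw [map_mul, hc, hd]; simp [smul_smul, mul_comm]⟩
      inv_mem' := by
        rintro a ⟨c, hc⟩
        refine ⟨c⁻¹, ?_⟩
        have h1 := rho_inv_mul σ a
        have hc0 : c ≠ 0 := by
          rintro rfl
          rw [hc, zero_smul, mul_zero] at h1
          have := h.1.1
          exact zero_ne_one h1
        rw [hc, mul_smul_comm, mul_one] at h1
        rw [← h1, smul_smul, inv_mul_cancel₀ hc0, one_smul] }
  have hN : N.Normal := ⟨by
    rintro a ⟨c, hc⟩ b
    refine ⟨c, ?_⟩
    rw [map_mul, map_mul, hc, mul_smul_comm, mul_one, smul_mul_assoc, rho_mul_inv]⟩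
  have hnt : Nontrivial N := ⟨⟨⟨g, hg⟩, 1, fun hh => hne (congrArg Subtype.val hh)⟩⟩
  have hA := Equiv.Perm.alternatingGroup_le_of_normal (α := α) (by simpa using hn) hnt
  have : Nontrivial α := by rw [← Fintype.one_lt_card_iff_nontrivial]; omega
  obtain ⟨x, y, hxy⟩ := exists_pair_ne α
  have := h.1.1
  obtain ⟨c, hc⟩ := Module.End.exists_eigenvalue (σ (swap x y))
  obtain ⟨v, hv⟩ := hc.exists_hasEigenvector
  have hv0 := hv.2
  have hv1 := hv.apply_eq_smul
  have hU := h.1.2 (Submodule.span ℂ {v}) (by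
    intro g w hw
    obtain ⟨a, rfl⟩ := Submodule.mem_span_singleton.1 hw
    rw [map_smul]
    refine Submodule.smul_mem _ _ ?_
    rcases Int.units_eq_one_or (Perm.sign g) with hs | hs
    · obtain ⟨d, hd⟩ := hA (Perm.mem_alternatingGroup.2 hs)
      rw [hd]
      exact Submodule.smul_mem _ _ (Submodule.mem_span_singleton_self v)
    · obtain ⟨d, hd⟩ := hA (Perm.mem_alternatingGroup.2
        (show Perm.sign (g * swap x y) = 1 by simp [hs, Perm.sign_swap hxy]))
      have e : g = (g * swap x y) * swap x y := by rw [mul_assoc, swap_mul_self, mul_one]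
      rw [e, map_mul, hd, Module.End.mul_apply, hv1]
      exact Submodule.smul_mem _ _ (Submodule.smul_mem _ _ (Submodule.mem_span_singleton_self v)))
  rcases hU with hU | hU
  · exact hv0 (by simpa using hU)
  · exact h.2 (by rw [← finrank_top, ← hU, finrank_span_singleton hv0])

theorem lin_char (σ : Perm α →* (W →ₗ[ℂ] W)) (h : Module.finrank ℂ W = 1) :
    (∀ g, σ g = 1) ∨ (∀ g, σ g = ((Perm.sign g : ℤ) : ℂ) • 1) := by
  have hsc : ∀ T : W →ₗ[ℂ] W, ∃ c : ℂ, T = c • 1 := by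
    intro T
    obtain ⟨v, hv, hw⟩ := finrank_eq_one_iff'.1 h
    obtain ⟨c, hc⟩ := hw (T v)
    refine ⟨c, ?_⟩
    ext w
    obtain ⟨d, rfl⟩ := hw w
    simp [← hc, smul_comm c d]
  have hnt : Nontrivial W := Module.nontrivial_of_finrank_pos (R := ℂ) (by omega)
  rcases subsingleton_or_nontrivial α with hs | hs
  · left
    intro g
    rw [Subsingleton.elim g 1, map_one]
  obtain ⟨x, y, hxy⟩ := exists_pair_ne α
  obtain ⟨c, hc⟩ := hsc (σ (swap x y))
  have hall : ∀ a b, a ≠ b → σ (swap a b) = c • 1 := by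
    intro a b hab
    obtain ⟨g, hg⟩ := isConj_iff.1 (Perm.isConj_swap hxy hab)
    rw [← hg, map_mul, map_mul, hc, mul_smul_comm, mul_one, smul_mul_assoc, rho_mul_inv]
  have hc2 : c * c = 1 := by
    have : σ (swap x y) * σ (swap x y) = 1 := by rw [← map_mul, swap_mul_self, map_one]
    rw [hc] at this
    simp only [smul_mul_smul_comm, mul_one] at this
    obtain ⟨w, hw⟩ := exists_ne (0 : W)
    have := LinearMap.congr_fun this w
    simp only [LinearMap.smul_apply, Module.End.one_apply] at this
    exact smul_left_injective ℂ hw (by simpa using this)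
  rcases mul_self_eq_one_iff.1 hc2 with rfl | rfl
  · left
    intro g
    induction g using Perm.swap_induction_on with
    | one => simp
    | swap_mul f a b hab ih => rw [map_mul, hall a b hab, ih]; simp
  · right
    intro g
    induction g using Perm.swap_induction_on with
    | one => simp
    | swap_mul f a b hab ih => rw [map_mul, hall a b hab, ih]; simp [Perm.sign_swap hab]

theorem supp_ind (S : Finset α) (P : Perm α → Prop) (h1 : P 1)
    (h2 : ∀ a ∈ S, ∀ b ∈ S, a ≠ b → ∀ g, P g → P (swap a b * g)) (g : Perm α)
    (hg : ∀ x, x ∉ S → g x = x) : P g := by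
  induction hk : g.support.card using Nat.strong_induction_on generalizing g with
  | _ k ih =>
    by_cases hne : g = 1
    · rw [hne]; exact h1
    · obtain ⟨a, ha⟩ : ∃ a, g a ≠ a := by
        by_contra hh; push Not at hh; exact hne (Equiv.ext hh)
      have haS : a ∈ S := by by_contra hh; exact ha (hg a hh)
      have hbS : g a ∈ S := by
        by_contra hh; exact ha (g.injective (hg _ hh))
      have := Perm.card_support_swap_mul ha
      have h3 := ih _ (by rw [← hk]; exact this) (swap a (g a) * g) (by
        intro x hx
        rw [Perm.mul_apply, hg x hx, swap_apply_of_ne_of_ne]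
        · rintro rfl; exact hx haS
        · rintro rfl; exact hx hbS) rfl
      have h4 := h2 a haS (g a) hbS (Ne.symm ha) _ h3
      rwa [← mul_assoc, swap_mul_self, one_mul] at h4

/-- The covering property -/
def Cov (ρ : Perm α →* (V →ₗ[ℂ] V)) : Prop :=
  (∀ (W : Type) [AddCommGroup W] [Module ℂ W] [FiniteDimensional ℂ W]
    (σ : Perm α →* (W →ₗ[ℂ] W)), NL σ → ∃ j, 1 ≤ j ∧ j ≤ Fintype.card α - 1 ∧ ∃ F ∈ cf ρ ^ j,
      ∑ g, F g • σ g⁻¹ ≠ 0) ∧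
  (∃ j, 1 ≤ j ∧ j ≤ Fintype.card α - 1 ∧ ∃ F ∈ cf ρ ^ j, ∑ g, F g * ((Perm.sign g : ℤ) : ℂ) ≠ 0)

end sym

theorem upper_of_cov (n : ℕ) (hn : 4 < n)
    (H : ∀ (V : Type) [AddCommGroup V] [Module ℂ V] [FiniteDimensional ℂ V]
      (ρ : Perm (Fin n) →* (V →ₗ[ℂ] V)), NL ρ → Cov ρ)
    (V : FDRep ℂ (Perm (Fin n))) (hV : CategoryTheory.Simple V) (h1 : 1 < V.character 1)
    (W : FDRep ℂ (Perm (Fin n))) (hW : CategoryTheory.Simple W) :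
    ∃ j : ℕ, 1 ≤ j ∧ j ≤ n - 1 ∧ 
      ∑ g, (V.character ^ j) g * (starRingEnd ℂ) (W.character g) ≠ 0 := by
  have hV' := irr_of_simple V hV
  have hW' := irr_of_simple W hW
  have hNL : NL V.ρ := by
    refine ⟨hV', fun h => ?_⟩
    rw [FDRep.char_one] at h1
    rw [h] at h1
    simp at h1
  obtain ⟨C1, C2⟩ := H V V.ρ hNL
  simp only [Fintype.card_fin] at C1 C2
  have key : ∃ j : ℕ, 1 ≤ j ∧ j ≤ n - 1 ∧ ∃ F ∈ cf V.ρ ^ j, ∑ g, F g • W.ρ g⁻¹ ≠ 0 := by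
    by_cases hf : Module.finrank ℂ W = 1
    · have hnt : Nontrivial W := hW'.1
      rcases lin_char W.ρ hf with hl | hl
      · refine ⟨2, by omega, by omega, 1, one_mem_sq _ hV', ?_⟩
        simp only [hl, Pi.one_apply, one_smul, Finset.sum_const]
        rw [← Nat.cast_smul_eq_nsmul ℂ]
        exact smul_ne_zero (by simp) one_ne_zero
      · obtain ⟨j, a, b, F, hF, hs⟩ := C2
        refine ⟨j, a, b, F, hF, ?_⟩
        simp only [hl, Perm.sign_inv, smul_smul, ← Finset.sum_smul]
        exact smul_ne_zero hs one_ne_zero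
    · exact C1 W W.ρ ⟨hW', hf⟩
  obtain ⟨j, a, b, F, hF, hs⟩ := key
  refine ⟨j, a, b, ?_⟩
  have := detect V.ρ W.ρ j F hF hs
  have e : ∀ g, (V.character ^ j) g * (starRingEnd ℂ) (W.character g) =
      (Representation.character V.ρ g) ^ j * Representation.character W.ρ g⁻¹ := fun g => by
    rw [← conj_char W.ρ g]; rfl
  simp only [e]
  exact this

end SymCov

namespace SymCov
open Equiv

section two
variable {β : Type} [Fintype β] [DecidableEq β] {V : Type} [AddCommGroup V] [Module ℂ V]

theorem cf_transl_pow {G : Type} [Group G] [Fintype G] (ρ : G →* (V →ₗ[ℂ] V)) (a b : G) (k : ℕ)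
    (F : G → ℂ) (hF : F ∈ cf ρ ^ k) : (fun g => F (a * g * b)) ∈ cf ρ ^ k := by
  have h1 : (cf ρ).map (pre (fun g => a * g * b)).toLinearMap ≤ cf ρ := by
    rintro _ ⟨F, hF, rfl⟩
    exact cf_transl ρ a b F hF
  have h2 := pow_le_pow_left' h1 k
  rw [← Submodule.map_pow] at h2
  exact h2 ⟨F, hF, rfl⟩

theorem rho_swap (ρ : Perm β →* (V →ₗ[ℂ] V)) (g : Perm β) (x z : β) :
    ρ (swap (g x) (g z)) = ρ g * ρ (swap x z) * ρ g⁻¹ := by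
  rw [← map_mul, ← map_mul, Equiv.swap_apply_apply]

/-- depth-one functions -/
def U1 (ρ : Perm β →* (V →ₗ[ℂ] V)) : Submodule ℂ (β → ℂ) where
  carrier := {y | ∀ x, (fun g : Perm β => y (g x)) ∈ cf ρ ^ 2}
  zero_mem' := fun x => Submodule.zero_mem _
  add_mem' := fun ha hb x => Submodule.add_mem _ (ha x) (hb x)
  smul_mem' := fun c y hy x => Submodule.smul_mem _ c (hy x)

/-- depth-two functions -/
def U2 (ρ : Perm β →* (V →ₗ[ℂ] V)) : Submodule ℂ (β → β → ℂ) where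
  carrier := {y | ∀ x z, x ≠ z → (fun g : Perm β => y (g x) (g z)) ∈ cf ρ ^ 2}
  zero_mem' := fun x z _ => Submodule.zero_mem _
  add_mem' := fun ha hb x z h => Submodule.add_mem _ (ha x z h) (hb x z h)
  smul_mem' := fun c y hy x z h => Submodule.smul_mem _ c (hy x z h)

theorem U1_inv (ρ : Perm β →* (V →ₗ[ℂ] V)) (y : β → ℂ) (hy : y ∈ U1 ρ) (h : Perm β) :
    (fun a => y (h a)) ∈ U1 ρ := by
  intro x
  have := cf_transl_pow ρ h 1 2 _ (hy x)
  simpa using this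

theorem U2_inv (ρ : Perm β →* (V →ₗ[ℂ] V)) (y : β → β → ℂ) (hy : y ∈ U2 ρ) (h : Perm β) :
    (fun a b => y (h a) (h b)) ∈ U2 ρ := by
  intro x z hxz
  have := cf_transl_pow ρ h 1 2 _ (hy x z hxz)
  simpa using this

theorem U2_diag (ρ : Perm β →* (V →ₗ[ℂ] V)) (y : β → β → ℂ) (hy : ∀ a b, a ≠ b → y a b = 0) :
    y ∈ U2 ρ := by
  intro x z hxz
  convert Submodule.zero_mem _ using 1
  ext g
  exact hy _ _ (fun h => hxz (g.injective h))

/-- symmetric unit -/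
def es (p q : β) : β → β → ℂ := fun u v =>
  (if u = p then 1 else 0) * (if v = q then 1 else 0) + (if u = q then 1 else 0) * (if v = p then 1 else 0)
/-- antisymmetric unit -/
def ea (p q : β) : β → β → ℂ := fun u v =>
  (if u = p then 1 else 0) * (if v = q then 1 else 0) - (if u = q then 1 else 0) * (if v = p then 1 else 0)
/-- row sums -/
def Es (p : β) : β → β → ℂ := fun u v => (if u = p then 1 else 0) + (if v = p then 1 else 0)

theorem es_comm (p q : β) : es p q = es q p := by
  ext u v; simp only [es]; ring
theorem es_sum (p : β) : ∑ x, es p x = Es p := by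
  ext u v
  simp only [es, Es, Finset.sum_apply, Finset.sum_add_distrib, ← Finset.mul_sum, ← Finset.sum_mul]
  simp
theorem es_self (ρ : Perm β →* (V →ₗ[ℂ] V)) (p : β) : es p p ∈ U2 ρ := by
  refine U2_diag ρ _ fun a b hab => ?_
  simp only [es]
  by_cases h1 : a = p
  · have : b ≠ p := fun h => hab (h1.trans h.symm)
    simp [this]
  · simp [h1]
/-- h-functions -/
def hs (p q : β) : β → β → ℂ := ((Fintype.card β : ℂ) - 2) • es p q - Es p - Es q
theorem hs_comm (p q : β) : hs p q = hs q p := by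
  rw [hs, hs, es_comm]; abel

variable [FiniteDimensional ℂ V]

theorem b0z (ρ : Perm β →* (V →ₗ[ℂ] V)) (hρ : Irr ρ) {a b c d : β} (hab : a ≠ b) (hac : a ≠ c)
    (had : a ≠ d) (hbc : b ≠ c) (hbd : b ≠ d) (hcd : c ≠ d)
    (hq : ρ (swap a b) + ρ (swap c d) - ρ (swap a c) - ρ (swap b d) ≠ 0) :
    es a b + es c d - es a c - es b d ∈ U2 ρ := by
  obtain ⟨Y, hY⟩ := not_forall.1 ((Module.forall_dual_apply_eq_zero_iff ℂ _).not.2 hq)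
  set y : β → β → ℂ := fun u v => Y (ρ (swap u v)) with hy
  have hyU : y ∈ U2 ρ := by
    intro x z _
    simp only [hy, rho_swap]
    exact dmemS ρ hρ _ Y
  have hsym : ∀ u v, y u v = y v u := fun u v => by simp only [hy, swap_comm]
  have hyq : y a b + y c d - y a c - y b d ≠ 0 := by
    simpa only [hy, map_add, map_sub] using hY
  clear_value y
  have h1 := U2 ρ |>.sub_mem hyU (U2_inv ρ y hyU (swap b c))
  have h2 := U2 ρ |>.sub_mem h1 (U2_inv ρ _ h1 (swap a d))
  have h3 := U2 ρ |>.smul_mem (y a b + y c d - y a c - y b d)⁻¹ h2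
  convert h3 using 1
  ext u v
  simp only [Pi.smul_apply, Pi.sub_apply, Pi.add_apply, smul_eq_mul, es]
  rw [eq_inv_mul_iff_mul_eq₀ hyq]
  have k1 := hab.symm; have k2 := hac.symm; have k3 := had.symm
  have k4 := hbc.symm; have k5 := hbd.symm; have k6 := hcd.symm
  have cases5 : ∀ w : β, w = a ∨ w = b ∨ w = c ∨ w = d ∨ (w ≠ a ∧ w ≠ b ∧ w ≠ c ∧ w ≠ d) := by
    intro w; tauto
  clear h1 h2 h3 hY hq hy hyU
  have q1 := hsym b a; have q2 := hsym c a; have q3 := hsym d a; have q4 := hsym c b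
  have q5 := hsym d b; have q6 := hsym d c
  clear hsym
  rcases cases5 u with rfl | rfl | rfl | rfl | ⟨u1, u2, u3, u4⟩ <;>
  rcases cases5 v with rfl | rfl | rfl | rfl | ⟨v1, v2, v3, v4⟩ <;>
  simp [swap_apply_def, *] <;> ring

/-- hypothesis giving enough distinct transposition sums -/
def QN (ρ : Perm β →* (V →ₗ[ℂ] V)) : Prop := ∀ a b c d : β, a ≠ b → a ≠ c → a ≠ d → b ≠ c → b ≠ d → c ≠ d →
    ρ (swap a b) + ρ (swap c d) - ρ (swap a c) - ρ (swap b d) ≠ 0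

theorem b0h (ρ : Perm β →* (V →ₗ[ℂ] V)) (hρ : Irr ρ) (hQ : QN ρ) {a b c : β} (hab : a ≠ b) (hac : a ≠ c) :
    hs a b - hs a c ∈ U2 ρ := by
  rcases eq_or_ne b c with rfl | hbc
  · rw [sub_self]; exact Submodule.zero_mem _
  have hz : ∀ d, d ≠ b → d ≠ c → es a b + es c d - es a c - es b d ∈ U2 ρ := by
    intro d hdb hdc
    rcases eq_or_ne a d with rfl | had
    · rw [es_comm c a, es_comm b a]
      convert Submodule.zero_mem _ using 1; abel
    · exact b0z ρ hρ hab hac had hbc hdb.symm hdc.symm (hQ a b c d hab hac had hbc hdb.symm hdc.symm)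
  have h1 : ∑ d, (es a b + es c d - es a c - es b d) -
      (es a b + es c b - es a c - es b b) - (es a b + es c c - es a c - es b c) ∈ U2 ρ := by
    rw [← Finset.add_sum_erase _ _ (Finset.mem_univ b),
      ← Finset.add_sum_erase _ _ (Finset.mem_erase.2 ⟨hbc.symm, Finset.mem_univ c⟩)]
    have : ∀ A B C : β → β → ℂ, A + (B + C) - A - B = C := fun A B C => by abel
    rw [this]
    refine Submodule.sum_mem _ fun d hd => ?_
    simp only [Finset.mem_erase, Finset.mem_univ, and_true] at hd
    exact hz d hd.2 hd.1
  have h2 := (U2 ρ).add_mem ((U2 ρ).sub_mem h1 (es_self ρ b)) (es_self ρ c)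
  convert h2 using 1
  simp only [Finset.sum_add_distrib, Finset.sum_sub_distrib, es_sum, Finset.sum_const,
    Finset.card_univ, hs, ← Nat.cast_smul_eq_nsmul ℂ, es_comm c b]
  module

theorem b0h' (ρ : Perm β →* (V →ₗ[ℂ] V)) (hρ : Irr ρ) (hQ : QN ρ) {a b c d : β} (hab : a ≠ b) (hcd : c ≠ d) :
    hs a b - hs c d ∈ U2 ρ := by
  rcases eq_or_ne a c with rfl | hac
  · exact b0h ρ hρ hQ hab hcd
  · have h1 := b0h ρ hρ hQ hab hac
    have h2 := b0h ρ hρ hQ hac.symm hcd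
    have := (U2 ρ).add_mem h1 h2
    rw [hs_comm a c] at this
    simpa using this

theorem b0 (ρ : Perm β →* (V →ₗ[ℂ] V)) (hρ : Irr ρ) (hQ : QN ρ) (hn : 3 ≤ Fintype.card β)
    (γ : β → β → ℂ) (h1 : ∀ a b, γ a b = γ b a) (h2 : ∀ a, γ a a = 0) (h3 : ∀ a, ∑ b, γ a b = 0) :
    γ ∈ U2 ρ := by
  have hn2 : (Fintype.card β : ℂ) - 2 ≠ 0 := by
    rw [sub_ne_zero]; intro h
    have : Fintype.card β = 2 := by exact_mod_cast h
    omega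
  have : Nontrivial β := by rw [← Fintype.one_lt_card_iff_nontrivial]; omega
  obtain ⟨p, q, hpq⟩ := exists_pair_ne β
  have e1 : ∑ a, ∑ b, γ a b • (hs a b - hs p q) ∈ U2 ρ := by
    refine Submodule.sum_mem _ fun a _ => Submodule.sum_mem _ fun b _ => ?_
    rcases eq_or_ne a b with rfl | hab
    · rw [h2, zero_smul]; exact Submodule.zero_mem _
    · exact Submodule.smul_mem _ _ (b0h' ρ hρ hQ hab hpq)
  have h3' : ∀ b, ∑ a, γ a b = 0 := fun b => by rw [← h3 b]; exact Finset.sum_congr rfl fun a _ => h1 a b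
  have e2 : ∑ a, ∑ b, γ a b • es a b = (2 : ℂ) • γ := by
    ext u v
    simp only [Finset.sum_apply, Pi.smul_apply, smul_eq_mul, es, mul_add, Finset.sum_add_distrib]
    simp only [mul_ite, mul_one, mul_zero, Finset.sum_ite_eq, Finset.mem_univ, if_true]
    simp
    rw [h1 v u]; ring
  have e3 : ∑ a, ∑ b, γ a b • (hs a b - hs p q) = ((Fintype.card β : ℂ) - 2) • ((2 : ℂ) • γ) := by
    rw [← e2]
    simp only [hs, smul_sub, Finset.sum_sub_distrib, ← Finset.sum_smul, h3, zero_smul,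
      Finset.sum_const_zero, sub_zero, smul_zero]
    rw [Finset.sum_comm (f := fun a b => γ a b • Es b)]
    simp only [← Finset.sum_smul, h3', zero_smul, Finset.sum_const_zero, sub_zero]
    simp only [Finset.smul_sum, smul_comm (γ _ _)]
  rw [e3, smul_smul] at e1
  have := (U2 ρ).smul_mem (((Fintype.card β : ℂ) - 2) * 2)⁻¹ e1
  rwa [smul_smul, inv_mul_cancel₀ (by simp [hn2]), one_smul] at this

end two
end SymCov

namespace SymCov
open Equiv

/-- indicator of pointwise fixing -/
def fixInd {β : Type} (S : Finset β) : Perm β → ℂ :=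
  open Classical in fun g => if ∀ s ∈ S, g s = s then 1 else 0

section case1
variable {β : Type} [Fintype β] [DecidableEq β] {V : Type} [AddCommGroup V] [Module ℂ V]
  [FiniteDimensional ℂ V]

/-- equivariant family of idempotents -/
structure Fam (ρ : Perm β →* (V →ₗ[ℂ] V)) (X : β → (V →ₗ[ℂ] V)) : Prop where
  equi : ∀ g a, ρ g * X a = X (g a) * ρ g
  idem : ∀ a, X a * X a = X a
  ns : ∀ a, ¬ ∃ c : ℂ, X a = c • 1

variable {ρ : Perm β →* (V →ₗ[ℂ] V)} {X : β → (V →ₗ[ℂ] V)}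

theorem Fam.ne (hX : Fam ρ X) (hs : Scal ρ) {a b : β} (hab : a ≠ b) : X a ≠ X b := by
  intro h
  have hall : ∀ c, X c = X a := by
    intro c
    rcases eq_or_ne c a with rfl | hc
    · rfl
    have h1 := hX.equi (swap b c) a
    have h2 := hX.equi (swap b c) b
    rw [swap_apply_left] at h2
    rw [swap_apply_of_ne_of_ne hab hc.symm] at h1
    rw [h] at h1
    have h3 : X b * ρ (swap b c) = X c * ρ (swap b c) := h1.symm.trans h2
    have h4 := congrArg (· * ρ (swap b c)⁻¹) h3
    simp only [mul_assoc, rho_mul_inv, mul_one] at h4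
    rw [← h4, h]
  exact hX.ns a (hs (X a) fun g => by rw [hX.equi, hall (g a)])

theorem Fam.conj (hX : Fam ρ X) (g : Perm β) (a : β) : X (g a) = ρ g * X a * ρ g⁻¹ := by
  rw [hX.equi, mul_assoc, rho_mul_inv, mul_one]

theorem Fam.U1top (hX : Fam ρ X) (hρ : Irr ρ) (hn : 2 ≤ Fintype.card β) (y : β → ℂ) : y ∈ U1 ρ := by
  have hs := scal_of_irr ρ hρ
  have : Nontrivial β := by rw [← Fintype.one_lt_card_iff_nontrivial]; omega
  obtain ⟨a, b, hab⟩ := exists_pair_ne β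
  have hone : (1 : β → ℂ) ∈ U1 ρ := fun x => one_mem_sq ρ hρ
  obtain ⟨Y, hY⟩ := not_forall.1 ((Module.forall_dual_apply_eq_zero_iff ℂ _).not.2
    (sub_ne_zero.2 (hX.ne hs hab)))
  rw [map_sub] at hY
  have hyU : (fun c => Y (X c)) ∈ U1 ρ := by
    intro x
    simp only [hX.conj]
    exact dmemS ρ hρ _ _
  have hdiff : (Pi.single a 1 - Pi.single b 1 : β → ℂ) ∈ U1 ρ := by
    have h1 := (U1 ρ).smul_mem (Y (X a) - Y (X b))⁻¹
      ((U1 ρ).sub_mem hyU (U1_inv ρ _ hyU (swap a b)))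
    convert h1 using 1
    ext c
    simp only [Pi.sub_apply, Pi.smul_apply, smul_eq_mul]
    rw [eq_inv_mul_iff_mul_eq₀ hY]
    rcases eq_or_ne c a with rfl | hca
    · simp [hab]
    rcases eq_or_ne c b with rfl | hcb
    · simp [hca]
    · simp [hca, hcb, swap_apply_of_ne_of_ne hca hcb]
  have hall : ∀ p q : β, (Pi.single p 1 - Pi.single q 1 : β → ℂ) ∈ U1 ρ := by
    intro p q
    rcases eq_or_ne p q with rfl | hpq
    · rw [sub_self]; exact Submodule.zero_mem _
    obtain ⟨h, h1, h2⟩ : ∃ h : Perm β, h p = a ∧ h q = b := by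
      refine ⟨swap (swap p a q) b * swap p a, ?_, ?_⟩
      · rw [Perm.mul_apply, swap_apply_left, swap_apply_of_ne_of_ne _ hab]
        intro hh
        exact hpq ((swap p a).injective (by rw [swap_apply_left, ← hh]))
      · rw [Perm.mul_apply, swap_apply_left]
    convert U1_inv ρ _ hdiff h using 1
    ext c
    simp only [Pi.sub_apply, Pi.single_apply, ← h1, ← h2, h.injective.eq_iff]
  have hδ : ∀ p, (Pi.single p 1 : β → ℂ) ∈ U1 ρ := by
    intro p
    have h1 : ∑ q, (Pi.single p 1 - Pi.single q 1 : β → ℂ) + 1 ∈ U1 ρ :=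
      (U1 ρ).add_mem (Submodule.sum_mem _ fun q _ => hall p q) hone
    have h2 := (U1 ρ).smul_mem (Fintype.card β : ℂ)⁻¹ h1
    have hc : (Fintype.card β : ℂ) ≠ 0 := by
      simp
    convert h2 using 1
    ext c
    simp [Finset.sum_apply, Finset.sum_sub_distrib, Pi.single_apply]
  have : y = ∑ p, y p • (Pi.single p 1 : β → ℂ) := by
    ext c; simp [Finset.sum_apply, Pi.single_apply]
  rw [this]
  exact Submodule.sum_mem _ fun p _ => Submodule.smul_mem _ _ (hδ p)

theorem Fam.left (hX : Fam ρ X) (hρ : Irr ρ) (hn : 2 ≤ Fintype.card β) (f : β → ℂ) :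
    (fun u v => f u) ∈ U2 ρ := fun x z _ => hX.U1top hρ hn f x
theorem Fam.right (hX : Fam ρ X) (hρ : Irr ρ) (hn : 2 ≤ Fintype.card β) (f : β → ℂ) :
    (fun u v => f v) ∈ U2 ρ := fun x z _ => hX.U1top hρ hn f z

theorem Fam.es (hX : Fam ρ X) (hρ : Irr ρ) (hQ : QN ρ) (hn : 3 ≤ Fintype.card β) {a b : β} (hab : a ≠ b) :
    SymCov.es a b ∈ U2 ρ := by
  have hn2 : (Fintype.card β : ℂ) - 2 ≠ 0 := by
    rw [sub_ne_zero]; intro h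
    have : Fintype.card β = 2 := by exact_mod_cast h
    omega
  have hn1 : (Fintype.card β : ℂ) - 1 ≠ 0 := by
    rw [sub_ne_zero]; intro h
    have : Fintype.card β = 1 := by exact_mod_cast h
    omega
  have hE : ∀ p, Es p ∈ U2 ρ := fun p => (U2 ρ).add_mem (hX.left hρ (by omega) fun u => if u = p then 1 else 0)
    (hX.right hρ (by omega) fun u => if u = p then 1 else 0)
  have h1 : ∀ c, c ≠ a → SymCov.es a b - SymCov.es a c ∈ U2 ρ := by
    intro c hc
    have h2 := b0h ρ hρ hQ hab hc.symm
    have h3 := (U2 ρ).smul_mem ((Fintype.card β : ℂ) - 2)⁻¹ ((U2 ρ).sub_mem ((U2 ρ).add_mem h2 (hE b)) (hE c))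
    convert h3 using 1
    rw [eq_inv_smul_iff₀ hn2, hs, hs]
    module
  have h2 : ∑ c, (SymCov.es a b - SymCov.es a c) - (SymCov.es a b - SymCov.es a a) ∈ U2 ρ := by
    rw [← Finset.add_sum_erase _ _ (Finset.mem_univ a), add_sub_cancel_left]
    exact Submodule.sum_mem _ fun c hc => h1 c (Finset.ne_of_mem_erase hc)
  have h3 := (U2 ρ).smul_mem ((Fintype.card β : ℂ) - 1)⁻¹
    ((U2 ρ).add_mem ((U2 ρ).sub_mem h2 (es_self ρ a)) (hE a))
  convert h3 using 1
  rw [eq_inv_smul_iff₀ hn1, Finset.sum_sub_distrib, es_sum, Finset.sum_const, Finset.card_univ,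
    ← Nat.cast_smul_eq_nsmul ℂ]
  module

theorem Fam.exK (hX : Fam ρ X) (hρ : Irr ρ) (hn : 2 ≤ Fintype.card β) :
    ∃ a b c : β, a ≠ b ∧ a ≠ c ∧ b ≠ c ∧
      (X a * X b - X b * X a) + (X b * X c - X c * X b) + (X c * X a - X a * X c) ≠ 0 := by
  by_contra hcon
  push Not at hcon
  have hs := scal_of_irr ρ hρ
  have hcard : (Fintype.card β : ℂ) ≠ 0 := by
    rw [Nat.cast_ne_zero]; omega
  have hall : ∀ a b c, (X a * X b - X b * X a) + (X b * X c - X c * X b) + (X c * X a - X a * X c) = 0 := by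
    intro a b c
    rcases eq_or_ne a b with rfl | hab
    · abel
    rcases eq_or_ne a c with rfl | hac
    · abel
    rcases eq_or_ne b c with rfl | hbc
    · abel
    exact hcon a b c hab hac hbc
  obtain ⟨κ, hκ⟩ := hs (∑ c, X c) (by
    intro g
    rw [Finset.sum_mul, Finset.mul_sum]
    refine Fintype.sum_equiv g⁻¹ _ _ fun c => ?_
    rw [hX.equi]; simp)
  have hcomm : ∀ a b, X a * X b = X b * X a := by
    intro a b
    have h1 : ∑ c, ((X a * X b - X b * X a) + (X b * X c - X c * X b) + (X c * X a - X a * X c)) = 0 :=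
      Finset.sum_eq_zero fun c _ => hall a b c
    simp only [Finset.sum_add_distrib, Finset.sum_sub_distrib, ← Finset.mul_sum, ← Finset.sum_mul,
      hκ, Finset.sum_const, Finset.card_univ] at h1
    simp only [mul_smul_comm, smul_mul_assoc, mul_one, one_mul, sub_self, add_zero] at h1
    rw [← smul_sub, ← Nat.cast_smul_eq_nsmul ℂ] at h1
    exact sub_eq_zero.1 ((smul_eq_zero.1 h1).resolve_left hcard)
  have : Nontrivial β := by rw [← Fintype.one_lt_card_iff_nontrivial]; omega
  obtain ⟨a, b, hab⟩ := exists_pair_ne β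
  set t : β → β → (V →ₗ[ℂ] V) := fun x y => ρ (swap x y) with ht
  have htsym : ∀ x y, t x y = t y x := fun x y => by simp only [ht, swap_comm]
  obtain ⟨μ, hμ⟩ := hs (∑ x, ∑ y, t x y) (by
    intro g
    simp only [Finset.sum_mul, Finset.mul_sum]
    refine Fintype.sum_equiv g⁻¹ _ _ fun x => Fintype.sum_equiv g⁻¹ _ _ fun y => ?_
    have := rho_swap ρ g (g⁻¹ x) (g⁻¹ y)
    have ii : ∀ x, g (g⁻¹ x) = x := fun x => by rw [← Perm.mul_apply, mul_inv_cancel]; rfl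
    rw [ii, ii] at this
    simp only [ht]
    rw [this, mul_assoc, rho_inv_mul, mul_one])
  have htX : ∀ x y c, t x y * X c = X (swap x y c) * t x y := fun x y c => hX.equi _ _
  -- X b commutes with J b
  have hJ : X b * ∑ i, t b i = (∑ i, t b i) * X b := by
    have hsplit : ∑ x, ∑ y, t x y = (∑ y, t b y) + (∑ x ∈ Finset.univ.erase b, t x b) +
        ∑ x ∈ Finset.univ.erase b, ∑ y ∈ Finset.univ.erase b, t x y := by
      rw [← Finset.add_sum_erase _ _ (Finset.mem_univ b), add_assoc, ← Finset.sum_add_distrib]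
      congr 1
      refine Finset.sum_congr rfl fun x _ => ?_
      rw [Finset.add_sum_erase _ _ (Finset.mem_univ b)]
    have hsplit2 : ∑ y, t b y = t b b + ∑ x ∈ Finset.univ.erase b, t x b := by
      rw [← Finset.add_sum_erase _ _ (Finset.mem_univ b)]
      congr 1
      exact Finset.sum_congr rfl fun x _ => htsym _ _
    have hbb : t b b = 1 := by simp only [ht, swap_self]; exact map_one ρ
    set R := ∑ x ∈ Finset.univ.erase b, ∑ y ∈ Finset.univ.erase b, t x y with hR
    have hRc : X b * R = R * X b := by
      simp only [hR, Finset.mul_sum, Finset.sum_mul]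
      refine Finset.sum_congr rfl fun x hx => Finset.sum_congr rfl fun y hy => ?_
      rw [htX, swap_apply_of_ne_of_ne (Finset.ne_of_mem_erase hx).symm (Finset.ne_of_mem_erase hy).symm]
    set J := ∑ i, t b i with hJ
    have e1 : (2 : ℂ) • J = μ • 1 + 1 - R := by
      rw [← hμ, hsplit, ← hbb]
      have : ∑ x ∈ Finset.univ.erase b, t x b = J - t b b := by rw [hsplit2]; abel
      rw [this]; module
    have e2 : J = (2 : ℂ)⁻¹ • (μ • 1 + 1 - R) := by rw [← e1, smul_smul]; norm_num
    rw [e2]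
    simp only [mul_smul_comm, smul_mul_assoc, mul_sub, mul_add, sub_mul, add_mul, mul_one, one_mul, hRc]
  have hS : ∑ i, (X b - X i) * t b i = 0 := by
    have : ∑ i, (X b - X i) * t b i = X b * ∑ i, t b i - (∑ i, t b i) * X b := by
      rw [Finset.mul_sum, Finset.sum_mul, ← Finset.sum_sub_distrib]
      refine Finset.sum_congr rfl fun i _ => ?_
      rw [htX, swap_apply_left, sub_mul]
    rw [this, hJ, sub_self]
  have hbr : ∑ i, (X b - X i) * (X a * t b i - t b i * X a) = 0 := by
    have : ∑ i, (X b - X i) * (X a * t b i - t b i * X a) =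
        X a * (∑ i, (X b - X i) * t b i) - (∑ i, (X b - X i) * t b i) * X a := by
      rw [Finset.mul_sum, Finset.sum_mul, ← Finset.sum_sub_distrib]
      refine Finset.sum_congr rfl fun i _ => ?_
      have : (X b - X i) * X a = X a * (X b - X i) := by rw [sub_mul, mul_sub, hcomm b a, hcomm i a]
      rw [mul_sub, ← mul_assoc, this, mul_assoc, mul_assoc]
    rw [this, hS]; simp
  rw [Finset.sum_eq_single a] at hbr
  · rw [htX, swap_apply_right] at hbr
    have h5 : (X b - X a) * (X a - X b) = 0 := by
      have := congrArg (· * t b a) hbr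
      simp only [zero_mul, ← sub_mul] at this
      rw [mul_assoc, mul_assoc] at this
      have htt : t b a * t b a = 1 := by simp only [ht, ← map_mul, swap_mul_self, map_one]
      rwa [htt, mul_one] at this
    have h6 : X a * X b + X b * X a = X a + X b := by
      have : (X b - X a) * (X a - X b) = X a * X b + X b * X a - X a - X b := by
        rw [sub_mul, mul_sub, mul_sub, hX.idem, hX.idem]; abel
      rw [this] at h5
      rw [← sub_eq_zero, ← h5]; abel
    rw [hcomm b a] at h6
    have h7 : X a * X b = X a := by
      have := congrArg (X a * ·) h6
      simp only [mul_add, ← mul_assoc, hX.idem] at this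
      have h8 : X a * X b + X a * X b = X a + X a * X b := this
      exact add_right_cancel h8
    have h8 : X a * X b = X b := by
      rw [h7] at h6; rw [h7]; exact add_left_cancel h6
    exact hX.ne hs hab (h7.symm.trans h8)
  · intro i _ hia
    rcases eq_or_ne i b with rfl | hib
    · simp
    · rw [htX, swap_apply_of_ne_of_ne hab hia.symm, sub_self, mul_zero]
  · simp

theorem Fam.ea (hX : Fam ρ X) (hρ : Irr ρ) (hn : 2 ≤ Fintype.card β) :
    ∀ a b : β, SymCov.ea a b ∈ U2 ρ := by
  obtain ⟨a, b, c, hab, hac, hbc, hK⟩ := hX.exK hρ hn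
  have hcard : (Fintype.card β : ℂ) ≠ 0 := by
    rw [Nat.cast_ne_zero]; omega
  have key : SymCov.ea a b + SymCov.ea b c + SymCov.ea c a ∈ U2 ρ := by
    obtain ⟨Y, hY⟩ := not_forall.1 ((Module.forall_dual_apply_eq_zero_iff ℂ _).not.2 hK)
    set y : β → β → ℂ := fun u v => Y (X u * X v - X v * X u) with hy
    have hyU : y ∈ U2 ρ := by
      intro x z _
      have : (fun g : Perm β => y (g x) (g z)) = fun g => Y (ρ g * (X x * X z - X z * X x) * ρ g⁻¹) := by
        ext g
        simp only [hy]
        congr 1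
        have e : ∀ A B : V →ₗ[ℂ] V, ρ g * A * ρ g⁻¹ * (ρ g * B * ρ g⁻¹) = ρ g * (A * B) * ρ g⁻¹ := fun A B => by
          rw [mul_assoc (ρ g * A), ← mul_assoc (ρ g⁻¹), ← mul_assoc (ρ g⁻¹), rho_inv_mul, one_mul]
          simp only [mul_assoc]
        rw [hX.conj, hX.conj, e, e, mul_sub, sub_mul]
      rw [this]
      exact dmemS ρ hρ _ _
    have hsym : ∀ u v, y u v = - y v u := fun u v => by
      simp only [hy]; rw [← map_neg]; congr 1; abel
    have hyq : y a b + y b c + y c a ≠ 0 := by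
      simpa only [hy, map_add] using hY
    clear_value y
    have h1 := (U2 ρ).sub_mem hyU (U2_inv ρ y hyU (swap a b))
    have h2 := U2 ρ |>.smul_mem (2 * (y a b + y b c + y c a))⁻¹ ((U2 ρ).add_mem ((U2 ρ).add_mem h1
      (U2_inv ρ _ h1 (swap a b * swap b c))) (U2_inv ρ _ h1 (swap b c * swap a b)))
    convert h2 using 1
    ext u v
    simp only [Pi.smul_apply, Pi.sub_apply, Pi.add_apply, smul_eq_mul, SymCov.ea]
    have hyq2 : 2 * (y a b + y b c + y c a) ≠ 0 := by simpa using hyq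
    rw [eq_inv_mul_iff_mul_eq₀ hyq2]
    have k1 := hab.symm; have k2 := hac.symm
    have k4 := hbc.symm
    have cases4 : ∀ w : β, w = a ∨ w = b ∨ w = c ∨ (w ≠ a ∧ w ≠ b ∧ w ≠ c) := by
      intro w; tauto
    clear h1 h2 hY hK hy hyU hX hyq hyq2
    have q1 := hsym b a; have q2 := hsym c a; have q4 := hsym c b
    have q5 : ∀ w, y w w = 0 := fun w => by have := hsym w w; linear_combination this / 2
    clear hsym
    rcases cases4 u with rfl | rfl | rfl | ⟨u1, u2, u3⟩ <;>
    rcases cases4 v with rfl | rfl | rfl | ⟨v1, v2, v3⟩ <;>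
    simp [swap_apply_def, hab, hac, hbc, k1, k2, k4, q5, *] <;> ring
  have key2 : ∀ p q r : β, p ≠ q → p ≠ r → q ≠ r → SymCov.ea p q + SymCov.ea q r + SymCov.ea r p ∈ U2 ρ := by
    intro p q r hpq hpr hqr
    obtain ⟨h, h1, h2, h3⟩ : ∃ h : Perm β, h p = a ∧ h q = b ∧ h r = c := by
      obtain ⟨e, he⟩ : ∃ e : Perm β, e p = a ∧ e q = b := by
        refine ⟨swap (swap p a q) b * swap p a, ?_, ?_⟩
        · rw [Perm.mul_apply, swap_apply_left, swap_apply_of_ne_of_ne _ hab]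
          intro hh
          exact hpq ((swap p a).injective (by rw [swap_apply_left, ← hh]))
        · rw [Perm.mul_apply, swap_apply_left]
      refine ⟨swap (e r) c * e, ?_, ?_, ?_⟩
      · rw [Perm.mul_apply, he.1, swap_apply_of_ne_of_ne _ hac]
        intro hh; exact hpr (e.injective (he.1.trans hh))
      · rw [Perm.mul_apply, he.2, swap_apply_of_ne_of_ne _ hbc]
        intro hh; exact hqr (e.injective (he.2.trans hh))
      · rw [Perm.mul_apply, swap_apply_left]
    convert U2_inv ρ _ key h using 1
    ext u v
    simp only [Pi.add_apply, SymCov.ea, ← h1, ← h2, ← h3, h.injective.eq_iff]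
  intro p q
  rcases eq_or_ne p q with rfl | hpq
  · convert Submodule.zero_mem _ using 1
    ext u v; simp [SymCov.ea]
  have h1 : ∑ r, (SymCov.ea p q + SymCov.ea q r + SymCov.ea r p) ∈ U2 ρ := by
    refine Submodule.sum_mem _ fun r _ => ?_
    rcases eq_or_ne p r with rfl | hpr
    · convert Submodule.zero_mem _ using 1
      ext u v; simp [SymCov.ea]
    rcases eq_or_ne q r with rfl | hqr
    · convert Submodule.zero_mem _ using 1
      ext u v; simp [SymCov.ea]
    exact key2 p q r hpq hpr hqr
  let f : β → ℂ := fun u => (if u = p then 1 else 0) - (if u = q then 1 else 0)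
  have h2 := (U2 ρ).smul_mem (Fintype.card β : ℂ)⁻¹
    ((U2 ρ).sub_mem ((U2 ρ).add_mem h1 (hX.left hρ hn f)) (hX.right hρ hn f))
  convert h2 using 1
  ext u v
  simp only [Pi.smul_apply, Pi.sub_apply, Pi.add_apply, smul_eq_mul, SymCov.ea, Finset.sum_apply,
    Finset.sum_add_distrib, Finset.sum_sub_distrib, ← Finset.mul_sum, ← Finset.sum_mul, f]
  simp
  field_simp
  split_ifs <;> ring

theorem Fam.pair (hX : Fam ρ X) (hρ : Irr ρ) (hQ : QN ρ) (hn : 3 ≤ Fintype.card β) {x z : β} (hxz : x ≠ z) :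
    fixInd {x, z} ∈ cf ρ ^ 2 := by
  have h1 := (U2 ρ).smul_mem (1/2 : ℂ) ((U2 ρ).add_mem (hX.es hρ hQ hn hxz) (hX.ea hρ (by omega) x z))
  have h2 := h1 x z hxz
  convert h2 using 1
  ext g
  simp only [fixInd, Finset.mem_insert, Finset.mem_singleton, forall_eq_or_imp, forall_eq,
    Pi.smul_apply, Pi.add_apply, SymCov.es, SymCov.ea, smul_eq_mul]
  by_cases h1 : g x = x <;> by_cases h2 : g z = z <;> simp [h1, h2] <;> ring

theorem fixInd_mul (S T : Finset β) : fixInd S * fixInd T = fixInd (S ∪ T) := by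
  ext g
  simp only [fixInd, Pi.mul_apply, Finset.mem_union]
  by_cases h1 : ∀ s ∈ S, g s = s
  · by_cases h2 : ∀ s ∈ T, g s = s
    · rw [if_pos h1, if_pos h2, if_pos, one_mul]
      rintro s (hs | hs)
      exacts [h1 s hs, h2 s hs]
    · rw [if_neg h2, mul_zero, if_neg]
      exact fun h => h2 fun s hs => h s (Or.inr hs)
  · rw [if_neg h1, zero_mul, if_neg]
    exact fun h => h1 fun s hs => h s (Or.inl hs)

theorem Fam.fix (hX : Fam ρ X) (hρ : Irr ρ) (hQ : QN ρ) (hn : 3 ≤ Fintype.card β) (j : ℕ) (S : Finset β)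
    (hS : S.card = 2 * j) : fixInd S ∈ cf ρ ^ (2 * j) := by
  induction j generalizing S with
  | zero =>
    have : S = ∅ := by simpa using hS
    subst this
    have : (fixInd ∅ : Perm β → ℂ) = 1 := by ext g; simp [fixInd]
    rw [this, mul_zero, pow_zero]
    exact Submodule.one_le.1 le_rfl
  | succ j ih =>
    obtain ⟨x, hx⟩ : S.Nonempty := by rw [← Finset.card_pos]; omega
    have hc1 : (S.erase x).card = 2 * j + 1 := by rw [Finset.card_erase_of_mem hx]; omega
    obtain ⟨z, hz⟩ : (S.erase x).Nonempty := by rw [← Finset.card_pos]; omega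
    have hc2 : ((S.erase x).erase z).card = 2 * j := by rw [Finset.card_erase_of_mem hz]; omega
    have hxz : x ≠ z := (Finset.ne_of_mem_erase hz).symm
    have : S = (S.erase x).erase z ∪ {x, z} := by
      ext w
      have hz' := Finset.mem_of_mem_erase hz
      simp only [Finset.mem_union, Finset.mem_erase, Finset.mem_insert, Finset.mem_singleton]
      constructor
      · intro hw; tauto
      · rintro (h | rfl | rfl)
        exacts [h.2.2, hx, hz']
    rw [this, ← fixInd_mul, show 2 * (j + 1) = 2 * j + 2 by ring, pow_add]
    exact Submodule.mul_mem_mul (ih _ hc2) (hX.pair hρ hQ hn hxz)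

end case1
end SymCov

namespace SymCov
open Equiv

section case1b
variable {α : Type} [Fintype α] [DecidableEq α] {V : Type} [AddCommGroup V] [Module ℂ V]
  [FiniteDimensional ℂ V]

theorem fix_one (x : α) : fixInd (Finset.univ.erase x) = Pi.single (1 : Perm α) (1 : ℂ) := by
  ext g
  simp only [fixInd, Finset.mem_erase, Finset.mem_univ, and_true, Pi.single_apply]
  congr 1
  rw [eq_iff_iff]
  constructor
  · intro h
    ext y
    by_cases hy : y = x
    · subst hy
      by_contra hne
      have := h (g y) hne
      exact hne (g.injective this)
    · exact h y hy
  · rintro rfl; simp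

theorem fix_two {a b : α} (hab : a ≠ b) : fixInd ((Finset.univ.erase a).erase b) =
    Pi.single (1 : Perm α) (1 : ℂ) + Pi.single (swap a b) 1 := by
  have hne : (1 : Perm α) ≠ swap a b := by
    intro h
    have := Equiv.congr_fun h a
    simp at this
    exact hab this
  ext g
  simp only [fixInd, Finset.mem_erase, Finset.mem_univ, and_true, Pi.single_apply, Pi.add_apply]
  by_cases h : ∀ s, s ≠ b ∧ s ≠ a → g s = s
  · rw [if_pos h]
    have : g = 1 ∨ g = swap a b := by
      have hg : ∀ x, x = a ∨ x = b → g x = a ∨ g x = b := by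
        intro x hx
        by_contra hcon
        push Not at hcon
        have := g.injective (h (g x) ⟨hcon.2, hcon.1⟩)
        rw [this] at hcon
        tauto
      rcases hg a (Or.inl rfl) with h1 | h1
      · left
        ext y
        by_cases hya : y = a
        · subst hya; exact h1
        by_cases hyb : y = b
        · subst hyb
          rcases hg y (Or.inr rfl) with h2 | h2
          · exact absurd (g.injective (h1.trans h2.symm)) hab
          · exact h2
        · exact h y ⟨hyb, hya⟩
      · right
        ext y
        by_cases hya : y = a
        · subst hya; rw [swap_apply_left]; exact h1
        by_cases hyb : y = b
        · subst hyb
          rw [swap_apply_right]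
          rcases hg y (Or.inr rfl) with h2 | h2
          · exact h2
          · exact absurd (g.injective (h1.trans h2.symm)) hab
        · rw [swap_apply_of_ne_of_ne hya hyb]; exact h y ⟨hyb, hya⟩
    rcases this with rfl | rfl
    · simp [hne]
    · simp [hne.symm]
  · rw [if_neg h, if_neg, if_neg, add_zero]
    · rintro rfl
      exact h fun s hs => swap_apply_of_ne_of_ne hs.2 hs.1
    · rintro rfl
      exact h fun s hs => rfl

theorem sum_two {M : Type} [AddCommGroup M] [Module ℂ M] {a b : α} (f : Perm α → M) :
    ∑ g, (Pi.single (1 : Perm α) (1 : ℂ) + Pi.single (swap a b) 1 : Perm α → ℂ) g • f g = f 1 + f (swap a b) := by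
  simp only [Pi.add_apply, add_smul, Finset.sum_add_distrib, Pi.single_apply, ite_smul, one_smul,
    zero_smul, Finset.sum_ite_eq', Finset.mem_univ, if_true]

theorem two_good (hn : 5 ≤ Fintype.card α) {W : Type} [AddCommGroup W] [Module ℂ W] [FiniteDimensional ℂ W]
    (σ : Perm α →* (W →ₗ[ℂ] W)) (hσ : NL σ) {a b : α} (hab : a ≠ b) :
    ∑ g, (Pi.single (1 : Perm α) (1 : ℂ) + Pi.single (swap a b) 1 : Perm α → ℂ) g • σ g⁻¹ ≠ 0 := by
  rw [sum_two]
  intro h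
  have h1 : σ (swap a b) = (-1 : ℂ) • 1 := by
    rw [inv_one, map_one, swap_inv] at h
    rw [neg_one_smul]; exact (neg_eq_of_add_eq_zero_right h).symm
  have := scalar_faithful hn σ hσ _ ⟨_, h1⟩
  have := Equiv.congr_fun this a
  simp at this
  exact hab this.symm

theorem one_cov {W : Type} [AddCommGroup W] [Module ℂ W] [FiniteDimensional ℂ W]
    (σ : Perm α →* (W →ₗ[ℂ] W)) (hσ : NL σ) :
    ∑ g, (Pi.single (1 : Perm α) (1 : ℂ) : Perm α → ℂ) g • σ g⁻¹ ≠ 0 := by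
  have := hσ.1.1
  simp [Pi.single_apply]

theorem one_sgn : ∑ g, (Pi.single (1 : Perm α) (1 : ℂ) : Perm α → ℂ) g * ((Perm.sign g : ℤ) : ℂ) ≠ 0 := by
  simp [Pi.single_apply]

theorem inj_of_NL (hn : 5 ≤ Fintype.card α) (ρ : Perm α →* (V →ₗ[ℂ] V)) (h : NL ρ) :
    Function.Injective ρ := by
  rw [injective_iff_map_eq_one]
  intro g hg
  exact scalar_faithful hn ρ h g ⟨1, by rw [hg, one_smul]⟩

theorem qn_of_inj {β : Type} [Fintype β] [DecidableEq β] (ρ : Perm β →* (V →ₗ[ℂ] V))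
    (h : Function.Injective ρ) : QN ρ := by
  intro a b c d hab hac had hbc hbd hcd h0
  have h1 : ρ (swap a b) + ρ (swap c d) = ρ (swap a c) + ρ (swap b d) := by
    rw [← sub_eq_zero, ← h0]; abel
  have sq : ∀ x y : β, ρ (swap x y) * ρ (swap x y) = 1 := fun x y => by
    rw [← map_mul, swap_mul_self, map_one]
  have cm : ∀ x y z w : β, x ≠ z → x ≠ w → y ≠ z → y ≠ w → ρ (swap z w) * ρ (swap x y) = ρ (swap x y) * ρ (swap z w) := by
    intro x y z w h1 h2 h3 h4
    rw [← map_mul, ← map_mul]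
    congr 1
    rw [Equiv.mul_swap_eq_swap_mul, swap_apply_of_ne_of_ne h1 h2, swap_apply_of_ne_of_ne h3 h4]
  have h2 := congrArg (fun T => T * T) h1
  simp only [add_mul, mul_add, sq] at h2
  rw [cm a b c d hac had hbc hbd, cm a c b d hab had hbc.symm hcd] at h2
  have h3 : (2 : ℂ) • (ρ (swap a b) * ρ (swap c d)) = (2 : ℂ) • (ρ (swap a c) * ρ (swap b d)) := by
    have : ∀ P : V →ₗ[ℂ] V, (2 : ℂ) • P = 1 + P + (P + 1) - (2 : ℂ) • 1 := fun P => by module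
    rw [this, this (ρ (swap a c) * _), h2]
  have h4 := smul_right_injective _ (two_ne_zero (α := ℂ)) h3
  rw [← map_mul, ← map_mul] at h4
  have h5 := Equiv.congr_fun (h h4) a
  rw [Perm.mul_apply, Perm.mul_apply, swap_apply_of_ne_of_ne hac had,
    swap_apply_of_ne_of_ne hab had, swap_apply_left, swap_apply_left] at h5
  exact hbc h5

theorem case1 (hn : 5 ≤ Fintype.card α) (ρ : Perm α →* (V →ₗ[ℂ] V)) (h : NL ρ)
    (X : α → (V →ₗ[ℂ] V)) (hX : Fam ρ X) : Cov ρ := by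
  have hinj := inj_of_NL hn ρ h
  have hQ := qn_of_inj ρ hinj
  have : Nontrivial α := by rw [← Fintype.one_lt_card_iff_nontrivial]; omega
  obtain ⟨a, b, hab⟩ := exists_pair_ne α
  have hc1 : (Finset.univ.erase a).card = Fintype.card α - 1 := by
    rw [Finset.card_erase_of_mem (Finset.mem_univ _), Finset.card_univ]
  have hc2 : ((Finset.univ.erase a).erase b).card = Fintype.card α - 2 := by
    rw [Finset.card_erase_of_mem (Finset.mem_erase.2 ⟨hab.symm, Finset.mem_univ _⟩), hc1]; omega
  rcases Nat.even_or_odd' (Fintype.card α) with ⟨m, hm | hm⟩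
  · have hF := hX.fix h.1 hQ (by omega) (m - 1) ((Finset.univ.erase a).erase b) (by rw [hc2]; omega)
    rw [fix_two hab] at hF
    refine ⟨fun W _ _ _ σ hσ => ⟨2 * (m - 1), by omega, by omega, _, hF, two_good hn σ hσ hab⟩, ?_⟩
    have hne : ρ (swap a b) ≠ ρ 1 := fun hh => by
      have := Equiv.congr_fun (hinj hh) a
      simp at this
      exact hab this.symm
    obtain ⟨v, hv⟩ : ∃ v, ρ (swap a b) v - ρ 1 v ≠ 0 := by
      by_contra hcon
      push Not at hcon
      exact hne (LinearMap.ext fun v => sub_eq_zero.1 (hcon v))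
    obtain ⟨φ, hφ⟩ := not_forall.1 ((Module.forall_dual_apply_eq_zero_iff ℂ _).not.2 hv)
    refine ⟨2 * (m - 1) + 1, by omega, by omega, (Pi.single (1 : Perm α) (1 : ℂ) + Pi.single (swap a b) 1) * (fun g => φ (ρ g v)), ?_, ?_⟩
    · rw [pow_succ]
      exact Submodule.mul_mem_mul hF (cf_mem ρ φ v)
    · simp only [Pi.mul_apply, mul_assoc]
      have := sum_two (a := a) (b := b) (fun g => φ (ρ g v) * ((Perm.sign g : ℤ) : ℂ))
      simp only [smul_eq_mul] at this
      rw [this]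
      simp only [Perm.sign_swap hab, map_one, Units.val_one, Int.cast_one, mul_one, Units.val_neg, Int.cast_neg]
      rw [map_sub, map_one] at hφ
      intro h0; apply hφ; rw [← neg_eq_zero, ← h0]; ring
  · have hF := hX.fix h.1 hQ (by omega) m (Finset.univ.erase a) (by rw [hc1]; omega)
    rw [fix_one] at hF
    exact ⟨fun W _ _ _ σ hσ => ⟨2 * m, by omega, by omega, _, hF, one_cov σ hσ⟩,
      ⟨2 * m, by omega, by omega, _, hF, one_sgn⟩⟩

/-- no proper subspace invariant under a point stabiliser -/
def NoSub (ρ : Perm α →* (V →ₗ[ℂ] V)) : Prop :=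
  ∀ z : α, ∀ U : Submodule ℂ V, (∀ g : Perm α, g z = z → ∀ v ∈ U, ρ g v ∈ U) → U = ⊥ ∨ U = ⊤

theorem fam_of_idem (ρ : Perm α →* (V →ₗ[ℂ] V)) (z : α) (X : V →ₗ[ℂ] V)
    (h1 : ∀ g : Perm α, g z = z → X * ρ g = ρ g * X) (h2 : X * X = X) (h3 : ¬ ∃ c : ℂ, X = c • 1) :
    Fam ρ (fun a => ρ (swap z a) * X * ρ (swap z a)⁻¹) := by
  refine ⟨fun g a => ?_, fun a => ?_, fun a => ?_⟩
  · have hk : ((swap z (g a))⁻¹ * g * swap z a) z = z := by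
      simp [Perm.mul_apply]
    have := h1 _ hk
    simp only [map_mul] at this
    have e1 : ρ (swap z (g a)) * (X * (ρ (swap z (g a))⁻¹ * ρ g * ρ (swap z a))) * ρ (swap z a)⁻¹ =
      ρ (swap z (g a)) * X * ρ (swap z (g a))⁻¹ * ρ g := by
      simp only [mul_assoc, rho_mul_inv, mul_one]
    have e2 : ρ (swap z (g a)) * (ρ (swap z (g a))⁻¹ * ρ g * ρ (swap z a) * X) * ρ (swap z a)⁻¹ =
      ρ g * (ρ (swap z a) * X * ρ (swap z a)⁻¹) := by
      simp only [← mul_assoc, rho_mul_inv, one_mul]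
    rw [← e2, ← this, e1]
  · have e : ρ (swap z a) * X * ρ (swap z a)⁻¹ * (ρ (swap z a) * X * ρ (swap z a)⁻¹) =
        ρ (swap z a) * (X * X) * ρ (swap z a)⁻¹ := by
      rw [mul_assoc (ρ (swap z a) * X), ← mul_assoc (ρ (swap z a)⁻¹), ← mul_assoc (ρ (swap z a)⁻¹), rho_inv_mul, one_mul]
      simp only [mul_assoc]
    rw [h2] at e
    exact e
  · rintro ⟨c, hc⟩
    refine h3 ⟨c, ?_⟩
    have e : X = ρ (swap z a)⁻¹ * (ρ (swap z a) * X * ρ (swap z a)⁻¹) * ρ (swap z a) := by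
      simp only [mul_assoc, rho_inv_mul, mul_one]
      rw [← mul_assoc, rho_inv_mul, one_mul]
    rw [e, hc, mul_smul_comm, smul_mul_assoc, mul_one, rho_inv_mul]

theorem split (ρ : Perm α →* (V →ₗ[ℂ] V)) : (∃ X, Fam ρ X) ∨ NoSub ρ := by
  by_cases hN : NoSub ρ
  · exact Or.inr hN
  left
  simp only [NoSub, not_forall] at hN
  obtain ⟨z, U, hU, hne⟩ := hN
  push Not at hne
  let H := MulAction.stabilizer (Perm α) z
  have : Fintype H := Fintype.ofFinite H
  obtain ⟨X, h1, h2, h3⟩ := maschke (ρ.comp H.subtype) U (fun g v hv => hU g.1 g.2 v hv)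
  refine ⟨_, fam_of_idem ρ z X (fun g hg => h1 ⟨g, hg⟩) ?_ ?_⟩
  · ext v
    exact h3 _ (h2 v)
  · rintro ⟨c, rfl⟩
    by_cases hc : c = 0
    · apply hne.1
      rw [Submodule.eq_bot_iff]
      intro v hv
      simpa [hc] using (h3 v hv).symm
    · apply hne.2
      rw [Submodule.eq_top_iff']
      intro v
      have := U.smul_mem c⁻¹ (h2 v)
      simpa [smul_smul, hc] using this

end case1b
end SymCov

namespace SymCov
open Equiv
section case3
variable {α : Type} [Fintype α] [DecidableEq α]
variable {V : Type} [AddCommGroup V] [Module ℂ V]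

def os (z : α) : Perm {i : α // i ≠ z} →* Perm α := Equiv.Perm.ofSubtype

theorem os_surj (z : α) (g : Perm α) (hg : g z = z) : ∃ h, os z h = g := by
  have h1 : ∀ x, x ≠ z ↔ g x ≠ z := fun x => by
    constructor
    · intro h h'; apply h; apply g.injective; rw [h', hg]
    · rintro h rfl; exact h hg
  have h1' : ∀ x, g x ≠ z ↔ x ≠ z := fun x => (h1 x).symm
  refine ⟨g.subtypePerm h1', ?_⟩
  apply Equiv.Perm.ofSubtype_subtypePerm
  rintro x hx rfl
  exact hx hg

theorem os_z (z : α) (h) : os z h z = z := by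
  apply Equiv.Perm.ofSubtype_apply_of_not_mem
  simp

theorem os_coe (z : α) (h) (x : {i : α // i ≠ z}) : os z h x = h x :=
  Equiv.Perm.ofSubtype_apply_coe h x

theorem os_inj (z : α) : Function.Injective (os z) := Equiv.Perm.ofSubtype_injective

theorem irr_os (ρ : Perm α →* (V →ₗ[ℂ] V)) (h : Irr ρ) (hN : NoSub ρ) (z : α) :
    Irr (ρ.comp (os z)) := by
  refine ⟨h.1, fun U hU => hN z U fun g hg => ?_⟩
  obtain ⟨k, rfl⟩ := os_surj z g hg
  exact hU k

theorem scal_z [FiniteDimensional ℂ V] (ρ : Perm α →* (V →ₗ[ℂ] V)) (h : Irr ρ) (hN : NoSub ρ) (z : α)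
    (T : V →ₗ[ℂ] V) (hT : ∀ g, g z = z → T * ρ g = ρ g * T) : ∃ c : ℂ, T = c • 1 :=
  scal_of_irr _ (irr_os ρ h hN z) T fun g => hT _ (os_z z g)

theorem kappa [FiniteDimensional ℂ V] (ρ : Perm α →* (V →ₗ[ℂ] V)) (h : Irr ρ) (hN : NoSub ρ) :
    ∃ κ : ℂ, ∀ z, ∑ i, ρ (swap i z) = κ • 1 := by
  have key : ∀ z (g : Perm α), (∑ i, ρ (swap i (g z))) * ρ g = ρ g * ∑ i, ρ (swap i z) := by
    intro z g
    rw [Finset.sum_mul, Finset.mul_sum, ← Equiv.sum_comp g]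
    refine Finset.sum_congr rfl fun i _ => ?_
    rw [rho_swap, mul_assoc, rho_inv_mul, mul_one]
  rcases isEmpty_or_nonempty α with he | ⟨⟨z0⟩⟩
  · exact ⟨0, fun z => he.elim z⟩
  obtain ⟨κ, hκ⟩ := scal_z ρ h hN z0 (∑ i, ρ (swap i z0)) (fun g hg => by
    have := key z0 g
    rwa [hg] at this)
  refine ⟨κ, fun z => ?_⟩
  have := key z0 (swap z0 z)
  rw [swap_apply_left, hκ] at this
  have h2 := congrArg (fun T => T * ρ (swap z0 z)⁻¹) this
  simp only [mul_assoc, rho_mul_inv, mul_one] at h2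
  rw [h2, smul_mul_assoc, one_mul, mul_smul_comm, rho_mul_inv]

theorem fixz [FiniteDimensional ℂ V] (hn : 5 ≤ Fintype.card α) (ρ : Perm α →* (V →ₗ[ℂ] V)) (h : NL ρ) (hN : NoSub ρ)
    (z : α) (j : ℕ) (S : Finset {i : α // i ≠ z}) (hS : S.card = 2 * j) :
    ∃ F ∈ cf ρ ^ (2 * j), ∀ g, F (os z g) = fixInd S g := by
  have hinj : Function.Injective (ρ.comp (os z)) := by
    rw [MonoidHom.coe_comp]
    exact (inj_of_NL hn ρ h).comp (os_inj z)
  have hf : Fam (ρ.comp (os z)) (fun w => (2 : ℂ)⁻¹ • (1 + ρ (swap (w : α) z))) := by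
    refine ⟨fun g a => ?_, fun a => ?_, fun a => ?_⟩
    · have := rho_swap ρ (os z g) a z
      rw [os_z, os_coe] at this
      simp only [MonoidHom.comp_apply, mul_smul_comm, smul_mul_assoc]
      rw [this, mul_add, add_mul, mul_assoc (ρ (os z g) * _), rho_inv_mul, mul_one, mul_one, one_mul]
    · have e : ρ (swap (a : α) z) * ρ (swap (a : α) z) = 1 := by rw [← map_mul, swap_mul_self, map_one]
      simp only [mul_smul_comm, smul_mul_assoc, mul_add, add_mul, e, mul_one, one_mul]
      module
    · rintro ⟨c, hc⟩
      have e : ρ (swap (a : α) z) = (2 * c - 1) • 1 := by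
        have : ρ (swap (a : α) z) = (2 : ℂ) • ((2 : ℂ)⁻¹ • (1 + ρ (swap (a : α) z))) - 1 := by module
        rw [this, hc]; module
      have := scalar_faithful hn ρ h _ ⟨_, e⟩
      rw [swap_eq_one_iff] at this
      exact a.2 this
  have hc : Fintype.card {i : α // i ≠ z} = Fintype.card α - 1 := by
    rw [Fintype.card_subtype_compl, Fintype.card_subtype_eq]
  exact cf_map_pow _ _ _ _ (hf.fix (irr_os ρ h.1 hN z) (qn_of_inj _ hinj) (by omega) j S hS)

/-- Sum over S₃ -/
def s3 (ρ : Perm α →* (V →ₗ[ℂ] V)) (ε : ℂ) (a b c : α) : V →ₗ[ℂ] V :=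
  1 + ε • ρ (swap a b) + ε • ρ (swap b c) + ρ (swap a b) * ρ (swap b c) + ρ (swap b c) * ρ (swap a b)
    + ε • (ρ (swap a b) * ρ (swap b c) * ρ (swap a b))

theorem s3_conj (ρ : Perm α →* (V →ₗ[ℂ] V)) (ε : ℂ) (a b c : α) (g : Perm α) :
    s3 ρ ε (g a) (g b) (g c) = ρ g * s3 ρ ε a b c * ρ g⁻¹ := by
  have e : ∀ X Y : V →ₗ[ℂ] V, ρ g * X * ρ g⁻¹ * (ρ g * Y * ρ g⁻¹) = ρ g * (X * Y) * ρ g⁻¹ := by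
    intro X Y
    rw [mul_assoc (ρ g * X), ← mul_assoc (ρ g⁻¹), ← mul_assoc (ρ g⁻¹), rho_inv_mul, one_mul]
    simp only [mul_assoc]
  simp only [s3, rho_swap, e, mul_add, add_mul, mul_smul_comm, smul_mul_assoc, mul_one, rho_mul_inv]

theorem rsq (ρ : Perm α →* (V →ₗ[ℂ] V)) (a b : α) : ρ (swap a b) * ρ (swap a b) = 1 := by
  rw [← map_mul, swap_mul_self, map_one]

theorem braid (ρ : Perm α →* (V →ₗ[ℂ] V)) {a b c : α} (hab : a ≠ b) (hac : a ≠ c) (hbc : b ≠ c) :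
    ρ (swap a b) * ρ (swap b c) * ρ (swap a b) = ρ (swap a c) := by
  have := rho_swap ρ (swap a b) b c
  rw [swap_apply_right, swap_apply_of_ne_of_ne hac.symm hbc.symm, swap_inv] at this
  exact this.symm

theorem s3_ab (ρ : Perm α →* (V →ₗ[ℂ] V)) (ε : ℂ) (he : ε * ε = 1) (a b c : α) :
    s3 ρ ε a b c * ρ (swap a b) = ε • s3 ρ ε a b c := by
  have h := rsq ρ a b
  simp only [s3, add_mul, smul_mul_assoc, mul_assoc, h, mul_one, one_mul, smul_add, smul_smul, he, one_smul]
  abel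

theorem s3_bc (ρ : Perm α →* (V →ₗ[ℂ] V)) (ε : ℂ) (he : ε * ε = 1) {a b c : α} 
    (hab : a ≠ b) (hac : a ≠ c) (hbc : b ≠ c) :
    s3 ρ ε a b c * ρ (swap b c) = ε • s3 ρ ε a b c := by
  have h := rsq ρ b c
  have h' := rsq ρ a b
  have h1 : ρ (swap b c) * ρ (swap a b) * ρ (swap b c) = ρ (swap a b) * ρ (swap b c) * ρ (swap a b) := by
    rw [braid ρ hab hac hbc, swap_comm b c, swap_comm a b, braid ρ hbc.symm hac.symm hab.symm, swap_comm]
  have h2 : ρ (swap a b) * (ρ (swap b c) * (ρ (swap a b) * ρ (swap b c))) = ρ (swap b c) * ρ (swap a b) := by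
    rw [← mul_assoc (ρ (swap b c)), h1, mul_assoc, ← mul_assoc, h', one_mul]
  rw [mul_assoc, mul_assoc] at h1
  have h3 : ∀ T, ρ (swap a b) * (ρ (swap a b) * T) = T := fun T => by rw [← mul_assoc, h', one_mul]
  simp only [s3, add_mul, smul_mul_assoc, mul_assoc, h, h1, h3, mul_one, one_mul, smul_add, smul_smul, he, one_smul]
  abel

theorem s3_ac (ρ : Perm α →* (V →ₗ[ℂ] V)) (ε : ℂ) (he : ε * ε = 1) {a b c : α} 
    (hab : a ≠ b) (hac : a ≠ c) (hbc : b ≠ c) :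
    s3 ρ ε a b c * ρ (swap a c) = ε • s3 ρ ε a b c := by
  rw [← braid ρ hab hac hbc, ← mul_assoc, ← mul_assoc, s3_ab ρ ε he, smul_mul_assoc, smul_mul_assoc,
    s3_bc ρ ε he hab hac hbc, smul_mul_assoc, s3_ab ρ ε he, smul_smul, smul_smul, he, one_mul]

theorem s3_ab' (ρ : Perm α →* (V →ₗ[ℂ] V)) (ε : ℂ) (he : ε * ε = 1) (a b c : α) :
    ρ (swap a b) * s3 ρ ε a b c = ε • s3 ρ ε a b c := by
  have h := rsq ρ a b
  have h' : ∀ T, ρ (swap a b) * (ρ (swap a b) * T) = T := fun T => by rw [← mul_assoc, h, one_mul]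
  simp only [s3, mul_add, mul_smul_comm, mul_assoc, h, h', mul_one, one_mul, smul_add, smul_smul, he, one_smul]
  abel

theorem s3_bc' (ρ : Perm α →* (V →ₗ[ℂ] V)) (ε : ℂ) (he : ε * ε = 1) {a b c : α} 
    (hab : a ≠ b) (hac : a ≠ c) (hbc : b ≠ c) :
    ρ (swap b c) * s3 ρ ε a b c = ε • s3 ρ ε a b c := by
  have h := rsq ρ b c
  have h' := rsq ρ a b
  have h0 : ∀ T, ρ (swap b c) * (ρ (swap b c) * T) = T := fun T => by rw [← mul_assoc, h, one_mul]
  have h1 : ρ (swap b c) * ρ (swap a b) * ρ (swap b c) = ρ (swap a b) * ρ (swap b c) * ρ (swap a b) := by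
    rw [braid ρ hab hac hbc, swap_comm b c, swap_comm a b, braid ρ hbc.symm hac.symm hab.symm, swap_comm]
  have h2 : ρ (swap b c) * (ρ (swap a b) * (ρ (swap b c) * ρ (swap a b))) = ρ (swap a b) * ρ (swap b c) := by
    rw [← mul_assoc, ← mul_assoc, h1, mul_assoc, h', mul_one]
  rw [mul_assoc, mul_assoc] at h1
  simp only [s3, mul_add, mul_smul_comm, mul_assoc, h, h0, h1, h2, mul_one, one_mul, smul_add, smul_smul, he, one_smul]
  abel

def NZ (ρ : Perm α →* (V →ₗ[ℂ] V)) (ε : ℂ) : Prop :=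
  ∀ a b c, a ≠ b → a ≠ c → b ≠ c → s3 ρ ε a b c ≠ 0

theorem trans3 {a b c a' b' c' : α} (hab : a ≠ b) (hac : a ≠ c) (hbc : b ≠ c)
    (hab' : a' ≠ b') (hac' : a' ≠ c') (hbc' : b' ≠ c') : ∃ g : Perm α, g a = a' ∧ g b = b' ∧ g c = c' := by
  let f1 := swap a a'
  have h1 : f1 a = a' := swap_apply_left _ _
  let f2 := swap (f1 b) b'
  have h2 : f2 a' = a' := swap_apply_of_ne_of_ne (by rw [← h1]; exact fun h => hab (f1.injective h)) hab'
  have h3 : f2 (f1 b) = b' := swap_apply_left _ _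
  let f3 := swap (f2 (f1 c)) c'
  have h4 : f3 a' = a' := swap_apply_of_ne_of_ne (by rw [← h2, ← h1]; exact fun h => hac (f1.injective (f2.injective h))) hac'
  have h5 : f3 b' = b' := swap_apply_of_ne_of_ne (by rw [← h3]; exact fun h => hbc (f1.injective (f2.injective h))) hbc'
  refine ⟨f3 * f2 * f1, ?_, ?_, ?_⟩
  · simp only [Perm.mul_apply, h1, h2, h4]
  · simp only [Perm.mul_apply, h3, h5]
  · simp only [Perm.mul_apply]; exact swap_apply_left _ _

theorem not_NZ (ρ : Perm α →* (V →ₗ[ℂ] V)) (ε : ℂ) (h : ¬ NZ ρ ε) :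
    ∀ a b c, a ≠ b → a ≠ c → b ≠ c → s3 ρ ε a b c = 0 := by
  simp only [NZ, not_forall, not_not] at h
  obtain ⟨a, b, c, hab, hac, hbc, h⟩ := h
  intro a' b' c' hab' hac' hbc'
  obtain ⟨g, rfl, rfl, rfl⟩ := trans3 hab hac hbc hab' hac' hbc'
  rw [s3_conj, h, mul_zero, zero_mul]

end case3
end SymCov

namespace SymCov
open Equiv
section case3A
variable {α : Type} [Fintype α] [DecidableEq α]
variable {V : Type} [AddCommGroup V] [Module ℂ V]

def sol (ρ : Perm α →* (V →ₗ[ℂ] V)) (ε : ℂ) : Submodule ℂ (α → V) where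
  carrier := {q | ∀ a b, a ≠ b → ρ (swap a b) (q a + q b) = -(ε • (q a + q b))}
  zero_mem' := by intro a b _; simp
  add_mem' := by
    intro p q hp hq a b hab
    have := hp a b hab
    have h2 := hq a b hab
    simp only [Pi.add_apply]
    rw [show p a + q a + (p b + q b) = (p a + p b) + (q a + q b) by abel, map_add, this, h2]
    module
  smul_mem' := by
    intro c q hq a b hab
    have h2 := hq a b hab
    simp only [Pi.smul_apply]
    rw [← smul_add, map_smul, h2]
    module

theorem s3_kill (s t : V →ₗ[ℂ] V) (ε : ℂ) (he : ε * ε = 1) (h : s * t = ε • s) (x : V) (hx : t x = -(ε • x)) :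
    s x = 0 := by
  have e : (s * t) x = ε • s x := by rw [h]; rfl
  rw [Module.End.mul_apply, hx, map_neg, map_smul] at e
  have e2 : ε • s x = 0 := by
    have : (2 : ℂ) • (ε • s x) = 0 := by
      rw [two_smul]; nth_rewrite 1 [← e]; simp
    exact (smul_eq_zero.1 this).resolve_left two_ne_zero
  refine (smul_eq_zero.1 e2).resolve_left ?_
  rintro rfl; simp at he

theorem kerq (hn : 3 ≤ Fintype.card α) (ρ : Perm α →* (V →ₗ[ℂ] V)) (hN : NoSub ρ) (ε : ℂ) (he : ε * ε = 1) (hZ : NZ ρ ε)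
    (q : α → V) (hq : q ∈ sol ρ ε) : q = 0 := by
  funext z
  have hcard : 2 < (Finset.univ : Finset α).card := by rw [Finset.card_univ]; omega
  obtain ⟨a, ha, b, hb, hza, hzb, hab⟩ : ∃ a, a ∈ (Finset.univ : Finset α) ∧ ∃ b, b ∈ (Finset.univ : Finset α) ∧ z ≠ a ∧ z ≠ b ∧ a ≠ b := by
    have h1 : 1 < (Finset.univ.erase z).card := by
      rw [Finset.card_erase_of_mem (Finset.mem_univ _)]; omega
    obtain ⟨a, ha, b, hb, hab⟩ := Finset.one_lt_card.1 h1
    exact ⟨a, Finset.mem_univ _, b, Finset.mem_univ _, (Finset.ne_of_mem_erase ha).symm, (Finset.ne_of_mem_erase hb).symm, hab⟩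
  have kill : ∀ q ∈ sol ρ ε, s3 ρ ε z a b (q z) = 0 := by
    intro q hq
    have h1 := s3_kill _ _ ε he (s3_ab ρ ε he z a b) _ (hq z a hza)
    have h2 := s3_kill _ _ ε he (s3_bc ρ ε he hza hzb hab) _ (hq a b hab)
    have h3 := s3_kill _ _ ε he (s3_ac ρ ε he hza hzb hab) _ (hq z b hzb)
    rw [map_add] at h1 h2 h3
    have : (2 : ℂ) • s3 ρ ε z a b (q z) = 0 := by
      have e : (2 : ℂ) • s3 ρ ε z a b (q z) = (s3 ρ ε z a b (q z) + s3 ρ ε z a b (q a)) + (s3 ρ ε z a b (q z) + s3 ρ ε z a b (q b)) - (s3 ρ ε z a b (q a) + s3 ρ ε z a b (q b)) := by module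
      rw [e, h1, h2, h3]; simp
    exact (smul_eq_zero.1 this).resolve_left two_ne_zero
  rcases hN z ((sol ρ ε).map (LinearMap.proj z)) (by
    rintro g hg _ ⟨q, hq, rfl⟩
    refine ⟨fun a => ρ g (q (g⁻¹ a)), ?_, ?_⟩
    · intro a b hab
      have := hq (g⁻¹ a) (g⁻¹ b) (fun h => hab (g⁻¹.injective h))
      rw [rho_swap, inv_inv] at this
      have h2 := congrArg (ρ g) this
      simp only [Module.End.mul_apply] at h2
      rw [← Module.End.mul_apply (ρ g), rho_mul_inv] at h2
      simp only [map_add, map_neg, map_smul, Module.End.one_apply] at h2 ⊢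
      exact h2
    · simp only [LinearMap.proj_apply]
      rw [Perm.inv_eq_iff_eq.2 hg.symm]) with h | h
  · have : q z ∈ (sol ρ ε).map (LinearMap.proj z) := ⟨q, hq, rfl⟩
    rw [h] at this
    exact this
  · exfalso
    refine hZ z a b hza hzb hab (LinearMap.ext fun v => ?_)
    have : v ∈ (sol ρ ε).map (LinearMap.proj z) := by rw [h]; trivial
    obtain ⟨q, hq, rfl⟩ := this
    exact kill q hq

def Psi (ρ : Perm α →* (V →ₗ[ℂ] V)) : ((α → V) × (α → V)) →ₗ[ℂ] (α → α → V) where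
  toFun p := fun a b => if a = b then 0 else ρ (swap a b) (p.1 a + p.1 b) - (p.2 a + p.2 b)
  map_add' p q := by
    funext a b
    simp only [Prod.fst_add, Prod.snd_add, Pi.add_apply, map_add]
    split_ifs
    · simp
    · abel
  map_smul' c q := by
    funext a b
    simp only [Prod.smul_fst, Prod.smul_snd, Pi.smul_apply, map_add, RingHom.id_apply, map_smul]
    split_ifs
    · simp
    · module

theorem psi_ker (hn : 3 ≤ Fintype.card α) (ρ : Perm α →* (V →ₗ[ℂ] V)) (hN : NoSub ρ) (hZ : NZ ρ 1) (hZ' : NZ ρ (-1))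
    (p) (hp : Psi ρ p = 0) : p.1 = 0 := by
  have h : ∀ a b, a ≠ b → ρ (swap a b) (p.1 a + p.1 b) = p.2 a + p.2 b := by
    intro a b hab
    have := congrFun (congrFun hp a) b
    simp only [Psi, LinearMap.coe_mk, AddHom.coe_mk, if_neg hab, Pi.zero_apply] at this
    exact sub_eq_zero.1 this
  have h' : ∀ a b, a ≠ b → ρ (swap a b) (p.2 a + p.2 b) = p.1 a + p.1 b := by
    intro a b hab
    rw [← h a b hab, ← Module.End.mul_apply, rsq]; rfl
  have h1 := kerq hn ρ hN 1 (by norm_num) hZ (p.1 - p.2) (by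
    intro a b hab
    simp only [Pi.sub_apply]
    rw [show p.1 a - p.2 a + (p.1 b - p.2 b) = (p.1 a + p.1 b) - (p.2 a + p.2 b) by abel, map_sub, h a b hab, h' a b hab]
    module)
  have h2 := kerq hn ρ hN (-1) (by norm_num) hZ' (p.1 + p.2) (by
    intro a b hab
    simp only [Pi.add_apply]
    rw [show p.1 a + p.2 a + (p.1 b + p.2 b) = (p.1 a + p.1 b) + (p.2 a + p.2 b) by abel, map_add, h a b hab, h' a b hab]
    module)
  have : (2 : ℂ) • p.1 = (p.1 - p.2) + (p.1 + p.2) := by module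
  rw [h1, h2, add_zero] at this
  exact (smul_eq_zero.1 this).resolve_left two_ne_zero

theorem exlam [FiniteDimensional ℂ V] (hn : 3 ≤ Fintype.card α) (ρ : Perm α →* (V →ₗ[ℂ] V)) (hN : NoSub ρ) (hZ : NZ ρ 1) (hZ' : NZ ρ (-1))
    (z : α) (φ : V →ₗ[ℂ] ℂ) : ∃ L : α → α → (V →ₗ[ℂ] ℂ), (∀ a b, L a b = L b a) ∧ (∀ a, L a a = 0) ∧
      (∀ a, ∑ b, L a b = 0) ∧ ∀ a v, ∑ b, L a b (ρ (swap a b) v) = if a = z then φ v else 0 := by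
  let f : ((α → V) × (α → V)) →ₗ[ℂ] ℂ := φ.comp ((LinearMap.proj z).comp (LinearMap.fst ℂ _ _))
  have hf : f ∈ LinearMap.range (Psi ρ).dualMap := by
    rw [LinearMap.range_dualMap_eq_dualAnnihilator_ker, Submodule.mem_dualAnnihilator]
    intro p hp
    have := psi_ker hn ρ hN hZ hZ' p hp
    simp [f, this]
  obtain ⟨l, hl⟩ := hf
  let m : α → α → (V →ₗ[ℂ] ℂ) := fun a b => l.comp ((LinearMap.single ℂ (fun _ => α → V) a).comp (LinearMap.single ℂ (fun _ => V) b))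
  have hm : ∀ F : α → α → V, l F = ∑ a, ∑ b, m a b (F a b) := by
    intro F
    have e : F = ∑ a, ∑ b, Pi.single a (Pi.single b (F a b)) := by
      funext c d
      simp only [Finset.sum_apply]
      rw [Finset.sum_eq_single c, Finset.sum_eq_single d]
      · simp
      · intro b _ hb; simp [Pi.single_apply, hb.symm]
      · simp
      · intro b _ hb; simp [Pi.single_apply, hb.symm]
      · simp
    conv_lhs => rw [e]
    simp only [map_sum]
    rfl
  have hl' : ∀ p, l (Psi ρ p) = φ (p.1 z) := fun p => by
    have := LinearMap.congr_fun hl p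
    exact this
  have two : ∀ (a : α) (G : α → α → ℂ), ∑ c, ∑ d, ((if c = a then G c d else 0) + (if d = a then G c d else 0)) =
      ∑ b, (G a b + G b a) := by
    intro a G
    simp only [Finset.sum_add_distrib]
    congr 1
    · rw [Finset.sum_comm]; simp
    · simp
  refine ⟨fun a b => if a = b then 0 else m a b + m b a, ?_, ?_, ?_, ?_⟩
  · intro a b
    by_cases h : a = b
    · simp [h]
    · simp only [if_neg h, if_neg (Ne.symm h)]; abel
  · intro a; simp
  · intro a
    ext v
    have h1 := hl' (0, Pi.single a v)
    rw [hm] at h1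
    have h2 : ∀ c d : α, m c d (Psi ρ (0, Pi.single a v) c d) = 
        -((if c = a then (if c = d then 0 else m c d v) else 0) + (if d = a then (if c = d then 0 else m c d v) else 0)) := by
      intro c d
      simp only [Psi, LinearMap.coe_mk, AddHom.coe_mk, Pi.zero_apply, Pi.single_apply]
      split_ifs <;> simp_all
    simp only [h2, Finset.sum_neg_distrib] at h1
    rw [two a (fun c d => if c = d then 0 else m c d v)] at h1
    simp only [Pi.zero_apply, map_zero, neg_eq_zero] at h1
    rw [LinearMap.sum_apply, LinearMap.zero_apply, ← h1]
    refine Finset.sum_congr rfl fun b _ => ?_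
    by_cases h : a = b
    · simp [h]
    · simp [h, Ne.symm h]
  · intro a v
    have h1 := hl' (Pi.single a v, 0)
    rw [hm] at h1
    have h2 : ∀ c d : α, m c d (Psi ρ (Pi.single a v, 0) c d) = 
        ((if c = a then (if c = d then 0 else m c d (ρ (swap c d) v)) else 0) + (if d = a then (if c = d then 0 else m c d (ρ (swap c d) v)) else 0)) := by
      intro c d
      simp only [Psi, LinearMap.coe_mk, AddHom.coe_mk, Pi.zero_apply, Pi.single_apply]
      split_ifs <;> simp_all
    simp only [h2] at h1
    rw [two a (fun c d => if c = d then 0 else m c d (ρ (swap c d) v))] at h1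
    have h3 : φ ((Pi.single a v : α → V) z) = if a = z then φ v else 0 := by
      by_cases h : a = z
      · subst h; simp
      · rw [if_neg h, Pi.single_apply, if_neg (Ne.symm h), map_zero]
    rw [← h3, ← h1]
    refine Finset.sum_congr rfl fun b _ => ?_
    by_cases h : a = b
    · simp [h]
    · simp [h, Ne.symm h, swap_comm b a]

end case3A
end SymCov

namespace SymCov
open Equiv
section case3A
variable {α : Type} [Fintype α] [DecidableEq α]
variable {V : Type} [AddCommGroup V] [Module ℂ V] [FiniteDimensional ℂ V]

theorem fixz1 (hn : 5 ≤ Fintype.card α) (ρ : Perm α →* (V →ₗ[ℂ] V)) (h : NL ρ) (hN : NoSub ρ)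
    (hZ : NZ ρ 1) (hZ' : NZ ρ (-1)) (z : α) (F : Perm α → ℂ) (hF : F ∈ cf ρ) :
    fixInd {z} * F ∈ cf ρ ^ 3 := by
  rw [cf] at hF
  induction hF using Submodule.span_induction with
  | zero => rw [mul_zero]; exact Submodule.zero_mem _
  | add x y _ _ hx hy => rw [mul_add]; exact Submodule.add_mem _ hx hy
  | smul c x _ hx => rw [mul_smul_comm]; exact Submodule.smul_mem _ _ hx
  | mem x hx =>
    obtain ⟨⟨φ, v⟩, rfl⟩ := hx
    obtain ⟨L, h1, h2, h3, h4⟩ := exlam (by omega) ρ hN hZ hZ' z φ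
    let B := Module.finBasis ℂ V
    have e : (fixInd {z} * fun g => φ (ρ g v)) = ∑ y, ∑ i, 
        (fun g => L (g z) (g y) (B i)) * (fun g => (B.coord i) (ρ g (ρ (swap z y) v))) := by
      funext g
      simp only [Pi.mul_apply, Finset.sum_apply]
      have h5 := h4 (g z) (ρ g v)
      rw [← Equiv.sum_comp g] at h5
      have h6 : fixInd {z} g * φ (ρ g v) = if g z = z then φ (ρ g v) else 0 := by
        simp [fixInd]
      rw [h6, ← h5]
      refine Finset.sum_congr rfl fun y _ => ?_
      have h7 : ρ (swap (g z) (g y)) (ρ g v) = ρ g (ρ (swap z y) v) := by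
        rw [rho_swap]
        simp only [← Module.End.mul_apply]
        rw [mul_assoc, rho_inv_mul, mul_one]
      rw [h7]
      conv_lhs => rw [← B.sum_repr (ρ g (ρ (swap z y) v))]
      rw [map_sum]
      refine Finset.sum_congr rfl fun i _ => ?_
      rw [map_smul, smul_eq_mul, mul_comm]; rfl
    rw [e]
    refine Submodule.sum_mem _ fun y _ => Submodule.sum_mem _ fun i _ => ?_
    by_cases hy : z = y
    · subst hy
      simp only [h2, LinearMap.zero_apply]
      convert Submodule.zero_mem _ using 1
      exact zero_mul _
    · rw [pow_succ]
      refine Submodule.mul_mem_mul ?_ (cf_mem ρ _ _)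
      have := b0 ρ h.1 (qn_of_inj ρ (inj_of_NL hn ρ h)) (by omega) (fun a b => L a b (B i))
        (fun a b => by rw [h1]) (fun a => by rw [h2]; rfl) (fun a => by
          have := LinearMap.congr_fun (h3 a) (B i)
          simpa using this)
      exact this z y hy

theorem fixzk (hn : 5 ≤ Fintype.card α) (ρ : Perm α →* (V →ₗ[ℂ] V)) (h : NL ρ) (hN : NoSub ρ)
    (hZ : NZ ρ 1) (hZ' : NZ ρ (-1)) (z : α) (k : ℕ) (F : Perm α → ℂ) (hF : F ∈ cf ρ ^ (k + 1)) :
    fixInd {z} * F ∈ cf ρ ^ (k + 3) := by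
  rw [pow_succ'] at hF
  rw [add_comm k 3, pow_add]
  induction hF using Submodule.mul_induction_on' with
  | mem_mul_mem m hm n hn' =>
    rw [← mul_assoc]
    exact Submodule.mul_mem_mul (fixz1 hn ρ h hN hZ hZ' z m hm) hn'
  | add x _ y _ hx hy => rw [mul_add]; exact Submodule.add_mem _ hx hy

theorem indS (hn : 5 ≤ Fintype.card α) (ρ : Perm α →* (V →ₗ[ℂ] V)) (h : NL ρ) (hN : NoSub ρ)
    (hZ : NZ ρ 1) (hZ' : NZ ρ (-1)) (S : Finset α) (j i : ℕ) (hS : S.card = 2 * j + 1) (hi : 1 ≤ 2 * j + i)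
    (F : Perm α → ℂ) (hF : F ∈ cf ρ ^ i) : fixInd S * F ∈ cf ρ ^ (2 * j + i + 2) := by
  obtain ⟨z, hz⟩ : S.Nonempty := by rw [← Finset.card_pos]; omega
  obtain ⟨F', hF', hF2⟩ := fixz hn ρ h hN z j (S.subtype (· ≠ z)) (by
    rw [Finset.card_subtype, Finset.filter_ne', Finset.card_erase_of_mem hz, hS]; rfl)
  have e : fixInd S * F = fixInd {z} * (F' * F) := by
    funext g
    simp only [Pi.mul_apply]
    rw [← mul_assoc]
    congr 1
    by_cases hg : g z = z
    · obtain ⟨k, rfl⟩ := os_surj z g hg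
      rw [hF2]
      simp only [fixInd, Finset.mem_singleton, forall_eq, hg, if_true, one_mul, Finset.mem_subtype]
      congr 1
      rw [eq_iff_iff]
      constructor
      · intro hh s hs
        apply Subtype.ext
        rw [← os_coe]; exact hh _ hs
      · intro hh s hs
        by_cases hsz : s = z
        · rw [hsz, hg]
        · have := hh ⟨s, hsz⟩ hs
          have h2 := os_coe z k ⟨s, hsz⟩
          rw [this] at h2
          exact h2
    · have h1 : fixInd S g = 0 := by
        simp only [fixInd]; rw [if_neg]; intro hh; exact hg (hh z hz)
      have h2 : fixInd {z} g = 0 := by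
        simp [fixInd, hg]
      rw [h1, h2, zero_mul]
  rw [e]
  have := fixzk hn ρ h hN hZ hZ' z (2 * j + i - 1) (F' * F) (by
    rw [show 2 * j + i - 1 + 1 = 2 * j + i by omega, pow_add]
    exact Submodule.mul_mem_mul hF' hF)
  rwa [show 2 * j + i - 1 + 3 = 2 * j + i + 2 by omega] at this

end case3A
end SymCov

namespace SymCov
open Equiv
section case3A
variable {α : Type} [Fintype α] [DecidableEq α]
variable {V : Type} [AddCommGroup V] [Module ℂ V]

theorem sum_fix_ne (S : Finset α) : ∑ g : Perm α, fixInd S g ≠ 0 := by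
  have e : ∑ g : Perm α, fixInd S g = ((∑ g : Perm α, open Classical in (if ∀ s ∈ S, g s = s then 1 else 0 : ℕ) : ℕ) : ℂ) := by
    push_cast
    refine Finset.sum_congr rfl fun g _ => ?_
    simp only [fixInd]
    split_ifs <;> rfl
  rw [e, Nat.cast_ne_zero]
  refine (Finset.sum_pos' (fun _ _ => Nat.zero_le _) ⟨1, Finset.mem_univ _, ?_⟩).ne'
  simp

def yy (ρ : Perm α →* (V →ₗ[ℂ] V)) (a b c : α) : V →ₗ[ℂ] V :=
  ρ (swap a b) * ρ (swap b c) - ρ (swap b c) * ρ (swap a b)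

theorem yy_conj (ρ : Perm α →* (V →ₗ[ℂ] V)) (a b c : α) (g : Perm α) :
    ρ g * yy ρ a b c * ρ g⁻¹ = yy ρ (g a) (g b) (g c) := by
  have e : ∀ X Y : V →ₗ[ℂ] V, ρ g * X * ρ g⁻¹ * (ρ g * Y * ρ g⁻¹) = ρ g * (X * Y) * ρ g⁻¹ := by
    intro X Y
    rw [mul_assoc (ρ g * X), ← mul_assoc (ρ g⁻¹), ← mul_assoc (ρ g⁻¹), rho_inv_mul, one_mul]
    simp only [mul_assoc]
  simp only [yy, rho_swap, e, mul_sub, sub_mul]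

theorem braid' (ρ : Perm α →* (V →ₗ[ℂ] V)) {a b c : α} (hab : a ≠ b) (hac : a ≠ c) (hbc : b ≠ c) :
    ρ (swap b c) * ρ (swap a b) * ρ (swap b c) = ρ (swap a c) := by
  rw [swap_comm b c, swap_comm a b, braid ρ hbc.symm hac.symm hab.symm, swap_comm]

theorem yy_12 (ρ : Perm α →* (V →ₗ[ℂ] V)) {a b c : α} (hab : a ≠ b) (hac : a ≠ c) (hbc : b ≠ c) :
    yy ρ b a c = - yy ρ a b c := by
  have h := rsq ρ a b
  simp only [yy, swap_comm b a]
  rw [← braid ρ hab hac hbc, ← mul_assoc, ← mul_assoc, h, one_mul, mul_assoc _ _ (ρ (swap a b)), h, mul_one]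
  abel

theorem yy_23 (ρ : Perm α →* (V →ₗ[ℂ] V)) {a b c : α} (hab : a ≠ b) (hac : a ≠ c) (hbc : b ≠ c) :
    yy ρ a c b = - yy ρ a b c := by
  have h := rsq ρ b c
  simp only [yy, swap_comm c b]
  rw [← braid' ρ hab hac hbc, ← mul_assoc, ← mul_assoc, h, one_mul, mul_assoc _ _ (ρ (swap b c)), h, mul_one]
  abel

theorem yy_13 (ρ : Perm α →* (V →ₗ[ℂ] V)) {a b c : α} (hab : a ≠ b) (hac : a ≠ c) (hbc : b ≠ c) :
    yy ρ c b a = - yy ρ a b c := by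
  simp only [yy, swap_comm c b, swap_comm b a]; abel

def TT (ρ : Perm α →* (V →ₗ[ℂ] V)) (a b c d : α) : V →ₗ[ℂ] V :=
  yy ρ a b c - yy ρ a b d + yy ρ a c d - yy ρ b c d

theorem TT_conj (ρ : Perm α →* (V →ₗ[ℂ] V)) (a b c d : α) (g : Perm α) :
    ρ g * TT ρ a b c d * ρ g⁻¹ = TT ρ (g a) (g b) (g c) (g d) := by
  simp only [TT, ← yy_conj, mul_sub, mul_add, sub_mul, add_mul]

theorem TT_swap (ρ : Perm α →* (V →ₗ[ℂ] V)) {a b c d : α} (hab : a ≠ b) (hac : a ≠ c) (had : a ≠ d)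
    (hbc : b ≠ c) (hbd : b ≠ d) (hcd : c ≠ d) (x y : α) (hx : x ∈ ({a, b, c, d} : Finset α))
    (hy : y ∈ ({a, b, c, d} : Finset α)) (hxy : x ≠ y) :
    ρ (swap x y) * TT ρ a b c d * ρ (swap x y)⁻¹ = - TT ρ a b c d := by
  rw [TT_conj]
  have s1 : TT ρ b a c d = - TT ρ a b c d := by
    simp only [TT]; rw [yy_12 ρ hab hac hbc, yy_12 ρ hab had hbd]; abel
  have s2 : TT ρ c b a d = - TT ρ a b c d := by
    simp only [TT]; rw [yy_13 ρ hab hac hbc, yy_12 ρ hab had hbd, yy_12 ρ hac had hcd, yy_12 ρ hbc hbd hcd]; abel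
  have s3 : TT ρ d b c a = - TT ρ a b c d := by
    simp only [TT]; rw [yy_12 ρ hbd hbc hcd.symm, yy_23 ρ hbc hbd hcd, yy_13 ρ hab had hbd, yy_13 ρ hac had hcd]
    rw [show yy ρ b c a = yy ρ a b c by rw [yy_23 ρ hab.symm hbc hac, yy_12 ρ hab hac hbc, neg_neg]]
    abel
  have s4 : TT ρ a c b d = - TT ρ a b c d := by
    simp only [TT]; rw [yy_23 ρ hab hac hbc, yy_12 ρ hbc hbd hcd]; abel
  have s5 : TT ρ a d c b = - TT ρ a b c d := by
    simp only [TT]; rw [yy_23 ρ hac had hcd, yy_23 ρ hab had hbd, yy_23 ρ hab hac hbc, yy_13 ρ hbc hbd hcd]; abel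
  have s6 : TT ρ a b d c = - TT ρ a b c d := by
    simp only [TT]; rw [yy_23 ρ hac had hcd, yy_23 ρ hbc hbd hcd]; abel
  simp only [Finset.mem_insert, Finset.mem_singleton] at hx hy
  have hba := hab.symm
  have hca := hac.symm
  have hda := had.symm
  have hcb := hbc.symm
  have hdb := hbd.symm
  have hdc := hcd.symm
  rcases hx with rfl | rfl | rfl | rfl <;> rcases hy with rfl | rfl | rfl | rfl <;>
    first
    | exact absurd rfl hxy
    | (simp only [swap_apply_left, swap_apply_right, swap_apply_of_ne_of_ne, ne_eq, hab, hac, had, hbc, hbd, hcd, hba, hca, hda, hcb, hdb, hdc, not_false_eq_true]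
       assumption)

theorem TT_sgn (ρ : Perm α →* (V →ₗ[ℂ] V)) {a b c d : α} (hab : a ≠ b) (hac : a ≠ c) (had : a ≠ d)
    (hbc : b ≠ c) (hbd : b ≠ d) (hcd : c ≠ d) (g : Perm α) (hg : ∀ x, x ∉ ({a, b, c, d} : Finset α) → g x = x) :
    ρ g * TT ρ a b c d * ρ g⁻¹ = ((Perm.sign g : ℤ) : ℂ) • TT ρ a b c d := by
  refine supp_ind {a, b, c, d} (fun g => ρ g * TT ρ a b c d * ρ g⁻¹ = ((Perm.sign g : ℤ) : ℂ) • TT ρ a b c d) (by simp) ?_ g hg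
  intro x hx y hy hxy g hg
  rw [Perm.sign_mul, Perm.sign_swap hxy, map_mul, mul_inv_rev, map_mul]
  have e : ρ (swap x y) * ρ g * TT ρ a b c d * (ρ g⁻¹ * ρ (swap x y)⁻¹) =
      ρ (swap x y) * (ρ g * TT ρ a b c d * ρ g⁻¹) * ρ (swap x y)⁻¹ := by simp only [mul_assoc]
  rw [e, hg, mul_smul_comm, smul_mul_assoc, TT_swap ρ hab hac had hbc hbd hcd x y hx hy hxy]
  simp

theorem TT_ex (ρ : Perm α →* (V →ₗ[ℂ] V)) (hinj : Function.Injective ρ) (κ : ℂ) (hκ : ∀ z, ∑ i, ρ (swap i z) = κ • 1)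
    {a b c : α} (hab : a ≠ b) (hac : a ≠ c) (hbc : b ≠ c) : ∃ d, a ≠ d ∧ b ≠ d ∧ c ≠ d ∧ TT ρ a b c d ≠ 0 := by
  by_contra hcon
  push Not at hcon
  have hz : ∀ a b, ∑ d, yy ρ a b d = 0 := by
    intro a b
    simp only [yy, Finset.sum_sub_distrib, ← Finset.mul_sum, ← Finset.sum_mul]
    rw [show ∑ i, ρ (swap b i) = κ • 1 by rw [← hκ b]; exact Finset.sum_congr rfl fun i _ => by rw [swap_comm]]
    simp
  have y0 : ∀ a b, yy ρ a b a = 0 := fun a b => by simp [yy, swap_comm]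
  have y1 : ∀ a b, yy ρ a b b = 0 := fun a b => by
    have : ρ (swap b b) = 1 := by simp only [swap_self]; exact map_one ρ
    rw [yy, this, mul_one, one_mul, sub_self]
  have hT : ∀ d, TT ρ a b c d = 0 := by
    intro d
    by_cases h1 : a = d
    · subst h1
      simp only [TT, y0]
      rw [show yy ρ b c a = yy ρ a b c by rw [yy_23 ρ hab.symm hbc hac, yy_12 ρ hab hac hbc, neg_neg]]
      abel
    by_cases h2 : b = d
    · subst h2
      simp only [TT, y0, y1]
      rw [yy_23 ρ hab hac hbc]; abel
    by_cases h3 : c = d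
    · subst h3
      simp only [TT, y1]
      abel
    exact hcon d h1 h2 h3
  have hs : ∑ d, TT ρ a b c d = 0 := Finset.sum_eq_zero fun d _ => hT d
  simp only [TT, Finset.sum_sub_distrib, Finset.sum_add_distrib, hz, Finset.sum_const, sub_zero, add_zero, Finset.card_univ] at hs
  rw [← Nat.cast_smul_eq_nsmul ℂ, smul_eq_zero] at hs
  rcases hs with hs | hs
  · rw [Nat.cast_eq_zero, Fintype.card_eq_zero_iff] at hs
    exact hs.elim a
  · rw [yy, sub_eq_zero, ← map_mul, ← map_mul] at hs
    have := Equiv.congr_fun (hinj hs) c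
    simp only [Perm.mul_apply, swap_apply_right] at this
    rw [swap_apply_of_ne_of_ne hac.symm hbc.symm, swap_apply_right] at this
    exact hab this

theorem NZ_or (hn : 5 ≤ Fintype.card α) (ρ : Perm α →* (V →ₗ[ℂ] V)) (hinj : Function.Injective ρ) : NZ ρ 1 ∨ NZ ρ (-1) := by
  by_contra hcon
  push Not at hcon
  have h1 := not_NZ ρ _ hcon.1
  have h2 := not_NZ ρ _ hcon.2
  have key : ∀ a b c, a ≠ b → a ≠ c → b ≠ c → ρ (swap a b) * ρ (swap b c) + ρ (swap b c) * ρ (swap a b) = -1 := by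
    intro a b c hab hac hbc
    have e1 := h1 a b c hab hac hbc
    have e2 := h2 a b c hab hac hbc
    have e3 : (2 : ℂ) • (1 + (ρ (swap a b) * ρ (swap b c) + ρ (swap b c) * ρ (swap a b))) = s3 ρ 1 a b c + s3 ρ (-1) a b c := by
      simp only [s3]; module
    rw [e1, e2, add_zero, smul_eq_zero] at e3
    exact (neg_eq_of_add_eq_zero_right (e3.resolve_left two_ne_zero)).symm
  obtain ⟨T, hT, hc⟩ := Finset.exists_subset_card_eq (s := (Finset.univ : Finset α)) (n := 4) (by rw [Finset.card_univ]; omega)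
  obtain ⟨a, b, c, d, hab, hac, had, hbc, hbd, hcd, rfl⟩ := Finset.card_eq_four.1 hc
  have hw := braid' ρ hbc hbd hcd
  have k1 := key b c d hbc hbd hcd
  have k2 := key a b c hab hac hbc
  have k3 := key a b d hab had hbd
  have cm : ρ (swap c d) * ρ (swap a b) = ρ (swap a b) * ρ (swap c d) := by
    rw [← map_mul, ← map_mul]
    congr 1
    rw [Equiv.mul_swap_eq_swap_mul, swap_apply_of_ne_of_ne hac had, swap_apply_of_ne_of_ne hbc hbd]
  have hw2 : ρ (swap b d) = - ρ (swap c d) - ρ (swap b c) := by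
    rw [← hw, mul_assoc, eq_sub_of_add_eq k1, mul_sub, ← mul_assoc, rsq, one_mul]; simp
  rw [hw2] at k3
  have k4 : (2 : ℂ) • (ρ (swap a b) * ρ (swap c d)) = (2 : ℂ) • 1 := by
    have e : (2 : ℂ) • (ρ (swap a b) * ρ (swap c d)) = - (ρ (swap a b) * (-ρ (swap c d) - ρ (swap b c)) + (-ρ (swap c d) - ρ (swap b c)) * ρ (swap a b))
      - (ρ (swap a b) * ρ (swap b c) + ρ (swap b c) * ρ (swap a b)) := by
      simp only [mul_sub, sub_mul, mul_neg, neg_mul, cm]; module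
    rw [e, k3, k2]; module
  have k5 := smul_right_injective _ (two_ne_zero (α := ℂ)) k4
  rw [← map_mul, ← map_one ρ] at k5
  have := Equiv.congr_fun (hinj k5) a
  rw [Perm.mul_apply, swap_apply_of_ne_of_ne hac had, swap_apply_left] at this
  exact hab this.symm

theorem s3_act (ρ : Perm α →* (V →ₗ[ℂ] V)) (ε : ℂ) (he : ε * ε = 1) (χ : Perm α → ℂ) (h1 : χ 1 = 1)
    (h2 : ∀ a b g, a ≠ b → χ (swap a b * g) = ε * χ g) {a b c : α} (hab : a ≠ b) (hac : a ≠ c) (hbc : b ≠ c)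
    (g : Perm α) (hg : ∀ x, x ∉ ({a, b, c} : Finset α) → g x = x) :
    ρ g * s3 ρ ε a b c = χ g • s3 ρ ε a b c := by
  refine supp_ind {a, b, c} (fun g => ρ g * s3 ρ ε a b c = χ g • s3 ρ ε a b c) (by simp [h1]) ?_ g hg
  have e1 := s3_ab' ρ ε he a b c
  have e2 := s3_bc' ρ ε he hab hac hbc
  have e3 : ρ (swap a c) * s3 ρ ε a b c = ε • s3 ρ ε a b c := by
    rw [← braid ρ hab hac hbc, mul_assoc, mul_assoc, e1, mul_smul_comm, e2, smul_smul, he, one_smul, e1]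
  intro x hx y hy hxy g hg
  have e : ρ (swap x y) * s3 ρ ε a b c = ε • s3 ρ ε a b c := by
    simp only [Finset.mem_insert, Finset.mem_singleton] at hx hy
    rcases hx with rfl | rfl | rfl <;> rcases hy with rfl | rfl | rfl <;>
    first
    | exact absurd rfl hxy
    | assumption
    | (rw [swap_comm]; assumption)
  rw [h2 x y g hxy, map_mul, mul_assoc, hg, mul_smul_comm, e, smul_smul, mul_comm]

end case3A
end SymCov

namespace SymCov
open Equiv
section case3A
variable {α : Type} [Fintype α] [DecidableEq α]
variable {V : Type} [AddCommGroup V] [Module ℂ V]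

theorem fixInd_cases (S : Finset α) (g : Perm α) : fixInd S g = 0 ∨ (fixInd S g = 1 ∧ ∀ s ∈ S, g s = s) := by
  by_cases h : ∀ s ∈ S, g s = s
  · right; exact ⟨by simp only [fixInd]; rw [if_pos h], h⟩
  · left; simp only [fixInd]; rw [if_neg h]

theorem exvec {T : V →ₗ[ℂ] V} (h : T ≠ 0) : ∃ v, ∃ φ : Module.Dual ℂ V, φ (T v) ≠ 0 := by
  obtain ⟨v, hv⟩ : ∃ v, T v ≠ 0 := by
    by_contra hcon
    push Not at hcon
    exact h (LinearMap.ext hcon)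
  obtain ⟨φ, hφ⟩ := not_forall.1 ((Module.forall_dual_apply_eq_zero_iff ℂ _).not.2 hv)
  exact ⟨v, φ, hφ⟩

theorem sgn_sq (g : Perm α) : ((Perm.sign g : ℤ) : ℂ) * ((Perm.sign g : ℤ) : ℂ) = 1 := by
  rw [← Int.cast_mul, ← Units.val_mul, Int.units_mul_self]; simp

theorem case3A [FiniteDimensional ℂ V] (hn : 5 ≤ Fintype.card α) (ρ : Perm α →* (V →ₗ[ℂ] V)) (h : NL ρ)
    (hN : NoSub ρ) (hZ : NZ ρ 1) (hZ' : NZ ρ (-1)) : Cov ρ := by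
  have hinj := inj_of_NL hn ρ h
  obtain ⟨κ, hκ⟩ := kappa ρ h.1 hN
  obtain ⟨T, hT, hc⟩ := Finset.exists_subset_card_eq (s := (Finset.univ : Finset α)) (n := 3) (by rw [Finset.card_univ]; omega)
  obtain ⟨a, b, c, hab, hac, hbc, rfl⟩ := Finset.card_eq_three.1 hc
  rcases Nat.even_or_odd' (Fintype.card α) with ⟨m, hm | hm⟩
  · -- even
    have hcard : (({a, b, c} : Finset α)ᶜ).card = 2 * (m - 2) + 1 := by
      rw [Finset.card_compl, hc]; omega
    have main : ∀ (ε : ℂ) (he : ε * ε = 1) (χ : Perm α → ℂ) (h1 : χ 1 = 1) 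
        (h2 : ∀ a b g, a ≠ b → χ (swap a b * g) = ε * χ g) (hZ : NZ ρ ε), ∃ F ∈ cf ρ ^ (Fintype.card α - 1), ∃ q : ℂ, q ≠ 0 ∧
          ∀ g, F g = q * (fixInd ({a, b, c} : Finset α)ᶜ g * χ g) := by
      intro ε he χ h1 h2 hZ
      obtain ⟨v, φ, hφ⟩ := exvec (hZ a b c hab hac hbc)
      have := indS hn ρ h hN ‹_› hZ' _ (m - 2) 1 hcard (by omega) _ (by rw [pow_one]; exact cf_mem ρ φ (s3 ρ ε a b c v))
      rw [show 2 * (m - 2) + 1 + 2 = Fintype.card α - 1 by omega] at this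
      refine ⟨_, this, _, hφ, fun g => ?_⟩
      simp only [Pi.mul_apply]
      rcases fixInd_cases ({a, b, c} : Finset α)ᶜ g with hg | ⟨hg, hg'⟩
      · rw [hg]; ring
      · rw [hg, ← Module.End.mul_apply, s3_act ρ ε he χ h1 h2 hab hac hbc g (fun x hx => hg' x (Finset.mem_compl.2 hx))]
        simp [mul_comm]
    have hsg : ∀ (a b : α) (g : Perm α), a ≠ b → ((Perm.sign (swap a b * g) : ℤ) : ℂ) = (-1) * ((Perm.sign g : ℤ) : ℂ) := by
      intro a b g hab
      rw [Perm.sign_mul, Perm.sign_swap hab]; simp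
    constructor
    · intro W _ _ _ σ hσ
      refine ⟨Fintype.card α - 1, by omega, le_rfl, ?_⟩
      have main2 : ∀ (ε : ℂ) (he : ε * ε = 1) (χ : Perm α → ℂ) (h1 : χ 1 = 1) 
        (h2 : ∀ a b g, a ≠ b → χ (swap a b * g) = ε * χ g) (h3 : ∀ g, χ g * χ g⁻¹ = 1) (hZ : NZ ρ ε) (hZ2 : NZ σ ε),
          ∃ F ∈ cf ρ ^ (Fintype.card α - 1), ∑ g, F g • σ g⁻¹ ≠ 0 := by
        intro ε he χ h1 h2 h3 hZ hZ2
        obtain ⟨F, hF, q, hq, hFq⟩ := main ε he χ h1 h2 hZ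
        refine ⟨F, hF, fun h0 => ?_⟩
        have h4 : (∑ g, F g • σ g⁻¹) * s3 σ ε a b c = (q * ∑ g : Perm α, fixInd ({a, b, c} : Finset α)ᶜ g) • s3 σ ε a b c := by
          rw [Finset.sum_mul, Finset.mul_sum, Finset.sum_smul]
          refine Finset.sum_congr rfl fun g _ => ?_
          rw [hFq, smul_mul_assoc]
          rcases fixInd_cases ({a, b, c} : Finset α)ᶜ g with hg | ⟨hg, hg'⟩
          · rw [hg]; simp
          · rw [hg, s3_act σ ε he χ h1 h2 hab hac hbc g⁻¹ (fun x hx => by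
              rw [Perm.inv_eq_iff_eq, hg' x (Finset.mem_compl.2 hx)]), smul_smul, mul_assoc, one_mul, h3]
        rw [h0, zero_mul] at h4
        rcases smul_eq_zero.1 h4.symm with h5 | h5
        · exact (mul_ne_zero hq (sum_fix_ne _)) h5
        · exact hZ2 a b c hab hac hbc h5
      rcases NZ_or hn σ (inj_of_NL hn σ hσ) with hz | hz
      · exact main2 1 (by norm_num) (fun _ => 1) rfl (fun _ _ _ _ => by simp) (fun _ => by simp) hZ hz
      · exact main2 (-1) (by norm_num) (fun g => ((Perm.sign g : ℤ) : ℂ)) (by simp) hsg (fun g => by rw [Perm.sign_inv, sgn_sq]) hZ' hz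
    · obtain ⟨F, hF, q, hq, hFq⟩ := main (-1) (by norm_num) (fun g => ((Perm.sign g : ℤ) : ℂ)) (by simp) hsg hZ'
      refine ⟨Fintype.card α - 1, by omega, le_rfl, F, hF, ?_⟩
      simp only [hFq, mul_assoc, sgn_sq, mul_one, ← Finset.mul_sum]
      exact mul_ne_zero hq (sum_fix_ne _)
  · -- odd
    constructor
    · intro W _ _ _ σ hσ
      have hc2 : ((Finset.univ.erase a).erase b).card = 2 * (m - 1) + 1 := by
        rw [Finset.card_erase_of_mem (Finset.mem_erase.2 ⟨hab.symm, Finset.mem_univ _⟩), Finset.card_erase_of_mem (Finset.mem_univ _), Finset.card_univ]; omega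
      have := indS hn ρ h hN hZ hZ' _ (m - 1) 0 hc2 (by omega) 1 (by rw [pow_zero]; exact Submodule.one_le.1 le_rfl)
      rw [mul_one, fix_two hab] at this
      exact ⟨_, by omega, by omega, _, this, two_good hn σ hσ hab⟩
    · obtain ⟨d, had, hbd, hcd, hT⟩ := TT_ex ρ hinj κ hκ hab hac hbc
      obtain ⟨Y, hY⟩ := not_forall.1 ((Module.forall_dual_apply_eq_zero_iff ℂ _).not.2 hT)
      have hcard : (({a, b, c, d} : Finset α)ᶜ).card = 2 * (m - 2) + 1 := by
        rw [Finset.card_compl, Finset.card_eq_four.2 ⟨a, b, c, d, hab, hac, had, hbc, hbd, hcd, rfl⟩]; omega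
      have := indS hn ρ h hN hZ hZ' _ (m - 2) 2 hcard (by omega) _ (dmemS ρ h.1 (TT ρ a b c d) Y)
      refine ⟨_, by omega, by omega, _, this, ?_⟩
      have e : ∀ g : Perm α, (fixInd ({a, b, c, d} : Finset α)ᶜ * fun g => Y (ρ g * TT ρ a b c d * ρ g⁻¹)) g * ((Perm.sign g : ℤ) : ℂ) =
          fixInd ({a, b, c, d} : Finset α)ᶜ g * Y (TT ρ a b c d) := by
        intro g
        simp only [Pi.mul_apply]
        rcases fixInd_cases ({a, b, c, d} : Finset α)ᶜ g with hg | ⟨hg, hg'⟩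
        · rw [hg]; ring
        · rw [hg, TT_sgn ρ hab hac had hbc hbd hcd g (fun x hx => hg' x (Finset.mem_compl.2 hx)), map_smul, smul_eq_mul, one_mul, one_mul,
            mul_right_comm, sgn_sq, one_mul]
      simp only [e, ← Finset.sum_mul]
      exact mul_ne_zero (sum_fix_ne _) hY

end case3A
end SymCov

namespace SymCov
open Equiv
section case3B
variable {α : Type} [Fintype α] [DecidableEq α]
variable {V : Type} [AddCommGroup V] [Module ℂ V]

def sg : Perm α → ℂ := fun g => ((Perm.sign g : ℤ) : ℂ)

theorem sg_mul (g h : Perm α) : sg (g * h) = sg g * sg h := by simp [sg]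
theorem sg_one : sg (1 : Perm α) = 1 := by simp [sg]
theorem sg_inv (g : Perm α) : sg g⁻¹ = sg g := by simp [sg]
theorem sg_sq (g : Perm α) : sg g * sg g = 1 := sgn_sq g

def tw (ρ : Perm α →* (V →ₗ[ℂ] V)) : Perm α →* (V →ₗ[ℂ] V) where
  toFun g := sg g • ρ g
  map_one' := by rw [sg_one, one_smul, map_one]
  map_mul' g h := by rw [sg_mul, map_mul, smul_mul_smul_comm]

theorem tw_apply (ρ : Perm α →* (V →ₗ[ℂ] V)) (g) : tw ρ g = sg g • ρ g := rfl

theorem tw_mem (ρ : Perm α →* (V →ₗ[ℂ] V)) (U : Submodule ℂ V) (g) (v) (h : tw ρ g v ∈ U) : ρ g v ∈ U := by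
  have := U.smul_mem (sg g) h
  rwa [tw_apply, LinearMap.smul_apply, smul_smul, sg_sq, one_smul] at this

theorem tw_NL (ρ : Perm α →* (V →ₗ[ℂ] V)) (h : NL ρ) : NL (tw ρ) :=
  ⟨⟨h.1.1, fun U hU => h.1.2 U fun g v hv => tw_mem ρ U g v (hU g v hv)⟩, h.2⟩

theorem tw_NoSub (ρ : Perm α →* (V →ₗ[ℂ] V)) (h : NoSub ρ) : NoSub (tw ρ) :=
  fun z U hU => h z U fun g hg v hv => tw_mem ρ U g v (hU g hg v hv)

theorem tw_cf (ρ : Perm α →* (V →ₗ[ℂ] V)) (F : Perm α → ℂ) (hF : F ∈ cf (tw ρ)) : sg * F ∈ cf ρ := by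
  rw [cf] at hF
  induction hF using Submodule.span_induction with
  | zero => rw [mul_zero]; exact Submodule.zero_mem _
  | add x y _ _ hx hy => rw [mul_add]; exact Submodule.add_mem _ hx hy
  | smul c x _ hx => rw [mul_smul_comm]; exact Submodule.smul_mem _ _ hx
  | mem x hx =>
    obtain ⟨⟨φ, v⟩, rfl⟩ := hx
    convert cf_mem ρ φ v using 1
    funext g
    simp only [Pi.mul_apply, tw_apply, LinearMap.smul_apply, map_smul, smul_eq_mul]
    rw [← mul_assoc, sg_sq, one_mul]

theorem tw_cf_pow (ρ : Perm α →* (V →ₗ[ℂ] V)) (k : ℕ) (F : Perm α → ℂ) (hF : F ∈ cf (tw ρ) ^ k) : sg ^ k * F ∈ cf ρ ^ k := by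
  induction k generalizing F with
  | zero => simpa using hF
  | succ k ih =>
    rw [pow_succ] at hF
    rw [pow_succ (cf ρ)]
    induction hF using Submodule.mul_induction_on' with
    | mem_mul_mem m hm n hn' =>
      rw [pow_succ, mul_mul_mul_comm]
      exact Submodule.mul_mem_mul (ih m hm) (tw_cf ρ n hn')
    | add x _ y _ hx hy => rw [mul_add]; exact Submodule.add_mem _ hx hy

theorem tw_s3 (ρ : Perm α →* (V →ₗ[ℂ] V)) {a b c : α} (hab : a ≠ b) (hbc : b ≠ c) :
    s3 (tw ρ) (-1) a b c = s3 ρ 1 a b c := by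
  simp only [s3, tw_apply, sg, Perm.sign_swap hab, Perm.sign_swap hbc]
  simp

/-- consequence of b₃ = 0 -/
def BB (ρ : Perm α →* (V →ₗ[ℂ] V)) : Prop :=
  ∀ a b c, a ≠ b → a ≠ c → b ≠ c → ∀ w, ρ (swap a b) w = -w → ρ (swap a c) w + ρ (swap b c) w = w

theorem BB_of (ρ : Perm α →* (V →ₗ[ℂ] V)) (h : ∀ a b c, a ≠ b → a ≠ c → b ≠ c → s3 ρ (-1) a b c = 0) : BB ρ := by
  intro a b c hab hac hbc w hw
  have h1 := LinearMap.congr_fun (h a b c hab hac hbc) w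
  have h2 := LinearMap.congr_fun (braid ρ hab hac hbc) w
  simp only [s3, LinearMap.add_apply, LinearMap.smul_apply, Module.End.mul_apply, Module.End.one_apply, hw, map_neg, LinearMap.zero_apply] at h1 h2
  rw [← h2]
  have e : (2 : ℂ) • (-(ρ (swap a b)) ((ρ (swap b c)) w) + ρ (swap b c) w - w) = 0 := by
    rw [← neg_eq_zero, ← h1]; module
  have e2 := (smul_eq_zero.1 e).resolve_left two_ne_zero
  rwa [sub_eq_zero] at e2

def Mat (ρ : Perm α →* (V →ₗ[ℂ] V)) (r : ℕ) : Prop :=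
  ∃ f : Fin r ⊕ Fin r ↪ α, ∃ u : V, u ≠ 0 ∧ ∀ i, ρ (swap (f (Sum.inl i)) (f (Sum.inr i))) u = -u

theorem comm4 (ρ : Perm α →* (V →ₗ[ℂ] V)) {a b c d : α} (hac : a ≠ c) (had : a ≠ d) (hbc : b ≠ c) (hbd : b ≠ d) (v : V) :
    ρ (swap a b) (ρ (swap c d) v) = ρ (swap c d) (ρ (swap a b) v) := by
  rw [← Module.End.mul_apply, ← Module.End.mul_apply, ← map_mul, ← map_mul]
  congr 2
  rw [Equiv.mul_swap_eq_swap_mul, swap_apply_of_ne_of_ne hac.symm hbc.symm, swap_apply_of_ne_of_ne had.symm hbd.symm]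

theorem rsq_apply (ρ : Perm α →* (V →ₗ[ℂ] V)) (a b : α) (v : V) : ρ (swap a b) (ρ (swap a b) v) = v := by
  rw [← Module.End.mul_apply, rsq]; rfl

theorem matching (hn : 5 ≤ Fintype.card α) (ρ : Perm α →* (V →ₗ[ℂ] V)) (hinj : Function.Injective ρ) (hB : BB ρ)
    (κ : ℂ) (hκ : ∀ z, ∑ i, ρ (swap i z) = κ • 1) : ∃ r, ∃ f : Fin r ⊕ Fin r ≃ α, ∃ u : V, u ≠ 0 ∧
      ∀ i, ρ (swap (f (Sum.inl i)) (f (Sum.inr i))) u = -u := by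
  classical
  have hb : ∀ r, Mat ρ r → r ≤ Fintype.card α := by
    rintro r ⟨f, _⟩
    have := Fintype.card_le_of_embedding f
    simp at this; omega
  have h1 : Mat ρ 1 := by
    have : Nontrivial α := by rw [← Fintype.one_lt_card_iff_nontrivial]; omega
    obtain ⟨a, b, hab⟩ := exists_pair_ne α
    have hne : ρ 1 - ρ (swap a b) ≠ 0 := fun hh => by
      have := Equiv.congr_fun (hinj (sub_eq_zero.1 hh)) a
      simp at this
      exact hab this
    obtain ⟨v, φ, hφ⟩ := exvec hne
    refine ⟨⟨Sum.elim (fun _ => a) (fun _ => b), ?_⟩, (ρ 1 - ρ (swap a b)) v, fun h => by rw [h, map_zero] at hφ; exact hφ rfl, ?_⟩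
    · rintro (x | x) (y | y) h
      · rw [Subsingleton.elim x y]
      · exact absurd h hab
      · exact absurd h hab.symm
      · rw [Subsingleton.elim x y]
    · intro i
      change ρ (swap a b) _ = _
      simp only [map_one, LinearMap.sub_apply, Module.End.one_apply, map_sub, rsq_apply]
      abel
  obtain ⟨r, hr, hmax⟩ : ∃ r, Mat ρ r ∧ ¬ Mat ρ (r + 1) ∧ 1 ≤ r := by
    have hs := Nat.findGreatest_spec (P := Mat ρ) (n := Fintype.card α) (m := 1) (by omega) h1
    refine ⟨_, hs, fun hh => ?_, Nat.le_findGreatest (by omega) h1⟩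
    have := Nat.le_findGreatest (hb _ hh) hh
    omega
  obtain ⟨f, u, hu, hf⟩ := hr
  have hcard : 2 * r ≤ Fintype.card α := by
    have := Fintype.card_le_of_embedding f
    simp at this; omega
  by_cases hsurj : Function.Surjective f
  · exact ⟨r, Equiv.ofBijective f ⟨f.injective, hsurj⟩, u, hu, hf⟩
  exfalso
  simp only [Function.Surjective, not_forall, not_exists] at hsurj
  obtain ⟨p, hp⟩ := hsurj
  have hun : ∀ q, (∀ x, f x ≠ q) → ρ (swap q p) u = u := by
    intro q hq
    by_contra hcon
    have hpq : p ≠ q := by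
      rintro rfl; apply hcon; simp only [swap_self]; rw [show (Equiv.refl α : Perm α) = 1 from rfl, map_one]; rfl
    apply hmax.1
    refine ⟨⟨Sum.elim (Fin.cons p (fun i => f (Sum.inl i))) (Fin.cons q (fun i => f (Sum.inr i))), ?_⟩, u - ρ (swap q p) u, sub_ne_zero.2 (Ne.symm hcon), ?_⟩
    · rintro (x | x) (y | y) h <;> simp only [Sum.elim_inl, Sum.elim_inr] at h <;> revert h <;>
        refine Fin.cases ?_ (fun i => ?_) x <;> refine Fin.cases ?_ (fun j => ?_) y <;> intro h <;>
        simp only [Fin.cons_zero, Fin.cons_succ] at h <;>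
        first
        | rfl
        | exact absurd h hpq
        | exact absurd h hpq.symm
        | exact absurd h (hp _)
        | exact absurd h (hq _)
        | exact absurd h.symm (hp _)
        | exact absurd h.symm (hq _)
        | (have := f.injective h; simp at this; try rw [this])
    · intro i
      refine Fin.cases ?_ (fun i => ?_) i
      · change ρ (swap p q) (u - ρ (swap q p) u) = -(u - ρ (swap q p) u)
        simp only [map_sub, swap_comm p q, rsq_apply]
        abel
      · change ρ (swap (f (Sum.inl i)) (f (Sum.inr i))) (u - ρ (swap q p) u) = -(u - ρ (swap q p) u)
        rw [map_sub]
        rw [comm4 ρ (hq _) (hp _) (hq _) (hp _), hf, map_neg]; abel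
  have hne : ∀ i, f (Sum.inl i) ≠ f (Sum.inr i) := fun i h => by have := f.injective h; simp at this
  -- κ from p
  have k1 : κ • u = ((Fintype.card α : ℂ) - r) • u := by
    have e := LinearMap.congr_fun (hκ p) u
    rw [LinearMap.sum_apply] at e
    have e2 : κ • u = ∑ i, ρ (swap i p) u := by rw [e]; rfl
    rw [e2]
    rw [← Finset.sum_add_sum_compl (Finset.univ.map f), Finset.sum_map, Fintype.sum_sum_type, ← Finset.sum_add_distrib]
    rw [Finset.sum_congr rfl (fun i _ => hB _ _ p (hne i) (hp _) (hp _) u (hf i)),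
      Finset.sum_congr (s₁ := (Finset.univ.map f)ᶜ) rfl (fun q hq => hun q (fun x hx => by
        rw [Finset.mem_compl] at hq
        exact hq (Finset.mem_map.2 ⟨x, Finset.mem_univ _, hx⟩)))]
    simp only [Finset.sum_const, Finset.card_compl, Finset.card_map, Finset.card_univ, Fintype.card_sum, Fintype.card_fin]
    rw [← Nat.cast_smul_eq_nsmul ℂ, ← Nat.cast_smul_eq_nsmul ℂ, ← add_smul, Nat.cast_sub (by omega)]
    push_cast
    congr 1; ring
  obtain ⟨i0⟩ : Nonempty (Fin r) := ⟨⟨0, by omega⟩⟩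
  have k2 : (2 * κ) • u = ((Fintype.card α : ℂ) - 2) • u := by
    have e := LinearMap.congr_fun (hκ (f (Sum.inl i0))) u
    have e' := LinearMap.congr_fun (hκ (f (Sum.inr i0))) u
    rw [LinearMap.sum_apply] at e e'
    have e2 : (2 * κ) • u = ∑ i, (ρ (swap i (f (Sum.inl i0))) u + ρ (swap i (f (Sum.inr i0))) u) := by
      rw [Finset.sum_add_distrib, e, e', LinearMap.smul_apply, Module.End.one_apply]; module
    rw [e2]
    have hs : ∀ a : α, ρ (swap a a) u = u := fun a => by
      simp only [swap_self]; rw [show (Equiv.refl α : Perm α) = 1 from rfl, map_one]; rfl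
    have hf' := hf i0
    have hxy := hne i0
    have key : ∀ i, ρ (swap i (f (Sum.inl i0))) u + ρ (swap i (f (Sum.inr i0))) u =
        if i ∈ ({f (Sum.inl i0), f (Sum.inr i0)} : Finset α) then 0 else u := by
      intro i
      split_ifs with h
      · rw [Finset.mem_insert, Finset.mem_singleton] at h
        rcases h with h | h
        · rw [h, hs, hf']; abel
        · rw [h, hs, swap_comm, hf']; abel
      · rw [Finset.mem_insert, Finset.mem_singleton, not_or] at h
        rw [swap_comm i, swap_comm i]
        exact hB _ _ i hxy (Ne.symm h.1) (Ne.symm h.2) u hf'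
    rw [Finset.sum_congr rfl (fun i _ => key i), Finset.sum_ite, Finset.sum_const_zero, zero_add, Finset.sum_const]
    have hc : (Finset.univ.filter (fun i => i ∉ ({f (Sum.inl i0), f (Sum.inr i0)} : Finset α))).card = Fintype.card α - 2 := by
      rw [← Finset.compl_filter, Finset.card_compl, Finset.filter_mem_eq_inter, Finset.univ_inter, Finset.card_pair hxy]
    rw [hc, ← Nat.cast_smul_eq_nsmul ℂ, Nat.cast_sub (by omega)]
    norm_num
  have k3 : (2 * ((Fintype.card α : ℂ) - r) - ((Fintype.card α : ℂ) - 2)) • u = 0 := by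
    rw [sub_smul, ← k2, mul_smul, ← k1, mul_smul, sub_self]
  have k4 := (smul_eq_zero.1 k3).resolve_right hu
  have k5 : (Fintype.card α : ℂ) + 2 = ((2 * r : ℕ) : ℂ) := by push_cast; linear_combination k4
  have k6 : Fintype.card α + 2 = 2 * r := by exact_mod_cast k5
  omega

end case3B
end SymCov

namespace SymCov
open Equiv
section f0
variable {ι : Type} [Fintype ι] [DecidableEq ι] {V : Type} [AddCommGroup V] [Module ℂ V]

def dd : ι ⊕ ι → ι ⊕ ι → ℤ
  | Sum.inl _, Sum.inr _ => 1
  | Sum.inr _, Sum.inl _ => -1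
  | _, _ => 0

theorem dd_swap (a b : ι ⊕ ι) : dd b a = - dd a b := by
  rcases a with a | a <;> rcases b with b | b <;> simp [dd]

def cc (γ : Perm (ι ⊕ ι)) : ℤ := ∏ i, dd (γ (Sum.inl i)) (γ (Sum.inr i))

theorem cc_swap (γ : Perm (ι ⊕ ι)) (j : ι) : cc (γ * swap (Sum.inl j) (Sum.inr j)) = - cc γ := by
  unfold cc
  rw [← Finset.mul_prod_erase _ _ (Finset.mem_univ j), ← Finset.mul_prod_erase (a := j) _ (fun i => dd (γ (Sum.inl i)) (γ (Sum.inr i))) (Finset.mem_univ j)]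
  rw [Finset.prod_congr rfl (g := fun i => dd (γ (Sum.inl i)) (γ (Sum.inr i)))]
  · simp only [Perm.mul_apply, swap_apply_left, swap_apply_right]
    rw [dd_swap]; ring
  · intro i hi
    have hij := Finset.ne_of_mem_erase hi
    simp only [Perm.mul_apply]
    rw [swap_apply_of_ne_of_ne (by simpa using hij) (by simp), swap_apply_of_ne_of_ne (by simp) (by simpa using hij)]

theorem sc_mul (a b c d : Perm ι) : Perm.sumCongr a b * Perm.sumCongr c d = Perm.sumCongr (a * c) (b * d) :=
  Perm.sumCongr_mul _ _ _ _

theorem sc_swl (i j : ι) : Perm.sumCongr (swap i j) 1 = swap (Sum.inl i) (Sum.inl j : ι ⊕ ι) :=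
  Perm.sumCongr_swap_one _ _

theorem sc_swr (i j : ι) : Perm.sumCongr 1 (swap i j) = swap (Sum.inr i) (Sum.inr j : ι ⊕ ι) :=
  Perm.sumCongr_one_swap _ _

theorem f0 (R : Perm (ι ⊕ ι) →* (V →ₗ[ℂ] V)) (hB : BB R) (u : V) (hu : u ≠ 0)
    (hf : ∀ i, R (swap (Sum.inl i) (Sum.inr i)) u = -u) :
    ∃ f ∈ cf R, f 1 ≠ 0 ∧ ∀ g, f g = (cc g⁻¹ : ℂ) * f 1 := by
  have mapp : ∀ a b w, R (a * b) w = R a (R b w) := fun a b w => by rw [map_mul]; rfl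
  have hA : ∀ i j : ι, i ≠ j → R (swap (Sum.inl i) (Sum.inl j)) u = R (swap (Sum.inr i) (Sum.inr j)) u := by
    intro i j hij
    have e1 := hB (Sum.inl i) (Sum.inr i) (Sum.inl j) (by simp) (by simpa using hij) (by simp) u (hf i)
    have e2 := hB (Sum.inl j) (Sum.inr j) (Sum.inr i) (by simp) (by simp) (by simpa using hij.symm) u (hf j)
    rw [swap_comm (Sum.inr i) (Sum.inl j)] at e1
    rw [swap_comm (Sum.inr j) (Sum.inr i)] at e2
    have := e1.trans e2.symm
    rw [add_comm] at this
    exact add_left_cancel this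
  have hA' : ∀ i j : ι, i ≠ j → R (Perm.sumCongr (swap i j) 1) u = R (Perm.sumCongr 1 (swap i j)) u := by
    intro i j hij
    rw [sc_swl, sc_swr, hA i j hij]
  have hC : ∀ σ : Perm ι, R (Perm.sumCongr σ 1) u = R (Perm.sumCongr 1 σ⁻¹) u := by
    intro σ
    induction σ using Perm.swap_induction_on with
    | one => rw [inv_one]
    | swap_mul f x y hxy ih =>
      have e1 : Perm.sumCongr (swap x y * f) (1 : Perm ι) = Perm.sumCongr (swap x y) 1 * Perm.sumCongr f 1 := by
        rw [sc_mul, one_mul]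
      have e2 : Perm.sumCongr (swap x y) 1 * Perm.sumCongr (1 : Perm ι) f⁻¹ = Perm.sumCongr 1 f⁻¹ * Perm.sumCongr (swap x y) 1 := by
        rw [sc_mul, sc_mul]; simp
      rw [e1, mapp, ih, ← mapp, e2, mapp, hA' x y hxy, ← mapp, sc_mul]; simp
  obtain ⟨φ, hφu, hφ⟩ : ∃ φ : V →ₗ[ℂ] ℂ, φ u ≠ 0 ∧ ∀ i w, φ (R (swap (Sum.inl i) (Sum.inr i)) w) = - φ w := by
    suffices h : ∀ S : Finset ι, ∃ φ : V →ₗ[ℂ] ℂ, φ u ≠ 0 ∧ ∀ i ∈ S, ∀ w, φ (R (swap (Sum.inl i) (Sum.inr i)) w) = - φ w by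
      obtain ⟨φ, h1, h2⟩ := h Finset.univ
      exact ⟨φ, h1, fun i => h2 i (Finset.mem_univ _)⟩
    intro S
    induction S using Finset.induction_on with
    | empty =>
      have := (Module.forall_dual_apply_eq_zero_iff ℂ u).not.2 hu
      push Not at this
      obtain ⟨φ, h⟩ := this
      exact ⟨φ, h, by simp⟩
    | insert j S hj ih =>
      obtain ⟨φ, h1, h2⟩ := ih
      refine ⟨φ - φ ∘ₗ R (swap (Sum.inl j) (Sum.inr j)), ?_, ?_⟩
      · rw [LinearMap.sub_apply, LinearMap.comp_apply, hf, map_neg, sub_neg_eq_add, ← two_mul]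
        exact mul_ne_zero two_ne_zero h1
      · intro i hi w
        simp only [LinearMap.sub_apply, LinearMap.comp_apply]
        by_cases hij : i = j
        · subst hij; rw [rsq_apply]; ring
        · have hiS := Finset.mem_of_mem_insert_of_ne hi hij
          rw [comm4 R (by simpa using Ne.symm hij) (by simp) (by simp) (by simpa using Ne.symm hij), h2 i hiS, h2 i hiS]; ring
  have hD : ∀ N : ℕ, ∀ σ : Perm ι, σ.support.card = N → ∃ q : ℝ, 0 < q ∧ φ (R (Perm.sumCongr σ 1) u) = q * φ u := by
    intro N
    induction N using Nat.strong_induction_on with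
    | _ N ih =>
    intro σ hσ
    by_cases h1 : σ = 1
    · refine ⟨1, one_pos, ?_⟩
      rw [h1, show Perm.sumCongr (1 : Perm ι) (1 : Perm ι) = 1 from Perm.sumCongr_one, map_one]; simp
    have : ∃ k, σ k ≠ k := by
      by_contra hc; push Not at hc; exact h1 (Perm.ext hc)
    obtain ⟨k, hk⟩ := this
    set j := σ k with hj
    set τ := swap k j * σ with hτ
    obtain ⟨q, hq, hq2⟩ := ih _ (by rw [← hσ]; exact Perm.card_support_swap_mul hk) τ rfl
    refine ⟨q / 2, by positivity, ?_⟩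
    have hτk : τ k = k := by simp [hτ, ← hj]
    have hs : σ = swap k j * τ := by rw [hτ, ← mul_assoc, swap_mul_self, one_mul]
    set w := R (Perm.sumCongr τ 1) u with hw
    have hw1 : R (swap (Sum.inl k) (Sum.inr k)) w = - w := by
      rw [hw, ← mapp, Equiv.swap_mul_eq_mul_swap, mapp]
      have e1 : (Perm.sumCongr τ (1 : Perm ι))⁻¹ (Sum.inl k) = Sum.inl k := by
        rw [Perm.inv_eq_iff_eq]; simp [hτk]
      have e2 : (Perm.sumCongr τ (1 : Perm ι))⁻¹ (Sum.inr k) = Sum.inr k := by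
        rw [Perm.inv_eq_iff_eq]; simp
      rw [e1, e2, hf, map_neg]
    have e0 : R (Perm.sumCongr σ 1) u = R (swap (Sum.inl k) (Sum.inl j)) w := by
      rw [hw, ← mapp, ← sc_swl, sc_mul, ← hs, one_mul]
    have e1 := congrArg φ (hB (Sum.inl k) (Sum.inr k) (Sum.inl j) (by simp) (by simpa using Ne.symm hk) (by simp) w hw1)
    have e2 : φ (R (swap (Sum.inr k) (Sum.inl j)) w) = φ (R (swap (Sum.inl k) (Sum.inl j)) w) := by
      have e := hφ k (R (swap (Sum.inr k) (Sum.inl j)) w)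
      rw [← mapp, Equiv.mul_swap_eq_swap_mul, mapp, hw1, swap_apply_right, swap_apply_of_ne_of_ne (by simpa using hk) (by simp), map_neg, map_neg] at e
      exact (neg_injective e).symm
    rw [map_add, e2, hq2] at e1
    rw [e0]; push_cast
    linear_combination e1 / 2
  choose! q hq hq2 using fun σ => hD _ σ rfl
  set v := ∑ σ : Perm ι, R (Perm.sumCongr σ 1) u with hv
  have hφv : φ v ≠ 0 := by
    rw [hv, map_sum, Finset.sum_congr rfl (fun σ _ => hq2 σ), ← Finset.sum_mul]
    refine mul_ne_zero ?_ hφu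
    have : 0 < ∑ σ : Perm ι, q σ := Finset.sum_pos (fun σ _ => hq σ) Finset.univ_nonempty
    exact_mod_cast this.ne'
  have hvl : ∀ τ : Perm ι, R (Perm.sumCongr τ 1) v = v := by
    intro τ
    rw [hv, map_sum]
    refine Fintype.sum_equiv (Equiv.mulLeft τ) _ _ fun σ => ?_
    rw [← mapp, sc_mul, one_mul]; rfl
  have hvr : ∀ τ : Perm ι, R (Perm.sumCongr 1 τ) v = v := by
    intro τ
    rw [hv, map_sum]
    refine Fintype.sum_equiv (Equiv.mulRight τ⁻¹) _ _ fun σ => ?_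
    have e : Perm.sumCongr (1 : Perm ι) τ * Perm.sumCongr σ 1 = Perm.sumCongr σ 1 * Perm.sumCongr 1 τ := by
      rw [sc_mul, sc_mul]; simp
    have h2 := hC τ⁻¹
    rw [inv_inv] at h2
    rw [← mapp, e, mapp, ← h2, ← mapp, sc_mul, one_mul]; rfl
  have hvs : ∀ σ τ : Perm ι, R (Perm.sumCongr σ τ) v = v := by
    intro σ τ
    have : Perm.sumCongr σ τ = Perm.sumCongr σ 1 * Perm.sumCongr 1 τ := by rw [sc_mul]; simp
    rw [this, mapp, hvr, hvl]
  refine ⟨fun g => φ (R g v), cf_mem R φ v, by simpa using hφv, ?_⟩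
  have key : ∀ S : Finset ι, ∀ g : Perm (ι ⊕ ι), (∀ i ∉ S, (g⁻¹ (Sum.inl i)).isLeft ∧ (g⁻¹ (Sum.inr i)).isRight) →
      φ (R g v) = (cc g⁻¹ : ℂ) * φ v := by
    intro S
    induction S using Finset.induction_on with
    | empty =>
      intro g hg
      have hc : cc g⁻¹ = 1 := by
        unfold cc
        refine Finset.prod_eq_one fun i _ => ?_
        obtain ⟨h1, h2⟩ := hg i (by simp)
        obtain ⟨a, ha⟩ := Sum.isLeft_iff.1 h1
        obtain ⟨b, hb⟩ := Sum.isRight_iff.1 h2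
        rw [ha, hb]; rfl
      have hr : g⁻¹ ∈ (Perm.sumCongrHom ι ι).range := by
        apply Perm.mem_sumCongrHom_range_of_perm_mapsTo_inl
        rintro _ ⟨i, rfl⟩
        obtain ⟨a, ha⟩ := Sum.isLeft_iff.1 (hg i (by simp)).1
        exact ⟨a, ha.symm⟩
      obtain ⟨⟨σ, τ⟩, h⟩ := hr
      have hg2 : g = Perm.sumCongr σ⁻¹ τ⁻¹ := by
        rw [← inv_inv g, ← h]; rfl
      rw [hc, hg2, hvs]; simp
    | insert j S hj ih =>
      intro g hg
      have hsw : φ (R (swap (Sum.inl j) (Sum.inr j) * g) v) = - φ (R g v) := by rw [mapp, hφ]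
      have hcs : cc (swap (Sum.inl j) (Sum.inr j) * g)⁻¹ = - cc g⁻¹ := by
        rw [mul_inv_rev, swap_inv, cc_swap]
      have hz : (∀ w : V, R (swap (g⁻¹ (Sum.inl j)) (g⁻¹ (Sum.inr j))) v = v) → dd (g⁻¹ (Sum.inl j)) (g⁻¹ (Sum.inr j)) = 0 → φ (R g v) = (cc g⁻¹ : ℂ) * φ v := by
        intro h1 h2
        have hc : cc g⁻¹ = 0 := Finset.prod_eq_zero (Finset.mem_univ j) h2
        rw [Equiv.swap_mul_eq_mul_swap, mapp, h1 v] at hsw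
        have : φ (R g v) = 0 := by linear_combination hsw / 2
        rw [this, hc]; simp
      rcases h1 : g⁻¹ (Sum.inl j) with a | a <;> rcases h2 : g⁻¹ (Sum.inr j) with b | b
      · refine hz (fun _ => ?_) (by rw [h1, h2]; rfl)
        rw [h1, h2, ← sc_swl, hvl]
      · apply ih
        intro i hi
        by_cases hij : i = j
        · subst hij; rw [h1, h2]; exact ⟨rfl, rfl⟩
        · exact hg i (by simp [hij, hi])
      · have e := ih (swap (Sum.inl j) (Sum.inr j) * g) (by
          intro i hi
          rw [mul_inv_rev, swap_inv, Perm.mul_apply, Perm.mul_apply]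
          by_cases hij : i = j
          · subst hij; rw [swap_apply_left, swap_apply_right, h1, h2]; exact ⟨rfl, rfl⟩
          · rw [swap_apply_of_ne_of_ne (by simpa using hij) (by simp), swap_apply_of_ne_of_ne (by simp) (by simpa using hij)]
            exact hg i (by simp [hij, hi]))
        rw [hsw, hcs] at e
        push_cast at e
        linear_combination -e
      · refine hz (fun _ => ?_) (by rw [h1, h2]; rfl)
        rw [h1, h2, ← sc_swr, hvr]
  intro g
  have := key Finset.univ g (by simp)
  simpa using this

end f0
end SymCov

namespace SymCov
open Equiv
section mtch

def EE {ι : Type} [Fintype ι] [DecidableEq ι] (s : Perm (ι ⊕ ι)) (p : Perm ι) (γ : Perm (ι ⊕ ι)) : ℤ :=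
  cc (s * γ * Perm.sumCongr 1 p)

def BE {ι : Type} [Fintype ι] [DecidableEq ι] (a b : ι) (p : Perm ι) (γ : Perm (ι ⊕ ι)) : ℤ :=
  EE (swap (Sum.inl a) (Sum.inr b)) p γ

section gen
variable {ι : Type} [Fintype ι] [DecidableEq ι]

theorem EE_ne {s : Perm (ι ⊕ ι)} {p : Perm ι} {γ : Perm (ι ⊕ ι)} (h : EE s p γ ≠ 0) (i : ι) :
    dd (s (γ (Sum.inl i))) (s (γ (Sum.inr (p i)))) ≠ 0 := by
  have := Finset.prod_ne_zero_iff.1 h i (Finset.mem_univ i)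
  simpa using this

theorem BE_nf {a b : ι} {p ξ η : Perm ι} (h : BE a b p (Perm.sumCongr ξ η) ≠ 0) : p (ξ⁻¹ a) = η⁻¹ b := by
  have := EE_ne h (ξ⁻¹ a)
  by_contra hc
  apply this
  have e1 : swap (Sum.inl a) (Sum.inr b) (Perm.sumCongr ξ η (Sum.inl (ξ⁻¹ a))) = (Sum.inr b : ι ⊕ ι) := by simp
  have e2 : swap (Sum.inl a) (Sum.inr b) (Perm.sumCongr ξ η (Sum.inr (p (ξ⁻¹ a)))) = (Sum.inr (η (p (ξ⁻¹ a))) : ι ⊕ ι) := by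
    rw [Perm.sumCongr_apply, Sum.map_inr]
    apply swap_apply_of_ne_of_ne (by simp)
    intro hh
    apply hc
    rw [Perm.eq_inv_iff_eq]
    exact Sum.inr_injective hh
  rw [e1, e2]; rfl

theorem BE_fl {a b : ι} {p ξ η : Perm ι} (h : BE a b p (sumComm ι ι * Perm.sumCongr ξ η : Perm (ι ⊕ ι)) ≠ 0) : p (ξ⁻¹ b) = η⁻¹ a := by
  have := EE_ne h (ξ⁻¹ b)
  by_contra hc
  apply this
  have e1 : swap (Sum.inl a) (Sum.inr b) ((sumComm ι ι * Perm.sumCongr ξ η : Perm (ι ⊕ ι)) (Sum.inl (ξ⁻¹ b))) = (Sum.inl a : ι ⊕ ι) := by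
    rw [Perm.mul_apply, Perm.sumCongr_apply]; simp
  have e2 : swap (Sum.inl a) (Sum.inr b) ((sumComm ι ι * Perm.sumCongr ξ η : Perm (ι ⊕ ι)) (Sum.inr (p (ξ⁻¹ b)))) = (Sum.inl (η (p (ξ⁻¹ b))) : ι ⊕ ι) := by
    rw [Perm.mul_apply, Perm.sumCongr_apply, Sum.map_inr]
    apply swap_apply_of_ne_of_ne
    · intro hh
      apply hc
      rw [Perm.eq_inv_iff_eq]
      exact Sum.inl_injective hh
    · simp
  rw [e1, e2]; rfl

theorem EE_one (p : Perm ι) : EE 1 p 1 ≠ 0 := by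
  unfold EE cc
  simp [dd]

theorem BE_one {a b : ι} {p : Perm ι} (h : p a = b) : BE a b p 1 ≠ 0 := by
  unfold BE EE cc
  rw [Finset.prod_ne_zero_iff]
  intro i _
  by_cases hi : i = a
  · subst hi; simp [h, dd]
  · have h1 : swap (Sum.inl a) (Sum.inr b) (Sum.inl i) = (Sum.inl i : ι ⊕ ι) := swap_apply_of_ne_of_ne (by simpa using hi) (by simp)
    have h2 : swap (Sum.inl a) (Sum.inr b) (Sum.inr (p i)) = (Sum.inr (p i) : ι ⊕ ι) :=
      swap_apply_of_ne_of_ne (by simp) (by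
        intro hh; apply hi; apply p.injective; rw [h]; exact Sum.inr_injective hh)
    simp [h1, h2, dd]

end gen

section fin
variable {k : ℕ}

theorem AA {γ : Perm (Fin (k+3) ⊕ Fin (k+3))} (h1 : EE 1 1 γ ≠ 0) (h2 : EE 1 (finRotate (k+3)) γ ≠ 0) :
    ∃ ξ η : Perm (Fin (k+3)), γ = Perm.sumCongr ξ η ∨ γ = (sumComm _ _ * Perm.sumCongr ξ η : Perm (Fin (k+3) ⊕ Fin (k+3))) := by
  have key : ∀ a b : Fin (k+3) ⊕ Fin (k+3), dd a b ≠ 0 → b.isLeft = !a.isLeft := by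
    rintro (a | a) (b | b) h <;> simp_all [dd]
  have e1 : ∀ i, (γ (Sum.inr i)).isLeft = !(γ (Sum.inl i)).isLeft := fun i => key _ _ (by simpa using EE_ne h1 i)
  have e2 : ∀ i, (γ (Sum.inr (i + 1))).isLeft = !(γ (Sum.inl i)).isLeft := fun i => key _ _ (by simpa using EE_ne h2 i)
  have e3 : ∀ i, (γ (Sum.inl (i + 1))).isLeft = (γ (Sum.inl i)).isLeft := by
    intro i
    have := (e1 (i+1)).symm.trans (e2 i)
    exact Bool.not_inj this
  have e4 : ∀ i : Fin (k+3), (γ (Sum.inl i)).isLeft = (γ (Sum.inl 0)).isLeft := by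
    intro i
    induction i using Fin.induction with
    | zero => rfl
    | succ i ih => rw [← Fin.coeSucc_eq_succ, e3, ih]
  have mem : ∀ δ : Perm (Fin (k+3) ⊕ Fin (k+3)), (∀ i, (δ (Sum.inl i)).isLeft = true) → ∃ ξ η : Perm (Fin (k+3)), δ = Perm.sumCongr ξ η := by
    intro δ hδ
    have hr : δ ∈ (Perm.sumCongrHom (Fin (k+3)) (Fin (k+3))).range := by
      apply Perm.mem_sumCongrHom_range_of_perm_mapsTo_inl
      rintro _ ⟨i, rfl⟩
      obtain ⟨a, ha⟩ := Sum.isLeft_iff.1 (hδ i)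
      exact ⟨a, ha.symm⟩
    obtain ⟨⟨σ, τ⟩, h⟩ := hr
    exact ⟨σ, τ, h.symm⟩
  cases hh : (γ (Sum.inl 0)).isLeft
  · obtain ⟨ξ, η, h⟩ := mem (sumComm _ _ * γ : Perm _) (fun i => by
      have := e4 i
      rw [hh] at this
      rw [Perm.mul_apply]
      rcases h5 : γ (Sum.inl i) with a | a
      · rw [h5] at this; simp at this
      · simp)
    refine ⟨ξ, η, Or.inr ?_⟩
    rw [← h, ← mul_assoc]
    ext x
    simp
  · obtain ⟨ξ, η, h⟩ := mem γ (fun i => by rw [e4, hh])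
    exact ⟨ξ, η, Or.inl h⟩

def p2 (k : ℕ) : Perm (Fin (k+3)) := Perm.decomposeFin.symm (0, finRotate (k+2))

theorem p2_zero : p2 k 0 = 0 := by simp [p2]
theorem p2_fix {x : Fin (k+3)} (h : p2 k x = x) : x = 0 := by
  revert h
  refine Fin.cases (fun _ => rfl) (fun i h => ?_) x
  exfalso
  unfold p2 at h
  rw [Perm.decomposeFin_symm_apply_succ, swap_self, Equiv.refl_apply, finRotate_succ_apply] at h
  have := Fin.succ_injective _ h
  simp at this

def pj (j : Fin k) : Perm (Fin (k+3)) := swap 0 (j.addNat 3) * (if j.val = 0 then swap 0 1 else 1)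

def FF (k : ℕ) (γ : Perm (Fin (k+3) ⊕ Fin (k+3))) : ℤ :=
  EE 1 1 γ * EE 1 (finRotate (k+3)) γ * BE 0 0 1 γ * BE 0 0 (p2 k) γ * BE 1 1 (swap 0 2) γ *
    ∏ j : Fin k, (BE 0 (j.addNat 3) (swap 0 (j.addNat 3)) γ * BE (j.addNat 3) 0 (pj j) γ)

theorem v2 : 2 % (k+3) = 2 := Nat.mod_eq_of_lt (by omega)

theorem an0 (j : Fin k) : (j.addNat 3 : Fin (k+3)) ≠ 0 := by
  intro h; have := congrArg Fin.val h; simp at this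
theorem an1 (j : Fin k) : (j.addNat 3 : Fin (k+3)) ≠ 1 := by
  intro h; have := congrArg Fin.val h; simp [Fin.val_one] at this
theorem an2 (j : Fin k) : (j.addNat 3 : Fin (k+3)) ≠ 2 := by
  intro h; have := congrArg Fin.val h; simp [v2] at this
theorem fcases (i : Fin (k+3)) : i = 0 ∨ i = 1 ∨ i = 2 ∨ ∃ j : Fin k, i = j.addNat 3 := by
  rcases i with ⟨i, hi⟩
  rcases i with _ | _ | _ | i
  · left; rfl
  · right; left; ext; simp
  · right; right; left; ext; simp [v2]
  · right; right; right; exact ⟨⟨i, by omega⟩, by ext; simp⟩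
theorem f01 : (0 : Fin (k+3)) ≠ 1 := by intro h; have := congrArg Fin.val h; simp [Fin.val_one] at this
theorem f02 : (0 : Fin (k+3)) ≠ 2 := by intro h; have := congrArg Fin.val h; simp [v2] at this
theorem f12 : (1 : Fin (k+3)) ≠ 2 := by intro h; have := congrArg Fin.val h; simp [v2, Fin.val_one] at this

theorem FF_one : FF k 1 ≠ 0 := by
  unfold FF
  refine mul_ne_zero (mul_ne_zero (mul_ne_zero (mul_ne_zero (mul_ne_zero (EE_one _) (EE_one _)) (BE_one rfl)) (BE_one p2_zero)) (BE_one ?_)) (Finset.prod_ne_zero_iff.2 fun j _ => mul_ne_zero (BE_one (by simp)) (BE_one ?_))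
  · exact swap_apply_of_ne_of_ne f01.symm f12
  · unfold pj
    split_ifs
    · rw [Perm.mul_apply, swap_apply_of_ne_of_ne (an0 j) (an1 j), swap_apply_right]
    · rw [mul_one, swap_apply_right]

theorem fin3 {α : Perm (Fin (k+3))} (h0 : α 0 = 0) (h1 : α 1 = 1) (hj : ∀ j : Fin k, α (j.addNat 3) = j.addNat 3) : α = 1 := by
  have hne : ∀ i, i ≠ 2 → α i = i := by
    intro i hi
    rcases fcases i with h | h | h | ⟨j, h⟩
    · rw [h, h0]
    · rw [h, h1]
    · exact absurd h hi
    · rw [h, hj]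
  ext1 i
  by_cases hi : i = 2
  · subst hi
    by_contra hc
    have := hne (α 2) hc
    exact hc (α.injective this)
  · exact hne i hi

theorem one_of {α β : Perm (Fin (k+3))} (h0 : α 0 = 0) (hb : β 0 = 0) (hj : ∀ j : Fin k, α (j.addNat 3) = j.addNat 3)
    (h : swap 0 2 (α 1) = β 1) : α 1 = 1 ∧ β 1 = 1 := by
  have h1 : α 1 = 1 := by
    rcases fcases (α 1) with h' | h' | h' | ⟨j, h'⟩
    · rw [← h0] at h'; exact absurd (α.injective h') f01.symm
    · exact h'
    · rw [h', swap_apply_right, ← hb] at h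
      exact absurd (β.injective h) f01
    · rw [← hj j] at h'
      exact absurd (α.injective h') (an1 j).symm
  refine ⟨h1, ?_⟩
  rw [← h, h1, swap_apply_of_ne_of_ne f01.symm f12]

theorem FF_supp {γ : Perm (Fin (k+3) ⊕ Fin (k+3))} (h : FF k γ ≠ 0) : γ = 1 ∨ (k = 0 ∧ γ = (sumComm _ _ : Perm _)) := by
  unfold FF at h
  have h6 := right_ne_zero_of_mul h
  have h := left_ne_zero_of_mul h
  have h5 := right_ne_zero_of_mul h
  have h := left_ne_zero_of_mul h
  have h4 := right_ne_zero_of_mul h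
  have h := left_ne_zero_of_mul h
  have h3 := right_ne_zero_of_mul h
  have h := left_ne_zero_of_mul h
  have h7 := fun j => left_ne_zero_of_mul (Finset.prod_ne_zero_iff.1 h6 j (Finset.mem_univ j))
  have h8 := fun j => right_ne_zero_of_mul (Finset.prod_ne_zero_iff.1 h6 j (Finset.mem_univ j))
  obtain ⟨ξ, η, hc⟩ := AA (left_ne_zero_of_mul h) (right_ne_zero_of_mul h)
  have sw0 : ∀ {j : Fin k} {x : Fin (k+3)}, swap 0 (j.addNat 3) x = 0 → x = j.addNat 3 := by
    intro j x hx
    rw [Equiv.swap_apply_eq_iff, swap_apply_left] at hx; exact hx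
  rcases hc with rfl | rfl
  · left
    have a3 := BE_nf h3
    have a4 := BE_nf h4
    rw [Perm.one_apply] at a3
    rw [← a3] at a4
    have a0 := p2_fix a4
    have b0 := a3.symm.trans a0
    have b1 : ∀ j : Fin k, η⁻¹ (j.addNat 3) = j.addNat 3 := fun j => by
      rw [← BE_nf (h7 j), a0, swap_apply_left]
    have c1 : ∀ j : Fin k, ξ⁻¹ (j.addNat 3) = j.addNat 3 := fun j => by
      have := BE_nf (h8 j)
      rw [b0] at this
      unfold pj at this
      split_ifs at this
      · rw [Perm.mul_apply] at this
        have := sw0 this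
        rwa [Equiv.swap_apply_eq_iff, swap_apply_of_ne_of_ne (an0 j) (an1 j)] at this
      · rw [mul_one] at this; exact sw0 this
    obtain ⟨x1, y1⟩ := one_of a0 b0 c1 (BE_nf h5)
    have hx := inv_eq_one.1 (fin3 a0 x1 c1)
    have hy := inv_eq_one.1 (fin3 b0 y1 b1)
    rw [hx, hy]; exact Perm.sumCongr_one
  · right
    have a3 := BE_fl h3
    have a4 := BE_fl h4
    rw [Perm.one_apply] at a3
    rw [← a3] at a4
    have a0 := p2_fix a4
    have b0 := a3.symm.trans a0
    have c1 : ∀ j : Fin k, ξ⁻¹ (j.addNat 3) = j.addNat 3 := fun j => by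
      have := BE_fl (h7 j)
      rw [b0] at this
      exact sw0 this
    obtain ⟨x1, y1⟩ := one_of a0 b0 c1 (BE_fl h5)
    rcases Nat.eq_zero_or_pos k with hk | hk
    · refine ⟨hk, ?_⟩
      have hx := inv_eq_one.1 (fin3 a0 x1 c1)
      have hy := inv_eq_one.1 (fin3 b0 y1 (fun j => by subst hk; exact j.elim0))
      rw [hx, hy, show Perm.sumCongr (1 : Perm (Fin (k+3))) (1 : Perm (Fin (k+3))) = 1 from Perm.sumCongr_one, mul_one]
    · exfalso
      have := BE_fl (h8 ⟨0, hk⟩)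
      rw [a0] at this
      unfold pj at this
      rw [if_pos rfl, Perm.mul_apply, swap_apply_left, swap_apply_of_ne_of_ne f01.symm (an1 _).symm, ← y1] at this
      exact (an1 _).symm (η⁻¹.injective this)

end fin
end mtch
end SymCov

namespace SymCov
open Equiv

inductive Tri | z | p | n
def Tri.mul : Tri → (Unit → Tri) → Tri
  | .z, _ => .z
  | .p, f => f ()
  | .n, f => match f () with
     | .z => .z
     | .p => .n
     | .n => .p
def Tri.toInt : Tri → ℤ
  | .z => 0
  | .p => 1
  | .n => -1
theorem Tri.toInt_mul (a : Tri) (f : Unit → Tri) : (a.mul f).toInt = a.toInt * (f ()).toInt := by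
  cases a <;> simp only [Tri.mul, Tri.toInt] <;> generalize f () = b <;> cases b <;> simp [Tri.toInt]
def sd1 : Fin 3 ⊕ Fin 3 → Fin 3 ⊕ Fin 3 → Tri
  | Sum.inl _, Sum.inr _ => .p
  | Sum.inr _, Sum.inl _ => .n
  | _, _ => .z
theorem sd1_toInt (a b : Fin 3 ⊕ Fin 3) : (sd1 a b).toInt = dd a b := by
  rcases a with a | a <;> rcases b with b | b <;> rfl
def ccT (γ : Perm (Fin 3 ⊕ Fin 3)) : Tri := (sd1 (γ (Sum.inl 0)) (γ (Sum.inr 0))).mul fun _ => (sd1 (γ (Sum.inl 1)) (γ (Sum.inr 1))).mul fun _ =>  sd1 (γ (Sum.inl 2)) (γ (Sum.inr 2))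
theorem ccT_toInt (γ) : (ccT γ).toInt = cc γ := by
  unfold ccT cc
  rw [Tri.toInt_mul, Tri.toInt_mul, sd1_toInt, sd1_toInt, sd1_toInt, Fin.prod_univ_three, mul_assoc]
def mtx (a b : Fin 3) (p : Perm (Fin 3)) (γ : Perm (Fin 3 ⊕ Fin 3)) : Tri :=
  ccT (swap (Sum.inl a) (Sum.inr b) * γ * Perm.sumCongr 1 p)
theorem mtx_toInt (a b p γ) : (mtx a b p γ).toInt = BE a b p γ := ccT_toInt _
set_option maxRecDepth 100000 in
theorem tst : ∑ γ : Perm (Fin 3 ⊕ Fin 3), ((mtx 0 0 (swap 0 2) γ).mul fun _ => (mtx 2 1 (swap 1 2) γ).mul fun _ => (mtx 1 0 (swap 0 1) γ).mul fun _ =>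
   (mtx 2 0 (swap 0 2 * swap 0 1) γ).mul fun _ => mtx 1 2 (swap 0 1 * swap 0 2) γ).toInt ≠ 0 := by decide +kernel
theorem tst2 : ∑ γ : Perm (Fin 3 ⊕ Fin 3), BE 0 0 (swap 0 2) γ * (BE 2 1 (swap 1 2) γ * (BE 1 0 (swap 0 1) γ *
   (BE 2 0 (swap 0 2 * swap 0 1) γ * BE 1 2 (swap 0 1 * swap 0 2) γ))) ≠ 0 := by
  have := tst
  simp only [Tri.toInt_mul, mtx_toInt] at this
  exact this

theorem FF_flip : FF 0 (sumComm _ _ : Perm _) = - FF 0 1 := by decide +kernel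
theorem sgn_flip : Perm.sign (sumComm (Fin 3) (Fin 3) : Perm _) = -1 := by decide +kernel

section K
variable {k : ℕ} {V : Type} [AddCommGroup V] [Module ℂ V]

theorem prod_mem_pow {A J : Type} [CommRing A] [Algebra ℂ A] (M : Submodule ℂ A) (s : Finset J) (f : J → A) (h : ∀ j ∈ s, f j ∈ M) :
    ∏ j ∈ s, f j ∈ M ^ s.card := by
  classical
  induction s using Finset.induction_on with
  | empty => simpa using (Submodule.one_le.1 le_rfl : (1 : A) ∈ (1 : Submodule ℂ A))
  | insert a s ha ih =>
    rw [Finset.prod_insert ha, Finset.card_insert_of_notMem ha, pow_succ']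
    exact Submodule.mul_mem_mul (h a (by simp)) (ih fun j hj => h j (by simp [hj]))

theorem EE_mem {ι : Type} [Fintype ι] [DecidableEq ι] (R : Perm (ι ⊕ ι) →* (V →ₗ[ℂ] V)) (f : Perm (ι ⊕ ι) → ℂ) (hf : f ∈ cf R) (h1 : f 1 ≠ 0)
    (h : ∀ g, f g = (cc g⁻¹ : ℂ) * f 1) (s : Perm (ι ⊕ ι)) (p : Perm ι) : (fun g => (EE s p g⁻¹ : ℂ)) ∈ cf R := by
  have e := (cf R).smul_mem (f 1)⁻¹ (cf_transl R (Perm.sumCongr 1 p)⁻¹ s⁻¹ f hf)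
  convert e using 1
  funext g
  simp only [Pi.smul_apply, smul_eq_mul]
  rw [h (_ * g * _), mul_comm _ (f 1), inv_mul_cancel_left₀ h1]
  unfold EE
  rw [mul_inv_rev, mul_inv_rev, inv_inv, inv_inv, mul_assoc]

theorem KK (R : Perm (Fin (k+3) ⊕ Fin (k+3)) →* (V →ₗ[ℂ] V)) (hB : BB R) (u : V) (hu : u ≠ 0)
    (hf : ∀ i, R (swap (Sum.inl i) (Sum.inr i)) u = -u) :
    (∃ F ∈ cf R ^ (2*k+5), ∀ (W : Type) [AddCommGroup W] [Module ℂ W] [FiniteDimensional ℂ W] (σ : Perm (Fin (k+3) ⊕ Fin (k+3)) →* (W →ₗ[ℂ] W)), NL σ → ∑ g, F g • σ g⁻¹ ≠ 0) ∧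
    (∃ F ∈ cf R ^ (2*k+5), ∑ g, F g * ((Perm.sign g : ℤ) : ℂ) ≠ 0) ∧
    (∃ F ∈ cf R ^ (2*k+5), ∑ g, F g ≠ 0) := by
  obtain ⟨f, hfm, hf1, hfc⟩ := f0 R hB u hu hf
  have hm : ∀ s p, (fun g => (EE s p g⁻¹ : ℂ)) ∈ cf R := EE_mem R f hfm hf1 hfc
  have hb : ∀ a b p, (fun g => (BE a b p g⁻¹ : ℂ)) ∈ cf R := fun a b p => hm _ _
  have hmem : (fun g => (FF k g⁻¹ : ℂ)) ∈ cf R ^ (2*k+5) := by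
    have e0 : (fun g => (FF k g⁻¹ : ℂ)) = ((fun g => (EE 1 1 g⁻¹ : ℂ)) * (fun g => (EE 1 (finRotate (k+3)) g⁻¹ : ℂ)) * (fun g => (BE 0 0 1 g⁻¹ : ℂ)) * (fun g => (BE 0 0 (p2 k) g⁻¹ : ℂ)) * (fun g => (BE 1 1 (swap 0 2) g⁻¹ : ℂ))) *
      ∏ j : Fin k, ((fun g => (BE 0 (j.addNat 3) (swap 0 (j.addNat 3)) g⁻¹ : ℂ)) * (fun g => (BE (j.addNat 3) 0 (pj j) g⁻¹ : ℂ))) := by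
      funext g
      simp only [FF, Pi.mul_apply, Finset.prod_apply]
      push_cast
      rfl
    have e1 : (2*k+5) = 1 + 1 + 1 + 1 + 1 + 2 * k := by ring
    rw [e0, e1, pow_add, pow_add, pow_add, pow_add, pow_add, pow_one, pow_mul]
    refine Submodule.mul_mem_mul (Submodule.mul_mem_mul (Submodule.mul_mem_mul (Submodule.mul_mem_mul (Submodule.mul_mem_mul (hm _ _) (hm _ _)) (hb _ _ _)) (hb _ _ _)) (hb _ _ _)) ?_
    have := prod_mem_pow (cf R ^ 2) Finset.univ (fun j : Fin k => ((fun g => (BE 0 (j.addNat 3) (swap 0 (j.addNat 3)) g⁻¹ : ℂ)) * (fun g => (BE (j.addNat 3) 0 (pj j) g⁻¹ : ℂ)))) (fun j _ => by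
      rw [pow_two]; exact Submodule.mul_mem_mul (hb _ _ _) (hb _ _ _))
    simpa using this
  have h1 : (FF k 1 : ℂ) ≠ 0 := by exact_mod_cast FF_one
  rcases Nat.eq_zero_or_pos k with hk | hk
  · subst hk
    set τ : Perm (Fin (0+3) ⊕ Fin (0+3)) := sumComm _ _ with hτ
    have hτi : τ⁻¹ = τ := rfl
    have hτ1 : τ ≠ 1 := fun h => by
      have := sgn_flip
      rw [show (sumComm (Fin 3) (Fin 3) : Perm _) = 1 from h] at this
      simp at this
    have hz : ∀ g, g ≠ 1 → g ≠ τ → (FF 0 g⁻¹ : ℂ) = 0 := by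
      intro g hg1 hg2
      by_contra hc
      rcases FF_supp (γ := g⁻¹) (fun h => hc (by rw [h]; simp)) with h | ⟨_, h⟩
      · exact hg1 (inv_eq_one.1 h)
      · exact hg2 (by rw [← inv_inv g, h, ← hτ, hτi])
    have hsum : ∀ {M : Type} [AddCommGroup M] [Module ℂ M] (G : Perm (Fin (0+3) ⊕ Fin (0+3)) → M), ∑ g, (FF 0 g⁻¹ : ℂ) • G g = (FF 0 1 : ℂ) • (G 1 - G τ) := by
      intro M _ _ G
      rw [Finset.sum_eq_add_of_mem 1 τ (Finset.mem_univ _) (Finset.mem_univ _) (Ne.symm hτ1)]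
      · rw [inv_one, hτi, hτ, FF_flip, ← hτ]; push_cast; module
      · rintro g _ ⟨h1, h2⟩
        rw [hz g h1 h2, zero_smul]
    refine ⟨⟨_, hmem, ?_⟩, ⟨_, hmem, ?_⟩, ?_⟩
    · intro W _ _ _ σ hσ hc
      rw [hsum (fun g => σ g⁻¹)] at hc
      have := (smul_eq_zero.1 hc).resolve_left h1
      rw [inv_one, map_one, sub_eq_zero, hτi] at this
      exact hτ1 (scalar_faithful (by simp) σ hσ τ ⟨1, by rw [← this, one_smul]⟩)
    · have := hsum (fun g => ((Perm.sign g : ℤ) : ℂ))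
      simp only [smul_eq_mul] at this
      rw [this]
      refine mul_ne_zero h1 ?_
      rw [show Perm.sign τ = -1 from sgn_flip]
      norm_num
    · refine ⟨fun g => ((BE 0 0 (swap 0 2) g⁻¹ * (BE 2 1 (swap 1 2) g⁻¹ * (BE 1 0 (swap 0 1) g⁻¹ *
   (BE 2 0 (swap 0 2 * swap 0 1) g⁻¹ * BE 1 2 (swap 0 1 * swap 0 2) g⁻¹))) : ℤ) : ℂ), ?_, ?_⟩
      · push_cast
        have e1 : 5 = 1 + (1 + (1 + (1 + 1))) := by ring
        rw [e1, pow_add, pow_add, pow_add, pow_add, pow_one]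
        exact Submodule.mul_mem_mul (hb _ _ _) (Submodule.mul_mem_mul (hb _ _ _) (Submodule.mul_mem_mul (hb _ _ _) (Submodule.mul_mem_mul (hb _ _ _) (hb _ _ _))))
      · have := tst2
        rw [← Equiv.sum_comp (Equiv.inv (Perm (Fin 3 ⊕ Fin 3)))] at this
        intro hc
        rw [← Int.cast_sum Finset.univ, Int.cast_eq_zero] at hc
        exact this hc
  · have hz : (fun g => (FF k g⁻¹ : ℂ)) = (FF k 1 : ℂ) • Pi.single 1 1 := by
      funext g
      by_cases hg : g = 1
      · subst hg; simp
      · simp only [Pi.smul_apply, Pi.single_eq_of_ne hg, smul_zero]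
        by_contra hc
        rcases FF_supp (γ := g⁻¹) (fun h => hc (by rw [h]; simp)) with h | ⟨h, _⟩
        · exact hg (inv_eq_one.1 h)
        · omega
    have hmem1 : (Pi.single 1 1 : Perm (Fin (k+3) ⊕ Fin (k+3)) → ℂ) ∈ cf R ^ (2*k+5) := by
      rw [hz] at hmem
      have := (cf R ^ (2*k+5)).smul_mem (FF k 1 : ℂ)⁻¹ hmem
      rwa [smul_smul, inv_mul_cancel₀ h1, one_smul] at this
    refine ⟨⟨_, hmem1, fun W _ _ _ σ hσ => one_cov σ hσ⟩, ⟨_, hmem1, ?_⟩, ⟨_, hmem1, ?_⟩⟩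
    · rw [Finset.sum_eq_single 1]
      · simp
      · intro b _ hb; rw [Pi.single_eq_of_ne hb, zero_mul]
      · simp
    · simp
end K
end SymCov

namespace SymCov
open Equiv
section asm
variable {α : Type} [Fintype α] [DecidableEq α] {V : Type} [AddCommGroup V] [Module ℂ V]

theorem K0 [FiniteDimensional ℂ V] (hn : 5 ≤ Fintype.card α) (ρ : Perm α →* (V →ₗ[ℂ] V)) (h : NL ρ) (hN : NoSub ρ) (hB : BB ρ) :
    ∃ k : ℕ, Fintype.card α - 1 = 2 * k + 5 ∧ 
    (∃ F ∈ cf ρ ^ (2*k+5), ∀ (W : Type) [AddCommGroup W] [Module ℂ W] [FiniteDimensional ℂ W] (σ : Perm α →* (W →ₗ[ℂ] W)), NL σ → ∑ g, F g • σ g⁻¹ ≠ 0) ∧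
    (∃ F ∈ cf ρ ^ (2*k+5), ∑ g, F g * ((Perm.sign g : ℤ) : ℂ) ≠ 0) ∧
    (∃ F ∈ cf ρ ^ (2*k+5), ∑ g, F g ≠ 0) := by
  have hinj := inj_of_NL hn ρ h
  obtain ⟨κ, hκ⟩ := kappa ρ h.1 hN
  obtain ⟨r, f, u, hu, hf⟩ := matching hn ρ hinj hB κ hκ
  have hc := Fintype.card_congr f
  rw [Fintype.card_sum, Fintype.card_fin] at hc
  obtain ⟨k, rfl⟩ : ∃ k, r = k + 3 := ⟨r - 3, by omega⟩
  refine ⟨k, by omega, ?_⟩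
  let P : Perm (Fin (k+3) ⊕ Fin (k+3)) ≃* Perm α := f.permCongrHom
  have hP : ∀ a b, P (swap a b) = swap (f a) (f b) := by
    intro a b
    ext x
    simp [P, Equiv.permCongrHom, Equiv.permCongr_apply, Equiv.swap_apply_def, Equiv.symm_apply_eq]
    split_ifs <;> simp
  have hR : ∀ a b, (ρ.comp P.toMonoidHom) (swap a b) = ρ (swap (f a) (f b)) := fun a b => by
    rw [← hP]; rfl
  obtain ⟨⟨F1, m1, h1⟩, ⟨F2, m2, h2⟩, ⟨F3, m3, h3⟩⟩ := KK (ρ.comp P.toMonoidHom) (by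
    intro a b c hab hac hbc w hw
    rw [hR] at hw ⊢
    rw [hR]
    exact hB _ _ _ (f.injective.ne hab) (f.injective.ne hac) (f.injective.ne hbc) w hw) u hu (fun i => by rw [hR, hf])
  refine ⟨?_, ?_, ?_⟩
  · obtain ⟨F', m', e⟩ := cf_map_pow ρ P.toMonoidHom _ _ m1
    refine ⟨F', m', ?_⟩
    intro W _ _ _ σ hσ
    have := h1 W (σ.comp P.toMonoidHom) ⟨⟨hσ.1.1, fun U hU => hσ.1.2 U fun g v hv => by
      have := hU (P.symm g) v hv
      rwa [MonoidHom.comp_apply, MulEquiv.toMonoidHom_eq_coe, MonoidHom.coe_coe, MulEquiv.apply_symm_apply] at this⟩, hσ.2⟩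
    rw [← Equiv.sum_comp P.toEquiv]
    convert this using 3 with g
    · exact e g
    · change σ (P g)⁻¹ = σ (P g⁻¹)
      rw [map_inv P]
  · obtain ⟨F', m', e⟩ := cf_map_pow ρ P.toMonoidHom _ _ m2
    refine ⟨F', m', ?_⟩
    rw [← Equiv.sum_comp P.toEquiv]
    convert h2 using 3 with g
    · exact e g
    · have : Perm.sign (P g) = Perm.sign g := Perm.sign_permCongr f g
      exact_mod_cast congrArg (fun x : ℤˣ => ((x : ℤ) : ℂ)) this
  · obtain ⟨F', m', e⟩ := cf_map_pow ρ P.toMonoidHom _ _ m3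
    refine ⟨F', m', ?_⟩
    rw [← Equiv.sum_comp P.toEquiv]
    convert h3 using 2 with g
    exact e g

theorem sg_pow (k : ℕ) : (sg : Perm α → ℂ) ^ (2 * k + 5) = sg := by
  funext g
  rw [Pi.pow_apply, show 2 * k + 5 = 2 * (k + 2) + 1 by ring, pow_succ, pow_mul, pow_two, sg_sq, one_pow, one_mul]

theorem all_cov [FiniteDimensional ℂ V] (hn : 5 ≤ Fintype.card α) (ρ : Perm α →* (V →ₗ[ℂ] V)) (h : NL ρ) : Cov ρ := by
  rcases split ρ with ⟨X, hX⟩ | hN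
  · exact case1 hn ρ h X hX
  by_cases hm : NZ ρ (-1)
  · by_cases hp : NZ ρ 1
    · exact case3A hn ρ h hN hp hm
    · have hB : BB (tw ρ) := BB_of _ (fun a b c hab hac hbc => by
        rw [tw_s3 ρ hab hbc]; exact not_NZ ρ 1 hp a b c hab hac hbc)
      obtain ⟨k, hk, ⟨F1, m1, h1⟩, _, ⟨F3, m3, h3⟩⟩ := K0 hn (tw ρ) (tw_NL ρ h) (tw_NoSub ρ hN) hB
      have m1' := tw_cf_pow ρ _ _ m1
      have m3' := tw_cf_pow ρ _ _ m3
      rw [sg_pow] at m1' m3'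
      refine ⟨fun W _ _ _ σ hσ => ⟨2*k+5, by omega, by omega, _, m1', ?_⟩, ⟨2*k+5, by omega, by omega, _, m3', ?_⟩⟩
      · have := h1 W (tw σ) (tw_NL σ hσ)
        refine fun hc => this (Eq.trans (Finset.sum_congr rfl fun g _ => ?_) hc)
        rw [tw_apply, sg_inv, smul_smul, Pi.mul_apply, mul_comm]
      · convert h3 using 2 with g
        change sg g * F3 g * sg g = F3 g
        rw [mul_right_comm, sg_sq, one_mul]
  · obtain ⟨k, hk, ⟨F1, m1, h1⟩, ⟨F2, m2, h2⟩, _⟩ := K0 hn ρ h hN (BB_of ρ (not_NZ ρ _ hm))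
    exact ⟨fun W _ _ _ σ hσ => ⟨2*k+5, by omega, by omega, F1, m1, h1 W σ hσ⟩, ⟨2*k+5, by omega, by omega, F2, m2, h2⟩⟩

end asm
end SymCov

namespace SymCov
open Equiv
section low

def sgr (n : ℕ) : Perm (Fin n) →* (ℂ →ₗ[ℂ] ℂ) where
  toFun g := sg g • 1
  map_one' := by rw [sg_one, one_smul]
  map_mul' g h := by rw [sg_mul, smul_mul_smul_comm, one_mul]

def ppi (n : ℕ) : Perm (Fin n) →* ((Fin n → ℂ) →ₗ[ℂ] (Fin n → ℂ)) where
  toFun g := LinearMap.funLeft ℂ ℂ (g⁻¹ : Perm (Fin n))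
  map_one' := rfl
  map_mul' g h := by
    rw [mul_inv_rev]; rfl

theorem ppi_apply (n : ℕ) (g : Perm (Fin n)) (v : Fin n → ℂ) (i) : ppi n g v i = v (g⁻¹ i) := rfl

def UU (n : ℕ) : Submodule ℂ (Fin n → ℂ) := LinearMap.ker (∑ i, LinearMap.proj (R := ℂ) (φ := fun _ : Fin n => ℂ) i)

theorem mem_UU {n : ℕ} {v : Fin n → ℂ} : v ∈ UU n ↔ ∑ i, v i = 0 := by
  simp [UU, LinearMap.mem_ker]

theorem ppi_mem {n : ℕ} (g : Perm (Fin n)) (v : Fin n → ℂ) (hv : v ∈ UU n) : ppi n g v ∈ UU n := by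
  rw [mem_UU] at *
  rw [← hv]
  exact Equiv.sum_comp g⁻¹ v

def std (n : ℕ) : Perm (Fin n) →* (UU n →ₗ[ℂ] UU n) where
  toFun g := (ppi n g).restrict (ppi_mem g)
  map_one' := by ext v i; rfl
  map_mul' g h := by ext v i; change ppi n (g * h) v i = ppi n g (ppi n h v) i; rw [map_mul]; rfl

theorem std_coe {n : ℕ} (g : Perm (Fin n)) (v : UU n) : ((std n g v : UU n) : Fin n → ℂ) = ppi n g v := rfl

theorem tr_ppi {n : ℕ} (g : Perm (Fin n)) : LinearMap.trace ℂ _ (ppi n g) = ∑ i, if g i = i then (1 : ℂ) else 0 := by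
  rw [LinearMap.trace_eq_matrix_trace ℂ (Pi.basisFun ℂ (Fin n))]
  unfold Matrix.trace
  refine Finset.sum_congr rfl fun i _ => ?_
  rw [Matrix.diag_apply, LinearMap.toMatrix_apply]
  simp only [Pi.basisFun_apply, Pi.basisFun_repr, ppi_apply, Pi.single_apply]
  refine if_congr ?_ rfl rfl
  rw [Perm.inv_eq_iff_eq, eq_comm]

def JJ (n : ℕ) : (Fin n → ℂ) →ₗ[ℂ] (Fin n → ℂ) :=
  LinearMap.pi fun _ => (n : ℂ)⁻¹ • ∑ i, LinearMap.proj (R := ℂ) (φ := fun _ : Fin n => ℂ) i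

theorem JJ_apply {n : ℕ} (v) (i) : JJ n v i = (n : ℂ)⁻¹ * ∑ j, v j := by
  simp [JJ]

def qq (n : ℕ) (hn : n ≠ 0) : (Fin n → ℂ) →ₗ[ℂ] UU n :=
  LinearMap.codRestrict (UU n) (1 - JJ n) (fun v => by
    rw [mem_UU]
    simp only [LinearMap.sub_apply, Module.End.one_apply, Pi.sub_apply, JJ_apply, Finset.sum_sub_distrib, Finset.sum_const, Finset.card_univ, Fintype.card_fin, nsmul_eq_mul]
    rw [mul_inv_cancel_left₀ (by exact_mod_cast hn), sub_self])

theorem tr_std {n : ℕ} (hn : n ≠ 0) (g : Perm (Fin n)) :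
    LinearMap.trace ℂ _ (std n g) = (∑ i, if g i = i then (1 : ℂ) else 0) - 1 := by
  have hn' : (n : ℂ) ≠ 0 := by exact_mod_cast hn
  have e1 : std n g = qq n hn ∘ₗ (ppi n g ∘ₗ (UU n).subtype) := by
    ext v i
    have := mem_UU.1 (ppi_mem g v v.2)
    change _ = (ppi n g v - JJ n (ppi n g v)) i
    rw [Pi.sub_apply, JJ_apply, this, mul_zero, sub_zero]; rfl
  have e2 : (ppi n g ∘ₗ (UU n).subtype) ∘ₗ qq n hn = ppi n g - JJ n := by
    ext v i
    simp only [LinearMap.comp_apply]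
    change (ppi n g (_ - JJ n _)) i = _
    rw [map_sub]
    simp only [LinearMap.comp_apply, LinearMap.sub_apply, Pi.sub_apply, ppi_apply, JJ_apply]
    rfl
  have e3 : LinearMap.trace ℂ _ (JJ n) = 1 := by
    rw [LinearMap.trace_eq_matrix_trace ℂ (Pi.basisFun ℂ (Fin n))]
    unfold Matrix.trace
    simp only [Matrix.diag_apply, LinearMap.toMatrix_apply, Pi.basisFun_apply, Pi.basisFun_repr, JJ_apply]
    simp [hn']
  rw [e1, LinearMap.trace_comp_comm', e2, map_sub, e3, tr_ppi]

theorem std_irr {n : ℕ} (hn : 5 ≤ n) : Irr (std n) := by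
  let e : Fin n → Fin n → (Fin n → ℂ) := fun a b => Pi.single a 1 - Pi.single b 1
  have he : ∀ a b, e a b ∈ UU n := fun a b => by
    rw [mem_UU]; simp [e]
  have hpe : ∀ g a b, ppi n g (e a b) = e (g a) (g b) := by
    intro g a b
    ext i
    rw [ppi_apply]
    simp only [e, Pi.sub_apply, Pi.single_apply, Perm.inv_eq_iff_eq]
  constructor
  · refine ⟨⟨⟨e ⟨0, by omega⟩ ⟨1, by omega⟩, he _ _⟩, 0, fun h => ?_⟩⟩
    have := congr_fun (congrArg Subtype.val h) ⟨0, by omega⟩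
    simp [e, Pi.single_apply] at this
  intro U hU
  by_cases hb : U = ⊥
  · exact Or.inl hb
  right
  obtain ⟨v, hv, hv0⟩ := U.ne_bot_iff.1 hb
  obtain ⟨a, b, hab⟩ : ∃ a b, v.1 a ≠ v.1 b := by
    by_contra hc
    push Not at hc
    apply hv0
    ext i
    have h1 := mem_UU.1 v.2
    rw [Finset.sum_congr rfl (fun j _ => hc j i)] at h1
    simp at h1
    rcases h1 with h1 | h1
    · omega
    · simpa using h1
  have hne : a ≠ b := fun h => hab (by rw [h])
  have h1 : (⟨e b a, he b a⟩ : UU n) ∈ U := by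
    have h2 := U.smul_mem (v.1 b - v.1 a)⁻¹ (U.sub_mem hv (hU (swap a b) v hv))
    convert h2 using 1
    ext i
    change e b a i = (v.1 b - v.1 a)⁻¹ * (v.1 i - v.1 ((swap a b)⁻¹ i))
    rw [swap_inv]
    have hd : v.1 b - v.1 a ≠ 0 := sub_ne_zero.2 hab.symm
    by_cases hia : i = a
    · subst hia
      rw [swap_apply_left]
      simp [e, Pi.single_apply, hne]
      field_simp
      ring
    · by_cases hib : i = b
      · subst hib
        rw [swap_apply_right]
        simp [e, Pi.single_apply, hia]
        field_simp
      · rw [swap_apply_of_ne_of_ne hia hib]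
        simp [e, Pi.single_apply, hia, hib]
  have h2 : ∀ x, (⟨e x a, he x a⟩ : UU n) ∈ U := by
    intro x
    by_cases hx : x = a
    · subst hx
      convert U.zero_mem
      simp [e]
    · have h3 := hU (swap b x) _ h1
      convert h3 using 1
      ext1
      rw [std_coe, hpe, swap_apply_left, swap_apply_of_ne_of_ne hne (Ne.symm hx)]
  rw [eq_top_iff]
  intro w _
  have : w = ∑ x, w.1 x • (⟨e x a, he x a⟩ : UU n) := by
    ext i
    have hw := mem_UU.1 w.2
    rw [AddSubmonoidClass.coe_finset_sum, Finset.sum_apply]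
    simp only [e, SetLike.val_smul, Pi.smul_apply, Pi.sub_apply, smul_eq_mul, mul_sub, Finset.sum_sub_distrib, ← Finset.sum_mul, hw]
    simp [Pi.single_apply]
  rw [this]
  exact U.sum_mem fun x _ => U.smul_mem _ (h2 x)

theorem sgn_fix_pow {n l : ℕ} (hl : l + 2 ≤ n) : ∑ g : Perm (Fin n), (∑ i, if g i = i then (1 : ℂ) else 0) ^ l * sg g = 0 := by
  simp only [Fintype.sum_pow, Finset.sum_mul]
  rw [Finset.sum_comm]
  refine Finset.sum_eq_zero fun t _ => ?_
  have hc : 1 < ((Finset.univ.image t)ᶜ).card := by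
    have := Finset.card_image_le (s := Finset.univ) (f := t)
    rw [Finset.card_compl]
    simp at this ⊢
    omega
  obtain ⟨x, hx, y, hy, hxy⟩ := Finset.one_lt_card.1 hc
  have e : ∑ g : Perm (Fin n), (∏ i, if g (t i) = t i then (1 : ℂ) else 0) * sg g = - ∑ g : Perm (Fin n), (∏ i, if g (t i) = t i then (1 : ℂ) else 0) * sg g := by
    rw [← Finset.sum_neg_distrib]
    refine Fintype.sum_equiv (Equiv.mulRight (swap x y)) _ _ fun g => ?_
    rw [Equiv.coe_mulRight, sg_mul]
    have : sg (swap x y) = -1 := by simp [sg, Perm.sign_swap hxy]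
    rw [this, mul_neg_one, mul_neg, neg_neg]
    congr 1
    refine Finset.prod_congr rfl fun i _ => ?_
    rw [Perm.mul_apply, swap_apply_of_ne_of_ne]
    · rintro rfl; simp at hx
    · rintro rfl; simp at hy
  exact self_eq_neg.1 e

theorem lower {n : ℕ} (hn : 5 ≤ n) : ∃ V : FDRep ℂ (Perm (Fin n)), CategoryTheory.Simple V ∧ 1 < V.character 1 ∧
    ∃ W : FDRep ℂ (Perm (Fin n)), CategoryTheory.Simple W ∧ ∀ j, j + 2 ≤ n →
      ∑ g, (V.character ^ j) g * (starRingEnd ℂ) (W.character g) = 0 := by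
  have hV : ∀ g, (FDRep.of (std n)).character g = (∑ i, if g i = i then (1 : ℂ) else 0) - 1 := fun g => tr_std (by omega) g
  have hW : ∀ g, (FDRep.of (sgr n)).character g = sg g := fun g => by
    change LinearMap.trace ℂ _ (sg g • 1) = sg g
    rw [map_smul, LinearMap.trace_one]; simp
  refine ⟨FDRep.of (std n), simple_of_irr _ (std_irr hn), ?_, FDRep.of (sgr n), simple_of_irr _ ?_, ?_⟩
  · rw [hV]
    simp only [Perm.one_apply, if_true, Finset.sum_const, Finset.card_univ, Fintype.card_fin, nsmul_eq_mul, mul_one]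
    rw [lt_sub_iff_add_lt]
    exact_mod_cast (by omega : 1 + 1 < n)
  · exact ⟨inferInstance, fun U _ => eq_bot_or_eq_top U⟩
  · intro j hj
    have : ∀ g : Perm (Fin n), ((FDRep.of (std n)).character ^ j) g * (starRingEnd ℂ) ((FDRep.of (sgr n)).character g) =
      ∑ l ∈ Finset.range (j + 1), ((-1) ^ (j - l) * (j.choose l : ℂ)) * ((∑ i, if g i = i then (1 : ℂ) else 0) ^ l * sg g) := by
      intro g
      have hs : (starRingEnd ℂ) (sg g) = sg g := by simp [sg]
      rw [Pi.pow_apply, hV, hW, hs, sub_eq_add_neg, add_pow, Finset.sum_mul]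
      refine Finset.sum_congr rfl fun l _ => ?_
      ring
    simp only [this]
    rw [Finset.sum_comm]
    refine Finset.sum_eq_zero fun l hl => ?_
    rw [← Finset.mul_sum, sgn_fix_pow (by rw [Finset.mem_range] at hl; omega), mul_zero]

end low
end SymCov

/-- For `n > 4` and `k ≥ 1`: `k ≥ n - 1` iff every irreducible character of `S_n` is a
constituent of some `χ^j`, `1 ≤ j ≤ k`, for every irreducible `χ` with `χ(1) > 1`. -/
theorem symmetricGroup_covering_number_d (n : ℕ) (hn : 4 < n) (k : ℕ) (hk : 0 < k) :
    n - 1 ≤ k ↔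
      ∀ χ : Equiv.Perm (Fin n) → ℂ, IsIrredChar (Equiv.Perm (Fin n)) χ → 1 < χ 1 →
        ∀ θ : Equiv.Perm (Fin n) → ℂ, IsIrredChar (Equiv.Perm (Fin n)) θ →
          ∃ j : ℕ, 1 ≤ j ∧ j ≤ k ∧ charInner (Equiv.Perm (Fin n)) (χ ^ j) θ ≠ 0 := by
  have hc : ((Fintype.card (Equiv.Perm (Fin n)) : ℂ))⁻¹ ≠ 0 :=
    inv_ne_zero (by exact_mod_cast Fintype.card_ne_zero)
  constructor
  · rintro hk2 _ ⟨V, hV, rfl⟩ h1 _ ⟨W, hW, rfl⟩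
    obtain ⟨j, hj1, hj2, hj3⟩ := SymCov.upper_of_cov n hn
      (fun V _ _ _ ρ h => SymCov.all_cov (by rw [Fintype.card_fin]; omega) ρ h) V hV h1 W hW
    exact ⟨j, hj1, hj2.trans hk2, mul_ne_zero hc hj3⟩
  · intro H
    by_contra hlt
    obtain ⟨V, hV, h1, W, hW, h0⟩ := SymCov.lower (n := n) hn
    obtain ⟨j, hj1, hj2, hj3⟩ := H _ ⟨V, hV, rfl⟩ h1 _ ⟨W, hW, rfl⟩
    apply hj3
    unfold charInner
    rw [h0 j (by omega), mul_zero]
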